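/- arXiv:1911.10083 — 9 statements merged into one kernel-verified Lean document; each statement's English description precedes it below -/
import Mathlib

section
/- Let π = (π_i)_{i≥0} be a probability distribution on the nonnegative integers with Σ_k k²π_k < ∞ that is supercritical, i.e. its generating function f satisfies f″(1) > f′(1). If the system (S′) has a unique solution defined on a maximal interval [0, t′_max) for some t′_max > 0, then the system (S) has a unique solution defined on a maximal interval [0, t_max) for some t_max > 0. -/
open Set

/-- First moment `∑ⱼ j zⱼ` of a sequence. -/
noncomputable def Emom (z : ℕ → ℝ) : ℝ := ∑' j : ℕ, (j : ℝ) * z j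

/-- Second factorial moment `∑ⱼ j (j-1) zⱼ` of a sequence. -/
noncomputable def Qmom (z : ℕ → ℝ) : ℝ := ∑' j : ℕ, (j : ℝ) * ((j : ℝ) - 1) * z j

/-- Size-biased generating series `ĝ_z(s) = (∑ᵢ i zᵢ s^(i-1)) / (∑ⱼ j zⱼ)`. -/
noncomputable def ghat (z : ℕ → ℝ) (s : ℝ) : ℝ :=
  (∑' i : ℕ, (i : ℝ) * z i * s ^ (i - 1)) / Emom z

/-- Right-hand side `f_i(z)` of the system (S), where `ρ` is the largest solution in `[0,1]`
of `1 - ρ = ĝ_z(1 - ρ)`. -/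
noncomputable def fS (z : ℕ → ℝ) (ρ : ℝ) (i : ℕ) : ℝ :=
  -(1 / ρ) * ((i : ℝ) * z i / Emom z)
    + (1 / ρ) * (1 - Qmom z / Emom z)
      * (((i : ℝ) * z i - ((i : ℝ) + 1) * z (i + 1)) / Emom z)

/-- `z` (together with the family of fixed points `ρ t`) is a solution of the system (S)
on `[0, tmax)` with initial condition `π`. -/
def IsSolS (π : ℕ → ℝ) (tmax : ℝ) (z : ℕ → ℝ → ℝ) (ρ : ℝ → ℝ) : Prop :=
  (∀ i, z i 0 = π i) ∧
  ∀ t ∈ Ico (0 : ℝ) tmax,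
    (∀ i, 0 ≤ z i t) ∧
    Summable (fun i => z i t) ∧ (∑' i : ℕ, z i t) ≤ 1 ∧
    Summable (fun i : ℕ => (i : ℝ) * z i t) ∧ 0 < Emom (fun i => z i t) ∧
    Summable (fun i : ℕ => (i : ℝ) * ((i : ℝ) - 1) * z i t) ∧
    IsGreatest {r | r ∈ Icc (0 : ℝ) 1 ∧ 1 - r = ghat (fun i => z i t) (1 - r)} (ρ t) ∧
    ∀ i, HasDerivWithinAt (fun u => z i u) (fS (fun j => z j t) (ρ t) i) (Ico (0 : ℝ) tmax) t

/-- `ζ` is a solution of the (time-changed) system (S′) on `[0, T)` with initial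
condition `π`:  `ζᵢ'(t) = -i ζᵢ/E + (1/E)(1 - Q/E)(i ζᵢ - (i+1) ζᵢ₊₁)` where
`E(t) = ∑ⱼ j ζⱼ(t)` and `Q(t) = ∑ⱼ j(j-1) ζⱼ(t)`. -/
def IsSolS' (π : ℕ → ℝ) (T : ℝ) (ζ : ℕ → ℝ → ℝ) : Prop :=
  (∀ i, ζ i 0 = π i) ∧
  ∀ t ∈ Ico (0 : ℝ) T,
    (∀ i, 0 ≤ ζ i t) ∧
    Summable (fun i => ζ i t) ∧
    Summable (fun i : ℕ => (i : ℝ) * ζ i t) ∧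
    Summable (fun i : ℕ => (i : ℝ) * ((i : ℝ) - 1) * ζ i t) ∧
    0 < Emom (fun i => ζ i t) ∧
    ∀ i : ℕ, HasDerivWithinAt (fun u => ζ i u)
      (-(i : ℝ) * ζ i t / Emom (fun j => ζ j t)
        + (1 / Emom (fun j => ζ j t))
          * (1 - Qmom (fun j => ζ j t) / Emom (fun j => ζ j t))
          * ((i : ℝ) * ζ i t - ((i : ℝ) + 1) * ζ (i + 1) t))
      (Ico (0 : ℝ) T) t

namespace DegreeFlow

open Filter Topology MeasureTheory

/-- The power series `∑ₖ cₖ sᵏ`. -/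
noncomputable def powSum (c : ℕ → ℝ) (s : ℝ) : ℝ := ∑' k : ℕ, c k * s ^ k

/-- Coefficients of the formal derivative of a power series. -/
def dcoef (c : ℕ → ℝ) (k : ℕ) : ℝ := ((k : ℝ) + 1) * c (k + 1)

/-- Coefficients of the formal expansion at `b` of the power series with coefficients `c`,
in the variable rescaled by `a`. -/
noncomputable def shift (c : ℕ → ℝ) (a b : ℝ) (i : ℕ) : ℝ :=
  a ^ i * powSum (fun j => c (i + j) * ((i + j).choose i : ℝ)) b

lemma dcoef_nonneg {c : ℕ → ℝ} (hc : ∀ k, 0 ≤ c k) (k : ℕ) : 0 ≤ dcoef c k :=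
  mul_nonneg (by positivity) (hc _)

lemma summable_mul_pow_of_mem_Icc {c : ℕ → ℝ} (hc : ∀ k, 0 ≤ c k) (hs : Summable c) {s : ℝ}
    (h : s ∈ Icc (0 : ℝ) 1) : Summable fun k => c k * s ^ k :=
  hs.of_nonneg_of_le (fun k => mul_nonneg (hc k) (pow_nonneg h.1 k))
    fun k => mul_le_of_le_one_right (hc k) (pow_le_one₀ h.1 h.2)

lemma powSum_one (c : ℕ → ℝ) : powSum c 1 = ∑' k, c k := by simp [powSum]

lemma powSum_nonneg {c : ℕ → ℝ} (hc : ∀ k, 0 ≤ c k) {s : ℝ} (hs : 0 ≤ s) : 0 ≤ powSum c s :=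
  tsum_nonneg fun k => mul_nonneg (hc k) (pow_nonneg hs k)

lemma powSum_mono {c : ℕ → ℝ} (hc : ∀ k, 0 ≤ c k) (hs : Summable c) {s t : ℝ} (h0 : 0 ≤ s)
    (hst : s ≤ t) (h1 : t ≤ 1) : powSum c s ≤ powSum c t :=
  (summable_mul_pow_of_mem_Icc hc hs ⟨h0, hst.trans h1⟩).tsum_le_tsum
    (fun k => mul_le_mul_of_nonneg_left (pow_le_pow_left₀ h0 hst k) (hc k))
    (summable_mul_pow_of_mem_Icc hc hs ⟨h0.trans hst, h1⟩)

lemma powSum_continuousOn {c : ℕ → ℝ} (hc : ∀ k, 0 ≤ c k) (hs : Summable c) :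
    ContinuousOn (powSum c) (Icc 0 1) := by
  refine continuousOn_tsum (fun k => by fun_prop) hs fun k s h => ?_
  rw [Real.norm_of_nonneg (mul_nonneg (hc k) (pow_nonneg h.1 k))]
  exact mul_le_of_le_one_right (hc k) (pow_le_one₀ h.1 h.2)

lemma powSum_convexOn {c : ℕ → ℝ} (hc : ∀ k, 0 ≤ c k) (hs : Summable c) :
    ConvexOn ℝ (Icc 0 1) (powSum c) := by
  refine ⟨convex_Icc 0 1, fun x hx y hy a b ha hb hab => ?_⟩
  have hz := convex_Icc (0 : ℝ) 1 hx hy ha hb hab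
  have hsx := summable_mul_pow_of_mem_Icc hc hs hx
  have hsy := summable_mul_pow_of_mem_Icc hc hs hy
  simp only [smul_eq_mul, powSum] at hz ⊢
  rw [← tsum_mul_left, ← tsum_mul_left, ← (hsx.mul_left a).tsum_add (hsy.mul_left b)]
  refine (summable_mul_pow_of_mem_Icc hc hs hz).tsum_le_tsum (fun k => ?_)
    ((hsx.mul_left a).add (hsy.mul_left b))
  have := (convexOn_pow k).2 (mem_Ici.2 hx.1) (mem_Ici.2 hy.1) ha hb hab
  simp only [smul_eq_mul] at this
  nlinarith [mul_le_mul_of_nonneg_left this (hc k)]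

lemma abs_pow_sub_pow_le {x y r : ℝ} (hx : x ∈ Icc 0 r) (hy : y ∈ Icc 0 r) (k : ℕ) :
    |y ^ (k + 1) - x ^ (k + 1)| ≤ ((k : ℝ) + 1) * r ^ k * |y - x| := by
  have := Convex.norm_image_sub_le_of_norm_hasDerivWithin_le (f := fun z : ℝ => z ^ (k + 1))
    (f' := fun z => ((k : ℝ) + 1) * z ^ k) (s := Icc 0 r) (C := ((k : ℝ) + 1) * r ^ k)
    (fun z _ => by simpa using (hasDerivAt_pow (k + 1) z).hasDerivWithinAt)
    (fun z hz => by
      rw [Real.norm_of_nonneg (mul_nonneg (by positivity) (pow_nonneg hz.1 k))]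
      gcongr
      · exact hz.1
      · exact hz.2) (convex_Icc 0 r) hx hy
  simpa using this

/-- Termwise differentiation on a closed interval up to the end point. -/
lemma powSum_hasDerivWithinAt {c : ℕ → ℝ} (hc : ∀ k, 0 ≤ c k) {r : ℝ}
    (hs : Summable fun k => c k * r ^ k) (hd : Summable fun k => dcoef c k * r ^ k) {x : ℝ}
    (hx : x ∈ Icc 0 r) :
    HasDerivWithinAt (powSum c) (powSum (dcoef c) x) (Icc 0 r) x := by
  have hsum : ∀ y ∈ Icc 0 r, Summable fun k => c k * y ^ k := fun y hy =>
    hs.of_nonneg_of_le (fun k => mul_nonneg (hc k) (pow_nonneg hy.1 k))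
      fun k => mul_le_mul_of_nonneg_left (pow_le_pow_left₀ hy.1 hy.2 k) (hc k)
  rw [hasDerivWithinAt_iff_tendsto_slope]
  have key : Tendsto (fun y => ∑' k, c (k + 1) * slope (fun z : ℝ => z ^ (k + 1)) x y)
      (𝓝[Icc 0 r \ {x}] x) (𝓝 (powSum (dcoef c) x)) := by
    refine tendsto_tsum_of_dominated_convergence hd (fun k => ?_) ?_
    · have h := (hasDerivAt_pow (k + 1) x).hasDerivWithinAt (s := Icc 0 r)
      rw [hasDerivWithinAt_iff_tendsto_slope] at h
      have := h.const_mul (c (k + 1))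
      convert this using 2
      simp only [dcoef, Nat.cast_add, Nat.cast_one, Nat.add_sub_cancel]
      ring
    · filter_upwards [self_mem_nhdsWithin] with y hy k
      have hne : |y - x| ≠ 0 := abs_ne_zero.2 (sub_ne_zero.2 hy.2)
      have := abs_pow_sub_pow_le hx hy.1 k
      rw [slope_def_field, norm_mul, Real.norm_of_nonneg (hc _), Real.norm_eq_abs, abs_div, dcoef]
      have h2 : |y ^ (k + 1) - x ^ (k + 1)| / |y - x| ≤ ((k : ℝ) + 1) * r ^ k :=
        (div_le_iff₀ (lt_of_le_of_ne (abs_nonneg _) hne.symm)).2 this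
      nlinarith [mul_le_mul_of_nonneg_left h2 (hc (k + 1))]
  refine key.congr' ?_
  filter_upwards [self_mem_nhdsWithin] with y hy
  rw [slope_def_field, powSum, powSum, ← (hsum y hy.1).tsum_sub (hsum x hx), ← tsum_div_const,
    Summable.tsum_eq_zero_add (((hsum y hy.1).sub (hsum x hx)).div_const _)]
  simp only [pow_zero, sub_self, zero_div, zero_add]
  refine tsum_congr fun k => ?_
  rw [slope_def_field]
  ring

lemma powSum_hasDerivWithinAt_unit {c : ℕ → ℝ} (hc : ∀ k, 0 ≤ c k) (hs : Summable c)
    (hd : Summable (dcoef c)) {x : ℝ} (hx : x ∈ Icc (0 : ℝ) 1) :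
    HasDerivWithinAt (powSum c) (powSum (dcoef c) x) (Icc 0 1) x :=
  powSum_hasDerivWithinAt hc (by simpa using hs) (by simpa using hd) hx

lemma powSum_one_sub_le {c : ℕ → ℝ} (hc : ∀ k, 0 ≤ c k) (hs : Summable c)
    (hd : Summable (dcoef c)) {s : ℝ} (h : s ∈ Icc (0 : ℝ) 1) :
    powSum c 1 - powSum c s ≤ (1 - s) * powSum (dcoef c) 1 := by
  have hsum := summable_mul_pow_of_mem_Icc hc hs h
  rw [powSum_one, powSum_one, powSum, ← hs.tsum_sub hsum, ← tsum_mul_left,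
    (hs.sub hsum).tsum_eq_zero_add]
  simp only [pow_zero, mul_one, sub_self, zero_add]
  refine ((summable_nat_add_iff 1).2 (hs.sub hsum)).tsum_le_tsum (fun k => ?_) (hd.mul_left _)
  have := one_add_mul_le_pow (a := s - 1) (by linarith [h.1]) (k + 1)
  simp only [dcoef]
  push_cast at this
  rw [add_sub_cancel] at this
  nlinarith [mul_le_mul_of_nonneg_left this (hc (k + 1))]

/-- A power series with summable coefficients vanishing on `[0, 1)` has zero coefficients. -/
lemma eq_zero_of_powSum_eq_zero {d : ℕ → ℝ} (hd : Summable fun k => |d k|)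
    (h : ∀ s ∈ Ico (0 : ℝ) 1, powSum d s = 0) (i : ℕ) : d i = 0 := by
  induction i using Nat.strong_induction_on with
  | _ m ih =>
    have hcont : ContinuousOn (fun s : ℝ => ∑' k, d (k + m) * s ^ k) (Icc (-1) 1) := by
      refine continuousOn_tsum (fun k => by fun_prop) ((summable_nat_add_iff m).2 hd)
        fun k s hs => ?_
      rw [norm_mul, norm_pow]
      exact mul_le_of_le_one_right (abs_nonneg _)
        (pow_le_one₀ (norm_nonneg _) (abs_le.2 hs))
    have hz : ∀ s ∈ Ioo (0 : ℝ) 1, ∑' k, d (k + m) * s ^ k = 0 := by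
      intro s hs
      have hsum : Summable fun k => d k * s ^ k := by
        refine Summable.of_norm_bounded hd fun k => ?_
        rw [norm_mul, norm_pow]
        exact mul_le_of_le_one_right (abs_nonneg _)
          (pow_le_one₀ (norm_nonneg _) (abs_le.2 ⟨by linarith [hs.1], hs.2.le⟩))
      have h1 := h s ⟨hs.1.le, hs.2⟩
      rw [powSum, ← hsum.sum_add_tsum_nat_add m,
        Finset.sum_eq_zero fun j hj => by rw [ih j (Finset.mem_range.1 hj), zero_mul],
        zero_add] at h1
      have h2 : ∑' k, d (k + m) * s ^ (k + m) = s ^ m * ∑' k, d (k + m) * s ^ k := by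
        rw [← tsum_mul_left]
        exact tsum_congr fun k => by ring
      rw [h2] at h1
      exact (mul_eq_zero.1 h1).resolve_left (pow_pos hs.1 m).ne'
    have ht : Tendsto (fun s : ℝ => ∑' k, d (k + m) * s ^ k) (𝓝[>] 0)
        (𝓝 (∑' k, d (k + m) * (0 : ℝ) ^ k)) :=
      ((hcont.continuousAt (Icc_mem_nhds (by norm_num) (by norm_num))).tendsto).mono_left
        nhdsWithin_le_nhds
    have h0 : Tendsto (fun s : ℝ => ∑' k, d (k + m) * s ^ k) (𝓝[>] 0) (𝓝 0) := by
      refine tendsto_const_nhds.congr' ?_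
      filter_upwards [Ioo_mem_nhdsGT (zero_lt_one' ℝ)] with s hs
      exact (hz s hs).symm
    have := tendsto_nhds_unique ht h0
    rwa [tsum_eq_single 0 (fun k hk => by simp [hk]), pow_zero, mul_one, zero_add] at this

lemma shift_nonneg {c : ℕ → ℝ} (hc : ∀ k, 0 ≤ c k) {a b : ℝ} (ha : 0 ≤ a) (hb : 0 ≤ b) (i : ℕ) :
    0 ≤ shift c a b i :=
  mul_nonneg (pow_nonneg ha i)
    (powSum_nonneg (fun _ => mul_nonneg (hc _) (Nat.cast_nonneg _)) hb)

lemma hasSum_shift {c : ℕ → ℝ} (hc : ∀ k, 0 ≤ c k) (hs : Summable c) {a b s : ℝ} (ha : 0 ≤ a)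
    (hb : 0 ≤ b) (hab : a + b ≤ 1) (h : s ∈ Icc (0 : ℝ) 1) :
    HasSum (fun i => shift c a b i * s ^ i) (powSum c (a * s + b)) := by
  set F : ℕ × ℕ → ℝ := fun p => c (p.1 + p.2) * ((p.1 + p.2).choose p.1 : ℝ) *
    ((a * s) ^ p.1 * b ^ p.2) with hF
  have has : 0 ≤ a * s := mul_nonneg ha h.1
  have hF0 : ∀ p, 0 ≤ F p := fun p =>
    mul_nonneg (mul_nonneg (hc _) (Nat.cast_nonneg _))
      (mul_nonneg (pow_nonneg has _) (pow_nonneg hb _))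
  have hy : a * s + b ∈ Icc (0 : ℝ) 1 :=
    ⟨by positivity, by nlinarith [mul_le_mul_of_nonneg_left h.2 ha]⟩
  have hrow : ∀ n, ∑ p ∈ Finset.HasAntidiagonal.antidiagonal n, F p = c n * (a * s + b) ^ n := by
    intro n
    rw [(Commute.all (a * s) b).add_pow', Finset.mul_sum]
    refine Finset.sum_congr rfl fun p hp => ?_
    rw [Finset.HasAntidiagonal.mem_antidiagonal] at hp
    simp only [hF, hp, nsmul_eq_mul]
    ring
  have hsig : HasSum (fun x : (n : ℕ) × Finset.HasAntidiagonal.antidiagonal n => F x.2)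
      (powSum c (a * s + b)) := by
    have hfib : ∀ n, HasSum (fun p : Finset.HasAntidiagonal.antidiagonal n => F p)
        (c n * (a * s + b) ^ n) := by
      intro n
      rw [← hrow n, ← Finset.sum_coe_sort]
      exact hasSum_fintype _
    refine HasSum.sigma_of_hasSum (summable_mul_pow_of_mem_Icc hc hs hy).hasSum hfib ?_
    refine (summable_sigma_of_nonneg fun x => hF0 _).2 ⟨fun n => (hfib n).summable, ?_⟩
    simp_rw [(hfib _).tsum_eq]
    exact summable_mul_pow_of_mem_Icc hc hs hy
  have hprod : HasSum F (powSum c (a * s + b)) := by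
    rw [← Finset.HasAntidiagonal.sigmaAntidiagonalEquivProd.hasSum_iff]
    exact hsig
  have hterm : ∀ i, ∑' j, F (i, j) = shift c a b i * s ^ i := by
    intro i
    rw [shift, powSum, mul_assoc, mul_comm _ (s ^ i), ← mul_assoc, ← mul_pow, ← tsum_mul_left]
    exact tsum_congr fun j => by simp only [hF]; ring
  have := hprod.prod_fiberwise fun i => (hprod.summable.prod_factor i).hasSum
  simpa only [hterm] using this

lemma summable_shift {c : ℕ → ℝ} (hc : ∀ k, 0 ≤ c k) (hs : Summable c) {a b : ℝ} (ha : 0 ≤ a)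
    (hb : 0 ≤ b) (hab : a + b ≤ 1) : Summable (shift c a b) := by
  simpa using (hasSum_shift hc hs ha hb hab (s := 1) (by simp)).summable

lemma powSum_shift {c : ℕ → ℝ} (hc : ∀ k, 0 ≤ c k) (hs : Summable c) {a b s : ℝ} (ha : 0 ≤ a)
    (hb : 0 ≤ b) (hab : a + b ≤ 1) (h : s ∈ Icc (0 : ℝ) 1) :
    powSum (shift c a b) s = powSum c (a * s + b) :=
  (hasSum_shift hc hs ha hb hab h).tsum_eq

lemma succ_mul_choose (i j : ℕ) :
    ((i : ℝ) + 1) * ((i + 1 + j).choose (i + 1) : ℝ)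
      = ((i : ℝ) + j + 1) * ((i + j).choose i : ℝ) := by
  have := Nat.add_one_mul_choose_eq (i + j) i
  rw [show i + 1 + j = i + j + 1 by ring]
  have h2 : ((i + j + 1 : ℕ) : ℝ) * ((i + j).choose i : ℝ)
      = ((i + j + 1).choose (i + 1) : ℝ) * ((i + 1 : ℕ) : ℝ) := by exact_mod_cast this
  push_cast at h2
  linarith

lemma dcoef_shift (c : ℕ → ℝ) (a b : ℝ) :
    dcoef (shift c a b) = fun i => a * shift (dcoef c) a b i := by
  funext i
  simp only [dcoef, shift, powSum]
  rw [pow_succ, mul_left_comm, mul_assoc, mul_left_comm a (a ^ i)]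
  simp only [← tsum_mul_left]
  refine tsum_congr fun j => ?_
  have := succ_mul_choose i j
  rw [show i + j + 1 = i + 1 + j by ring]
  push_cast
  linear_combination (a ^ i * a * c (i + 1 + j) * b ^ j) * this

lemma dcoef_expansion (c : ℕ → ℝ) (i : ℕ) :
    dcoef (fun j => c (i + j) * ((i + j).choose i : ℝ))
      = fun j => ((i : ℝ) + 1) * (c (i + 1 + j) * ((i + 1 + j).choose (i + 1) : ℝ)) := by
  funext j
  simp only [dcoef]
  have h := succ_mul_choose i j
  have h' := succ_mul_choose j i
  have e1 : (i + (j + 1)).choose i = (j + 1 + i).choose (j + 1) := by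
    rw [add_comm i, ← Nat.choose_symm_add]
  have e2 : (j + i).choose j = (i + j).choose i := by
    rw [add_comm j, ← Nat.choose_symm_add]
  rw [e1, show i + (j + 1) = i + 1 + j by ring]
  rw [e2] at h'
  linear_combination (c (i + 1 + j)) * h' - (c (i + 1 + j)) * h

lemma expansion_hasDerivWithinAt {c : ℕ → ℝ} (hc : ∀ k, 0 ≤ c k) (hs : Summable c) (i : ℕ) {b : ℝ}
    (hb : 0 ≤ b) (hb1 : b < 1) :
    HasDerivWithinAt (powSum fun j => c (i + j) * ((i + j).choose i : ℝ))
      (((i : ℝ) + 1) * powSum (fun j => c (i + 1 + j) * ((i + 1 + j).choose (i + 1) : ℝ)) b)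
      (Ici 0) b := by
  obtain ⟨r, hbr, hr1⟩ := exists_between hb1
  have hr0 : 0 ≤ r := hb.trans hbr.le
  have hcoef : ∀ i, Summable fun j => c (i + j) * ((i + j).choose i : ℝ) * r ^ j := by
    intro i
    have h := summable_choose_mul_geometric_of_norm_lt_one i (r := r)
      (by rwa [Real.norm_of_nonneg hr0])
    refine (h.mul_left (∑' k, c k)).of_nonneg_of_le (fun j => ?_) fun j => ?_
    · exact mul_nonneg (mul_nonneg (hc _) (Nat.cast_nonneg _)) (pow_nonneg hr0 _)
    · rw [mul_assoc, add_comm i j]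
      exact mul_le_mul_of_nonneg_right (hs.le_tsum _ fun _ _ => hc _) (by positivity)
  have h := powSum_hasDerivWithinAt (r := r)
    (fun j => mul_nonneg (hc (i + j)) (Nat.cast_nonneg ((i + j).choose i))) (hcoef i)
    (by
      rw [dcoef_expansion]
      simpa only [mul_assoc] using (hcoef (i + 1)).mul_left ((i : ℝ) + 1)) ⟨hb, hbr.le⟩
  rw [dcoef_expansion] at h
  simp only [powSum] at h ⊢
  rw [← tsum_mul_left]
  simp only [mul_assoc] at h ⊢
  refine h.mono_of_mem_nhdsWithin ?_
  rw [← Ici_inter_Iic]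
  exact inter_mem_nhdsWithin _ (Iic_mem_nhds hbr)

lemma shift_hasDerivWithinAt {c : ℕ → ℝ} (hc : ∀ k, 0 ≤ c k) (hs : Summable c) {a b : ℝ → ℝ}
    {a' b' t : ℝ} {S : Set ℝ} (ha : HasDerivWithinAt a a' S t) (hb : HasDerivWithinAt b b' S t)
    (hbS : ∀ u ∈ S, 0 ≤ b u) (htS : t ∈ S) (hb1 : b t < 1) (ha0 : a t ≠ 0) (i : ℕ) :
    HasDerivWithinAt (fun u => shift c (a u) (b u) i)
      (a' / a t * (i * shift c (a t) (b t) i)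
        + b' / a t * (((i : ℝ) + 1) * shift c (a t) (b t) (i + 1))) S t := by
  have h1 := (expansion_hasDerivWithinAt hc hs i (hbS t htS) hb1).comp t hb hbS
  have h2 := (ha.fun_pow i).mul h1
  refine h2.congr_deriv ?_
  simp only [shift, Function.comp]
  rcases i with _ | i
  · simp
    field_simp
  · push_cast
    simp only [pow_succ]
    field_simp

lemma tsum_eq_tsum_succ {u : ℕ → ℝ} (h : u 0 = 0) : ∑' k, u k = ∑' k, u (k + 1) := by
  refine ((add_left_injective 1).tsum_eq (f := u) fun k hk => ?_).symm
  rcases k with _ | k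
  · exact absurd h hk
  · exact ⟨k, rfl⟩

lemma emom_eq (z : ℕ → ℝ) : Emom z = powSum (dcoef z) 1 := by
  rw [Emom, tsum_eq_tsum_succ (by simp), powSum_one]
  simp [dcoef]

lemma qmom_eq (z : ℕ → ℝ) : Qmom z = powSum (dcoef (dcoef z)) 1 := by
  rw [Qmom, tsum_eq_tsum_succ (by simp), tsum_eq_tsum_succ (by simp), powSum_one]
  refine tsum_congr fun k => ?_
  simp only [dcoef]
  push_cast
  ring

lemma ghat_eq (z : ℕ → ℝ) (s : ℝ) : ghat z s = powSum (dcoef z) s / powSum (dcoef z) 1 := by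
  rw [ghat, emom_eq, tsum_eq_tsum_succ (by simp)]
  simp [dcoef, powSum]

lemma summable_dcoef_iff {z : ℕ → ℝ} :
    Summable (dcoef z) ↔ Summable fun i : ℕ => (i : ℝ) * z i := by
  rw [← summable_nat_add_iff (f := fun i : ℕ => (i : ℝ) * z i) 1]
  refine summable_congr fun k => ?_
  simp only [dcoef]
  push_cast
  ring

lemma summable_dcoef_dcoef_iff {z : ℕ → ℝ} :
    Summable (dcoef (dcoef z)) ↔ Summable fun i : ℕ => (i : ℝ) * ((i : ℝ) - 1) * z i := by
  rw [← summable_nat_add_iff (f := fun i : ℕ => (i : ℝ) * ((i : ℝ) - 1) * z i) 2]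
  refine summable_congr fun k => ?_
  simp only [dcoef]
  push_cast
  ring

/-- The survival parameters `r`, i.e. those for which `1 - r` is a fixed point of `g`. -/
def fixSet (g : ℝ → ℝ) : Set ℝ := {r | r ∈ Icc (0 : ℝ) 1 ∧ 1 - r = g (1 - r)}

/-- Properties of the normalised generating function used for its fixed points. -/
structure IsGen (g : ℝ → ℝ) : Prop where
  convex : ConvexOn ℝ (Icc 0 1) g
  cont : ContinuousOn g (Icc 0 1)
  one : g 1 = 1
  zero : 0 ≤ g 0

lemma IsGen.exists_isGreatest {g : ℝ → ℝ} (hg : IsGen g) : ∃ r, IsGreatest (fixSet g) r := by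
  have hcont : ContinuousOn (fun r => g (1 - r)) (Icc 0 1) :=
    hg.cont.comp (by fun_prop) fun r hr => ⟨by linarith [hr.2], by linarith [hr.1]⟩
  have hclosed : IsClosed (fixSet g) := by
    have := (ContinuousOn.sub (f := fun r : ℝ => 1 - r) (by fun_prop)
      hcont).preimage_isClosed_of_isClosed isClosed_Icc (isClosed_singleton (x := (0 : ℝ)))
    convert this using 1
    ext r
    simp [fixSet, sub_eq_zero]
  have hcomp : IsCompact (fixSet g) := isCompact_Icc.of_isClosed_subset hclosed fun r hr => hr.1
  exact hcomp.exists_isGreatest ⟨0, by simp [fixSet, hg.one]⟩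

lemma IsGen.lt_of_lt {g : ℝ → ℝ} (hg : IsGen g) {r s : ℝ} (hr : IsGreatest (fixSet g) r)
    (hs : s ∈ Icc (0 : ℝ) 1) (h : g s < s) : 1 - s < r := by
  have hcont : ContinuousOn (fun x => x - g x) (Icc 0 s) :=
    continuousOn_id.sub (hg.cont.mono (Icc_subset_Icc_right hs.2))
  obtain ⟨x, hx, hx0⟩ := intermediate_value_Icc hs.1 hcont
    (show (0 : ℝ) ∈ Icc (0 - g 0) (s - g s) from ⟨by linarith [hg.zero], by linarith⟩)
  have hne : x ≠ s := by
    rintro rfl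
    simp only at hx0
    linarith
  have hmem : 1 - x ∈ fixSet g := by
    refine ⟨⟨by linarith [hx.2, hs.2], by linarith [hx.1]⟩, ?_⟩
    simp only [sub_sub_cancel]
    simp only at hx0
    linarith
  have := hr.2 hmem
  have := lt_of_le_of_ne hx.2 hne
  linarith

lemma IsGen.chord {g : ℝ → ℝ} (hg : IsGen g) {x y : ℝ} (hx : x ∈ Icc (0 : ℝ) 1)
    (hy : y ∈ Icc (0 : ℝ) 1) (h1 : g x ≤ x) (h2 : g y ≤ y) {s : ℝ} (hxs : x ≤ s) (hsy : s ≤ y) :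
    g s ≤ s := by
  have : ConvexOn ℝ (Icc 0 1) (fun x => g x - x) :=
    hg.convex.sub (concaveOn_id (convex_Icc _ _))
  have hs := this.le_max_of_mem_Icc hx hy ⟨hxs, hsy⟩
  have : max (g x - x) (g y - y) ≤ 0 := max_le (by linarith) (by linarith)
  linarith

lemma IsGen.lt_of_gt {g : ℝ → ℝ} (hg : IsGen g) {r s : ℝ} (hr : IsGreatest (fixSet g) r)
    (hs : s ∈ Icc (0 : ℝ) 1) (h : s < g s) : r < 1 - s := by
  by_contra! hle
  have := hg.chord (x := 1 - r) (y := 1) (s := s) ⟨by linarith [hr.1.1.2], by linarith [hr.1.1.1]⟩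
    (by simp) hr.1.2.symm.le hg.one.le (by linarith) hs.2
  linarith

lemma IsGen.continuousWithinAt {g : ℝ → ℝ → ℝ} {r : ℝ → ℝ} {D : Set ℝ} {x₀ : ℝ} (hx₀ : x₀ ∈ D)
    (hg : ∀ x ∈ D, IsGen (g x)) (hr : ∀ x ∈ D, IsGreatest (fixSet (g x)) (r x))
    (hsup : ∃ s ∈ Icc (0 : ℝ) 1, g x₀ s < s)
    (hcont : ∀ s ∈ Icc (0 : ℝ) 1, ContinuousWithinAt (fun x => g x s) D x₀) :
    ContinuousWithinAt r D x₀ := by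
  obtain ⟨s', hs', hgs'⟩ := hsup
  have hr0 := hr x₀ hx₀
  have hlt := (hg x₀ hx₀).lt_of_lt hr0 hs' hgs'
  rw [ContinuousWithinAt, tendsto_order]
  constructor
  · intro u hu
    obtain ⟨s, hs1, hs2⟩ : ∃ s, 1 - r x₀ < s ∧ s < min s' (1 - u) :=
      exists_between (lt_min (by linarith) (by linarith))
    have hss' : s < s' := hs2.trans_le (min_le_left _ _)
    have hsu : s < 1 - u := hs2.trans_le (min_le_right _ _)
    have hs : s ∈ Icc (0 : ℝ) 1 := ⟨by linarith [hr0.1.1.2], by linarith [hs'.2]⟩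
    have hgs : g x₀ s < s := by
      refine lt_of_le_of_ne ((hg x₀ hx₀).chord (x := 1 - r x₀) (y := s')
        ⟨by linarith [hr0.1.1.2], by linarith [hr0.1.1.1]⟩ hs' hr0.1.2.symm.le hgs'.le hs1.le
          hss'.le) fun heq => ?_
      have hc : ConvexOn ℝ (Icc 0 1) (fun x => g x₀ x - x) :=
        (hg x₀ hx₀).convex.sub (concaveOn_id (convex_Icc _ _))
      have h3 := hc.slope_mono_adjacent (x := 1 - r x₀) (y := s) (z := s')
        ⟨by linarith [hr0.1.1.2], by linarith [hr0.1.1.1]⟩ hs' hs1 hss'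
      have h4 := hr0.1.2
      simp only [heq, ← h4, sub_self, zero_div] at h3
      have : (g x₀ s' - s' - 0) / (s' - s) < 0 := div_neg_of_neg_of_pos (by linarith) (by linarith)
      linarith
    filter_upwards [(hcont s hs).eventually_lt_const hgs, self_mem_nhdsWithin] with x hx hxD
    have := (hg x hxD).lt_of_lt (hr x hxD) hs hx
    linarith
  · intro u hu
    rcases lt_or_ge 1 u with h1 | h1
    · filter_upwards [self_mem_nhdsWithin] with x hxD
      exact (hr x hxD).1.1.2.trans_lt h1
    have hs : 1 - u ∈ Icc (0 : ℝ) 1 := ⟨by linarith, by linarith [hr0.1.1.1]⟩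
    have hgs : 1 - u < g x₀ (1 - u) := by
      rcases lt_trichotomy (g x₀ (1 - u)) (1 - u) with h | h | h
      · have := (hg x₀ hx₀).lt_of_lt hr0 hs h
        linarith
      · have : u ≤ r x₀ := hr0.2 ⟨⟨by linarith [hr0.1.1.1], h1⟩, h.symm⟩
        linarith
      · exact h
    filter_upwards [(hcont _ hs).eventually_const_lt hgs, self_mem_nhdsWithin] with x hx hxD
    have := (hg x hxD).lt_of_gt (hr x hxD) hs hx
    linarith

lemma isGen_ghat {z : ℕ → ℝ} (hz : ∀ k, 0 ≤ z k) (hd : Summable (dcoef z)) (hE : 0 < Emom z) :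
    IsGen (ghat z) := by
  rw [emom_eq] at hE
  have hfun : ghat z = fun s => (powSum (dcoef z) 1)⁻¹ • powSum (dcoef z) s := by
    funext s
    rw [ghat_eq, smul_eq_mul, div_eq_inv_mul]
  refine ⟨?_, ?_, ?_, ?_⟩
  · rw [hfun]
    exact (powSum_convexOn (dcoef_nonneg hz) hd).smul (by positivity)
  · rw [hfun]
    simp only [smul_eq_mul]
    exact continuousOn_const.mul (powSum_continuousOn (dcoef_nonneg hz) hd)
  · rw [ghat_eq, div_self hE.ne']
  · rw [ghat_eq]
    exact div_nonneg (powSum_nonneg (dcoef_nonneg hz) le_rfl) hE.le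

lemma emom_lt_qmom_of_ghat_lt {z : ℕ → ℝ} (hz : ∀ k, 0 ≤ z k) (hd : Summable (dcoef z))
    (hdd : Summable (dcoef (dcoef z))) (hE : 0 < Emom z) {s : ℝ} (hs : s ∈ Ico (0 : ℝ) 1)
    (h : ghat z s < s) : Emom z < Qmom z := by
  have h1 := powSum_one_sub_le (dcoef_nonneg hz) hd hdd ⟨hs.1, hs.2.le⟩
  rw [← emom_eq, ← qmom_eq] at h1
  rw [ghat_eq, ← emom_eq, div_lt_iff₀ hE] at h
  have : (1 - s) * Emom z < (1 - s) * Qmom z := by linarith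
  exact lt_of_mul_lt_mul_left this (by linarith [hs.2])

lemma exists_ghat_lt {z : ℕ → ℝ} (hz : ∀ k, 0 ≤ z k) (hd : Summable (dcoef z))
    (hdd : Summable (dcoef (dcoef z))) (hE : 0 < Emom z) (h : Emom z < Qmom z) :
    ∃ s ∈ Ioo (0 : ℝ) 1, ghat z s < s := by
  have hder := powSum_hasDerivWithinAt_unit (dcoef_nonneg hz) hd hdd (x := 1) (by simp)
  rw [hasDerivWithinAt_iff_tendsto_slope, ← qmom_eq] at hder
  have hset : Icc (0 : ℝ) 1 \ {1} = Ico 0 1 := Icc_sdiff_right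
  rw [hset, nhdsWithin_Ico_eq_nhdsLT zero_lt_one] at hder
  obtain ⟨s, hs, hs1⟩ := ((hder.eventually_const_lt h).and (Ioo_mem_nhdsLT zero_lt_one)).exists
  refine ⟨s, hs1, ?_⟩
  rw [slope_def_field, ← emom_eq, ← neg_div_neg_eq, lt_div_iff₀ (by linarith [hs1.2])] at hs
  rw [ghat_eq, ← emom_eq, div_lt_iff₀ hE]
  linarith

lemma ac_congr {f g : ℝ → ℝ} {a b : ℝ} (hf : AbsolutelyContinuousOnInterval f a b)
    (h : EqOn f g (uIcc a b)) : AbsolutelyContinuousOnInterval g a b := by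
  rw [absolutelyContinuousOnInterval_iff] at hf ⊢
  intro ε hε
  obtain ⟨δ, hδ, H⟩ := hf ε hε
  refine ⟨δ, hδ, fun E hE hlt => ?_⟩
  refine lt_of_eq_of_lt (Finset.sum_congr rfl fun i hi => ?_) (H E hE hlt)
  rw [h (hE.1 i hi).1, h (hE.1 i hi).2]

lemma ac_const (c a b : ℝ) : AbsolutelyContinuousOnInterval (fun _ => c) a b :=
  (LipschitzWith.const c).lipschitzOnWith.absolutelyContinuousOnInterval

lemma ac_exp {f : ℝ → ℝ} {a b : ℝ} (hf : AbsolutelyContinuousOnInterval f a b) :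
    AbsolutelyContinuousOnInterval (fun x => Real.exp (f x)) a b := by
  obtain ⟨M, hM⟩ := hf.exists_bound
  have hlip : ∀ x ∈ uIcc a b, ∀ y ∈ uIcc a b,
      dist (Real.exp (f x)) (Real.exp (f y)) ≤ Real.exp M * dist (f x) (f y) := by
    intro x hx y hy
    have := Convex.norm_image_sub_le_of_norm_hasDerivWithin_le (f := Real.exp) (f' := Real.exp)
      (s := Iic M) (C := Real.exp M) (fun z _ => (Real.hasDerivAt_exp z).hasDerivWithinAt)
      (fun z hz => by
        rw [Real.norm_of_nonneg (Real.exp_pos z).le]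
        exact Real.exp_le_exp.2 hz) (convex_Iic M)
      (show f y ∈ Iic M from (le_abs_self _).trans (hM y hy))
      (show f x ∈ Iic M from (le_abs_self _).trans (hM x hx))
    simpa [dist_eq_norm] using this
  rw [absolutelyContinuousOnInterval_iff] at hf ⊢
  intro ε hε
  obtain ⟨δ, hδ, H⟩ := hf (ε / Real.exp M) (by positivity)
  refine ⟨δ, hδ, fun E hE hlt => ?_⟩
  calc _ ≤ ∑ i ∈ Finset.range E.1, Real.exp M * dist (f (E.2 i).1) (f (E.2 i).2) :=
        Finset.sum_le_sum fun i hi => hlip _ (hE.1 i hi).1 _ (hE.1 i hi).2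
    _ = Real.exp M * ∑ i ∈ Finset.range E.1, dist (f (E.2 i).1) (f (E.2 i).2) :=
        (Finset.mul_sum _ _ _).symm
    _ < Real.exp M * (ε / Real.exp M) := by
        gcongr
        exact H E hE hlt
    _ = ε := by field_simp

lemma ac_pow {f : ℝ → ℝ} {a b : ℝ} (hf : AbsolutelyContinuousOnInterval f a b) (n : ℕ) :
    AbsolutelyContinuousOnInterval (fun x => f x ^ n) a b := by
  induction n with
  | zero => simpa using ac_const 1 a b
  | succ n ih => simpa only [pow_succ] using ih.fun_mul hf

lemma ac_sum {f : ℕ → ℝ → ℝ} {a b : ℝ} (hf : ∀ i, AbsolutelyContinuousOnInterval (f i) a b)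
    (n : ℕ) : AbsolutelyContinuousOnInterval (fun x => ∑ i ∈ Finset.range n, f i x) a b := by
  induction n with
  | zero => simpa using ac_const 0 a b
  | succ n ih =>
    simp only [Finset.sum_range_succ]
    exact ih.add (hf n)

/-- A function differentiable everywhere with integrable derivative is absolutely continuous. -/
lemma ac_of_hasDerivWithinAt {f f' : ℝ → ℝ} {a b : ℝ} (hab : a ≤ b)
    (hd : ∀ x ∈ Icc a b, HasDerivWithinAt f (f' x) (Icc a b) x)
    (hi : IntervalIntegrable f' volume a b) : AbsolutelyContinuousOnInterval f a b := by
  have h := (hi.absolutelyContinuousOnInterval_intervalIntegral (c := a) left_mem_uIcc).add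
    (ac_const (f a) a b)
  refine ac_congr h fun x hx => ?_
  rw [uIcc_of_le hab] at hx
  have := intervalIntegral.integral_eq_sub_of_hasDerivAt_of_le hx.1
    (f := f) (f' := f')
    (fun y hy => (hd y ⟨hy.1, hy.2.trans hx.2⟩).continuousWithinAt.mono
      (Icc_subset_Icc_right hx.2))
    (fun y hy => (hd y ⟨hy.1.le, hy.2.le.trans hx.2⟩).hasDerivAt
      (Icc_mem_nhds hy.1 (hy.2.trans_le hx.2)))
    (hi.mono_set (by
      rw [uIcc_of_le hab, uIcc_of_le hx.1]
      exact Icc_subset_Icc_right hx.2))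
  simp only [Pi.add_apply, this]
  ring

lemma sum_telescope (z : ℕ → ℝ) (α β σ : ℝ) (n : ℕ) :
    ∑ i ∈ Finset.range (n + 1), ((-α * (i * z i) + β * (((i : ℝ) + 1) * z (i + 1))) * σ ^ i
        + z i * (i * σ ^ (i - 1) * (α * σ - β)))
      = β * (((n : ℝ) + 1) * z (n + 1)) * σ ^ n := by
  induction n with
  | zero => simp
  | succ n ih =>
    rw [Finset.sum_range_succ, ih]
    push_cast
    simp only [pow_succ]
    ring

/-- A nonnegative bounded solution of a linear death-and-thinning flow with integrable rates is
obtained from its initial value by an affine change of variable in the generating function. -/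
theorem eq_shift_of_linear_flow {z : ℕ → ℝ → ℝ} {A B : ℝ → ℝ} {δ : ℝ}
    (hz0 : ∀ t ∈ Icc (0 : ℝ) δ, ∀ i, 0 ≤ z i t) (hz1 : ∀ t ∈ Icc (0 : ℝ) δ, ∀ i, z i t ≤ 1)
    (hsum : ∀ t ∈ Icc (0 : ℝ) δ, Summable fun i => z i t)
    (hd : ∀ i : ℕ, ∀ t ∈ Icc (0 : ℝ) δ, HasDerivWithinAt (z i)
      (-(A t + B t) * (i * z i t) + B t * (((i : ℝ) + 1) * z (i + 1) t)) (Icc 0 δ) t)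
    (hA : ∀ t ∈ Icc (0 : ℝ) δ, 0 ≤ A t) (hB : ∀ t ∈ Icc (0 : ℝ) δ, 0 ≤ B t)
    (hAi : IntervalIntegrable A volume 0 δ) (hBi : IntervalIntegrable B volume 0 δ) :
    ∃ a b : ℝ → ℝ, a 0 = 1 ∧ b 0 = 0 ∧ ContinuousOn a (Icc 0 δ) ∧ ContinuousOn b (Icc 0 δ) ∧
      (∀ t ∈ Icc (0 : ℝ) δ, 0 < a t ∧ 0 ≤ b t ∧ a t + b t ≤ 1 ∧
        ∀ i, z i t = shift (fun k => z k 0) (a t) (b t) i) ∧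
      (∀ t, a t = Real.exp (-∫ u in (0 : ℝ)..t, (A u + B u))) ∧
      (∀ t, b t = ∫ u in (0 : ℝ)..t, B u * a u) := by
  rcases lt_or_ge δ 0 with hδ | hδ
  · refine ⟨_, _, ?_, ?_, ?_, ?_, ?_, fun _ => rfl, fun _ => rfl⟩ <;>
    simp [Icc_eq_empty_of_lt hδ]
  set P : ℝ → ℝ := fun t => ∫ u in (0 : ℝ)..t, (A u + B u) with hP
  set a : ℝ → ℝ := fun t => Real.exp (-P t) with ha
  set e : ℝ → ℝ := fun t => Real.exp (P t) with he
  set b : ℝ → ℝ := fun t => ∫ u in (0 : ℝ)..t, B u * a u with hb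
  have hae : ∀ t, a t * e t = 1 := fun t => by
    simp only [ha, he, ← Real.exp_add, neg_add_cancel, Real.exp_zero]
  have hu : uIcc (0 : ℝ) δ = Icc 0 δ := uIcc_of_le hδ
  have h0 : (0 : ℝ) ∈ Icc (0 : ℝ) δ := ⟨le_rfl, hδ⟩
  have hABi := hAi.add hBi
  have hPac : AbsolutelyContinuousOnInterval P 0 δ :=
    hABi.absolutelyContinuousOnInterval_intervalIntegral left_mem_uIcc
  have haac : AbsolutelyContinuousOnInterval a 0 δ := ac_exp hPac.neg
  have heac : AbsolutelyContinuousOnInterval e 0 δ := ac_exp hPac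
  have hBai : IntervalIntegrable (fun u => B u * a u) volume 0 δ :=
    hBi.mul_continuousOn haac.continuousOn
  have hbac : AbsolutelyContinuousOnInterval b 0 δ :=
    hBai.absolutelyContinuousOnInterval_intervalIntegral left_mem_uIcc
  have hapos : ∀ t, 0 < a t := fun t => Real.exp_pos _
  have ha0 : a 0 = 1 := by simp [ha, hP]
  have hb0 : b 0 = 0 := by simp [hb]
  have hPd : ∀ᵐ t, t ∈ Icc (0 : ℝ) δ → HasDerivAt P (A t + B t) t := by
    filter_upwards [hABi.ae_hasDerivAt_integral] with t ht hmem
    exact ht (hu ▸ hmem) 0 (hu ▸ h0)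
  have hbd : ∀ᵐ t, t ∈ Icc (0 : ℝ) δ → HasDerivAt b (B t * a t) t := by
    filter_upwards [hBai.ae_hasDerivAt_integral] with t ht hmem
    exact ht (hu ▸ hmem) 0 (hu ▸ h0)
  have hbmono : ∀ s ∈ Icc (0 : ℝ) δ, ∀ t ∈ Icc (0 : ℝ) δ, s ≤ t → b s ≤ b t := by
    intro s hs t ht hst
    have h1 : b t - b s = ∫ u in s..t, B u * a u :=
      intervalIntegral.integral_interval_sub_left
        (hBai.mono_set (by rw [hu, uIcc_of_le ht.1]; exact Icc_subset_Icc_right ht.2))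
        (hBai.mono_set (by rw [hu, uIcc_of_le hs.1]; exact Icc_subset_Icc_right hs.2))
    have h2 : 0 ≤ ∫ u in s..t, B u * a u := intervalIntegral.integral_nonneg hst fun u hu =>
      mul_nonneg (hB u ⟨hs.1.trans hu.1, hu.2.trans ht.2⟩) (hapos u).le
    linarith
  have habanti : ∀ s ∈ Icc (0 : ℝ) δ, ∀ t ∈ Icc (0 : ℝ) δ, s ≤ t → a t + b t ≤ a s + b s := by
    intro s hs t ht hst
    have hac : AbsolutelyContinuousOnInterval (fun t => a t + b t) s t :=
      (haac.add hbac).mono (by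
        rw [hu, uIcc_of_le hst]
        exact Icc_subset_Icc hs.1 ht.2)
    have h1 := hac.integral_deriv_eq_sub
    have h2 : ∫ u in s..t, deriv (fun t => a t + b t) u ≤ ∫ _ in s..t, (0 : ℝ) := by
      refine intervalIntegral.integral_mono_ae_restrict hst hac.intervalIntegrable_deriv
        (by simp) ?_
      rw [EventuallyLE, ae_restrict_iff' measurableSet_Icc]
      filter_upwards [hPd, hbd] with u hu1 hu2 hmem
      have hm : u ∈ Icc (0 : ℝ) δ := ⟨hs.1.trans hmem.1, hmem.2.trans ht.2⟩
      have := ((hu1 hm).neg.exp.add (hu2 hm)).deriv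
      simp only [Pi.add_def] at this
      refine (this.trans_le ?_)
      have := mul_nonneg (hA u hm) (hapos u).le
      simp only [Pi.neg_apply, ha] at this ⊢
      linarith
    simp only [intervalIntegral.integral_zero] at h2
    linarith
  have hzc : ∀ i, ContinuousOn (z i) (uIcc 0 δ) := fun i t ht =>
    (hd i t (hu ▸ ht)).continuousWithinAt.mono hu.le
  have hzac : ∀ i, AbsolutelyContinuousOnInterval (z i) 0 δ := by
    intro i
    refine ac_of_hasDerivWithinAt hδ (hd i) ?_
    exact (hABi.neg.mul_continuousOn (continuousOn_const.mul (hzc i))).add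
      (hBi.mul_continuousOn (continuousOn_const.mul (hzc (i + 1))))
  have hab1 : ∀ t ∈ Icc (0 : ℝ) δ, a t + b t ≤ 1 := fun t ht => by
    simpa [ha0, hb0] using habanti 0 h0 t ht ht.1
  have hbnn : ∀ t ∈ Icc (0 : ℝ) δ, 0 ≤ b t := fun t ht => by
    simpa [hb0] using hbmono 0 h0 t ht ht.1
  have hgen : ∀ t ∈ Icc (0 : ℝ) δ, ∀ s ∈ Ico (0 : ℝ) 1,
      powSum (fun i => z i t) s = powSum (fun i => z i 0) (a t * s + b t) := by
    intro t ht s hs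
    set y := a t * s + b t with hy
    set σ : ℝ → ℝ := fun τ => (y - b τ) * e τ with hσ
    set r := 1 - a t * (1 - s) with hr
    have hsub : Icc (0 : ℝ) t ⊆ Icc 0 δ := Icc_subset_Icc_right ht.2
    have ha1 : a t ≤ 1 := by linarith [hab1 t ht, hbnn t ht]
    have hr1 : r < 1 := by
      have := mul_pos (hapos t) (sub_pos.2 hs.2)
      linarith
    have hr0 : 0 ≤ r := by nlinarith [hs.1, hs.2, hapos t]
    have hσ0 : σ 0 = y := by simp [hσ, hb0, he, hP]
    have hσt : σ t = s := by
      simp only [hσ, hy, add_sub_cancel_right]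
      rw [mul_right_comm, hae, one_mul]
    have hepos : ∀ τ, 0 < e τ := fun τ => Real.exp_pos _
    have hσmem : ∀ τ ∈ Icc (0 : ℝ) t, 0 ≤ σ τ ∧ σ τ ≤ r := by
      intro τ hτ
      have h1 := hbmono τ (hsub hτ) t ht hτ.2
      have h2 := habanti τ (hsub hτ) t ht hτ.2
      have h3 : 1 ≤ e τ := by
        have := hab1 τ (hsub hτ)
        have := hbnn τ (hsub hτ)
        nlinarith [hae τ, hepos τ]
      refine ⟨mul_nonneg (by nlinarith [hs.1, hapos t]) (hepos τ).le, ?_⟩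
      have h4 : σ τ ≤ (a τ - a t * (1 - s)) * e τ :=
        mul_le_mul_of_nonneg_right (by linarith) (hepos τ).le
      have h5 := mul_le_mul_of_nonneg_left h3 (mul_nonneg (hapos t).le (sub_nonneg.2 hs.2.le))
      nlinarith [hae τ]
    have hσac : AbsolutelyContinuousOnInterval σ 0 δ := ((ac_const y 0 δ).sub hbac).fun_mul heac
    have hest : ∀ n : ℕ, |∑ i ∈ Finset.range (n + 1), z i t * s ^ i
        - ∑ i ∈ Finset.range (n + 1), z i 0 * y ^ i|
        ≤ (((n : ℝ) + 1) * r ^ n) * ∫ u in (0 : ℝ)..t, B u := by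
      intro n
      have hac : AbsolutelyContinuousOnInterval
          (fun τ => ∑ i ∈ Finset.range (n + 1), z i τ * σ τ ^ i) 0 t :=
        (ac_sum (fun i => (hzac i).fun_mul (ac_pow hσac i)) (n + 1)).mono (by
          rw [hu, uIcc_of_le ht.1]
          exact hsub)
      have h1 := hac.integral_deriv_eq_sub
      simp only [hσt, hσ0] at h1
      rw [← h1, ← Real.norm_eq_abs, ← intervalIntegral.integral_const_mul]
      refine intervalIntegral.norm_integral_le_of_norm_le ht.1 ?_ ?_
      · have hne : ∀ᵐ u : ℝ, u ≠ t := by simp [ae_iff]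
        filter_upwards [hPd, hbd, hne] with u hu1 hu2 hut hmem
        have hmt : u ∈ Icc (0 : ℝ) t := ⟨hmem.1.le, hmem.2⟩
        have hm := hsub hmt
        have hnhds : Icc (0 : ℝ) δ ∈ 𝓝 u :=
          Icc_mem_nhds hmem.1 ((lt_of_le_of_ne hmem.2 hut).trans_le ht.2)
        have hσd : HasDerivAt σ ((A u + B u) * σ u - B u) u := by
          refine (((hu2 hm).const_sub y).mul (hu1 hm).exp).congr_deriv ?_
          have := hae u
          simp only [hσ, he] at this ⊢
          linear_combination (-B u) * this
        have hsumd := HasDerivAt.fun_sum (u := Finset.range (n + 1)) fun i _ =>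
          ((hd i u hm).hasDerivAt hnhds).mul (hσd.fun_pow i)
        have hder := hsumd.deriv
        simp only [Pi.mul_def] at hder
        rw [hder, sum_telescope (fun i => z i u), Real.norm_of_nonneg]
        · have := hσmem u hmt
          have hpow : σ u ^ n ≤ r ^ n := pow_le_pow_left₀ this.1 this.2 n
          have hzz : z (n + 1) u * σ u ^ n ≤ 1 * r ^ n :=
            mul_le_mul (hz1 u hm _) hpow (pow_nonneg this.1 n) zero_le_one
          have hB1 := mul_nonneg (hB u hm) (by positivity : (0 : ℝ) ≤ (n : ℝ) + 1)
          nlinarith [mul_le_mul_of_nonneg_left hzz hB1]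
        · exact mul_nonneg (mul_nonneg (hB u hm) (mul_nonneg (by positivity) (hz0 u hm _)))
            (pow_nonneg (hσmem u hmt).1 n)
      · exact (hBi.mono_set (by
          rw [hu, uIcc_of_le ht.1]
          exact hsub)).const_mul _
    have hyI : y ∈ Icc (0 : ℝ) 1 := by
      have h1 := hσmem 0 ⟨le_rfl, ht.1⟩
      rw [hσ0] at h1
      exact ⟨h1.1, h1.2.trans hr1.le⟩
    have ht1 := ((summable_mul_pow_of_mem_Icc (hz0 t ht) (hsum t ht)
      ⟨hs.1, hs.2.le⟩).hasSum.tendsto_sum_nat).comp (tendsto_add_atTop_nat 1)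
    have ht2 := ((summable_mul_pow_of_mem_Icc (hz0 0 h0) (hsum 0 h0)
      hyI).hasSum.tendsto_sum_nat).comp (tendsto_add_atTop_nat 1)
    have hlim : Tendsto (fun n : ℕ => (((n : ℝ) + 1) * r ^ n) * ∫ u in (0 : ℝ)..t, B u) atTop
        (𝓝 0) := by
      have h1 := tendsto_self_mul_const_pow_of_lt_one hr0 hr1
      have h2 := tendsto_pow_atTop_nhds_zero_of_lt_one hr0 hr1
      have h3 := (h1.add h2).mul_const (∫ u in (0 : ℝ)..t, B u)
      simp only [add_zero, zero_mul] at h3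
      refine h3.congr fun n => by ring
    have hdiff := squeeze_zero_norm (f := fun n : ℕ => ∑ i ∈ Finset.range (n + 1), z i t * s ^ i
        - ∑ i ∈ Finset.range (n + 1), z i 0 * y ^ i) hest hlim
    have := tendsto_nhds_unique (ht1.sub ht2) hdiff
    exact sub_eq_zero.1 this
  refine ⟨a, b, ha0, hb0, hu ▸ haac.continuousOn, hu ▸ hbac.continuousOn,
    fun t ht => ⟨hapos t, hbnn t ht, hab1 t ht, fun i => ?_⟩, fun _ => rfl, fun _ => rfl⟩
  have hs0 := summable_shift (hz0 0 h0) (hsum 0 h0) (hapos t).le (hbnn t ht) (hab1 t ht)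
  refine sub_eq_zero.1 (eq_zero_of_powSum_eq_zero
    (d := fun i => z i t - shift (fun k => z k 0) (a t) (b t) i) ?_ (fun s hs => ?_) i)
  · exact ((hsum t ht).sub hs0).abs
  · have hsI : s ∈ Icc (0 : ℝ) 1 := ⟨hs.1, hs.2.le⟩
    simp only [powSum, sub_mul]
    rw [(summable_mul_pow_of_mem_Icc (hz0 t ht) (hsum t ht) hsI).tsum_sub
      (summable_mul_pow_of_mem_Icc (shift_nonneg (hz0 0 h0) (hapos t).le (hbnn t ht)) hs0 hsI)]
    have h1 := hgen t ht s hs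
    have h2 := powSum_shift (hz0 0 h0) (hsum 0 h0) (hapos t).le (hbnn t ht) (hab1 t ht) hsI
    rw [← h2] at h1
    exact sub_eq_zero.2 h1

/-- Inversion of a strictly increasing primitive: `X` solves the scalar equation `X' = -1 / k X`
started from `1`, and `G` is the corresponding clock. -/
lemma exists_clock {k : ℝ → ℝ} {x₁ : ℝ} (hx₁ : x₁ < 1) (hk : ContinuousOn k (Icc x₁ 1))
    (hpos : ∀ x ∈ Icc x₁ 1, 0 < k x) :
    ∃ (G X : ℝ → ℝ) (T : ℝ), 0 < T ∧ G 1 = 0 ∧ (∀ x, X (-G x) = x) ∧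
      (∀ x ∈ Icc x₁ 1, HasDerivAt G (k x) x) ∧
      ∀ t ∈ Icc 0 T, X t ∈ Icc x₁ 1 ∧ HasDerivAt X (-1 / k (X t)) t := by
  set K : ℝ → ℝ := IccExtend hx₁.le (domRestrict (Icc x₁ 1) k) with hK
  have hKc : Continuous K := (continuousOn_iff_continuous_domRestrict.1 hk).Icc_extend'
  have hKk : ∀ x ∈ Icc x₁ 1, K x = k x := fun x hx => IccExtend_of_mem _ _ hx
  obtain ⟨y, hy, hmin⟩ := isCompact_Icc.exists_isMinOn (nonempty_Icc.2 hx₁.le) hk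
  set m := k y with hm
  have hm0 : 0 < m := hpos y hy
  have hKm : ∀ x, m ≤ K x := fun x => hmin (projIcc x₁ 1 hx₁.le x).2
  set G : ℝ → ℝ := fun x => ∫ u in (1 : ℝ)..x, K u with hG
  have hGd : ∀ x, HasDerivAt G (K x) x := fun x =>
    (hKc.integral_hasStrictDerivAt 1 x).hasDerivAt
  have hG1 : G 1 = 0 := by simp [hG]
  have hGm : StrictMono G := strictMono_of_hasDerivAt_pos hGd fun x => hm0.trans_le (hKm x)
  have hGlin : Monotone fun x => G x - m * x :=
    monotone_of_hasDerivAt_nonneg (f' := fun x => K x - m)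
      (fun x => (hGd x).sub (by simpa using (hasDerivAt_id x).const_mul m))
      fun x => sub_nonneg.2 (hKm x)
  have hGc : Continuous G := continuous_iff_continuousAt.2 fun x => (hGd x).continuousAt
  have hGs : Function.Surjective G := by
    refine hGc.surjective ?_ ?_
    · have hlin : Tendsto (fun x : ℝ => m * x + (G 1 - m * 1)) atTop atTop :=
        tendsto_atTop_add_const_right _ _ (tendsto_id.const_mul_atTop hm0)
      refine tendsto_atTop_mono' _ ?_ hlin
      filter_upwards [eventually_ge_atTop (1 : ℝ)] with x hx
      have := hGlin hx
      simp only at this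
      linarith
    · have hlin : Tendsto (fun x : ℝ => m * x + (G 1 - m * 1)) atBot atBot :=
        tendsto_atBot_add_const_right _ _ (tendsto_id.const_mul_atBot hm0)
      refine tendsto_atBot_mono' _ ?_ hlin
      filter_upwards [eventually_le_atBot (1 : ℝ)] with x hx
      have := hGlin hx
      simp only at this
      linarith
  set O := hGm.orderIsoOfSurjective G hGs with hO
  have hGO : ∀ u, G (O.symm u) = u := fun u => O.apply_symm_apply u
  refine ⟨G, fun t => O.symm (-t), -G x₁, ?_, hG1, ?_, fun x hx => hKk x hx ▸ hGd x, ?_⟩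
  · have := hGm hx₁
    linarith
  · intro x
    simp only [neg_neg]
    exact O.symm_apply_apply x
  · intro t ht
    have hmem : O.symm (-t) ∈ Icc x₁ 1 := by
      constructor <;> rw [← hGm.le_iff_le, hGO]
      · linarith [ht.2]
      · linarith [ht.1]
    refine ⟨hmem, ?_⟩
    have h1 : HasDerivAt O.symm (K (O.symm (-t)))⁻¹ (-t) :=
      (hGd _).of_local_left_inverse O.symm.continuous.continuousAt
        (hm0.trans_le (hKm _)).ne' (Eventually.of_forall hGO)
    refine (h1.comp t (hasDerivAt_neg t)).congr_deriv ?_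
    rw [hKk _ hmem]
    ring

/-- Supercritical degree sequences of total mass at most one with finite second moment. -/
structure IsSupercritical (c : ℕ → ℝ) : Prop where
  nonneg : ∀ k, 0 ≤ c k
  summable : Summable c
  tsum_le_one : ∑' k, c k ≤ 1
  summable_dcoef : Summable (dcoef c)
  summable_dcoef_dcoef : Summable (dcoef (dcoef c))
  emom_pos : 0 < Emom c
  emom_lt_qmom : Emom c < Qmom c

lemma powSum_mul_left (a : ℝ) (c : ℕ → ℝ) (s : ℝ) :
    powSum (fun i => a * c i) s = a * powSum c s := by
  simp only [powSum, mul_assoc, tsum_mul_left]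

lemma dcoef_mul_left (a : ℝ) (c : ℕ → ℝ) : dcoef (fun i => a * c i) = fun i => a * dcoef c i := by
  funext i
  simp only [dcoef]
  ring

lemma shift_one_zero (c : ℕ → ℝ) (i : ℕ) : shift c 1 0 i = c i := by
  rw [shift, powSum, tsum_eq_single 0 fun j hj => by simp [hj]]
  simp

namespace IsSupercritical

variable {c : ℕ → ℝ} {a b s : ℝ}

lemma powSum_dcoef_shift (hc : IsSupercritical c) (ha : 0 ≤ a) (hb : 0 ≤ b) (hab : a + b ≤ 1)
    (hs : s ∈ Icc (0 : ℝ) 1) :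
    powSum (dcoef (shift c a b)) s = a * powSum (dcoef c) (a * s + b) := by
  rw [dcoef_shift, powSum_mul_left,
    powSum_shift (dcoef_nonneg hc.nonneg) hc.summable_dcoef ha hb hab hs]

lemma summable_dcoef_shift (hc : IsSupercritical c) (ha : 0 ≤ a) (hb : 0 ≤ b) (hab : a + b ≤ 1) :
    Summable (dcoef (shift c a b)) := by
  rw [dcoef_shift]
  exact (summable_shift (dcoef_nonneg hc.nonneg) hc.summable_dcoef ha hb hab).mul_left a

lemma summable_dcoef_dcoef_shift (hc : IsSupercritical c) (ha : 0 ≤ a) (hb : 0 ≤ b)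
    (hab : a + b ≤ 1) : Summable (dcoef (dcoef (shift c a b))) := by
  rw [dcoef_shift, dcoef_mul_left, dcoef_shift]
  exact ((summable_shift (dcoef_nonneg (dcoef_nonneg hc.nonneg))
    hc.summable_dcoef_dcoef ha hb hab).mul_left a).mul_left a

lemma emom_shift (hc : IsSupercritical c) (ha : 0 ≤ a) (hb : 0 ≤ b) (hab : a + b ≤ 1) :
    Emom (shift c a b) = a * powSum (dcoef c) (a + b) := by
  rw [emom_eq, hc.powSum_dcoef_shift ha hb hab (by simp), mul_one]

lemma qmom_shift (hc : IsSupercritical c) (ha : 0 ≤ a) (hb : 0 ≤ b) (hab : a + b ≤ 1) :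
    Qmom (shift c a b) = a ^ 2 * powSum (dcoef (dcoef c)) (a + b) := by
  rw [qmom_eq, dcoef_shift, dcoef_mul_left, dcoef_shift, powSum_mul_left, powSum_mul_left,
    powSum_shift (dcoef_nonneg (dcoef_nonneg hc.nonneg)) hc.summable_dcoef_dcoef ha hb hab
      (by simp), mul_one]
  ring

lemma ghat_shift (hc : IsSupercritical c) (ha : 0 < a) (hb : 0 ≤ b) (hab : a + b ≤ 1)
    (hs : s ∈ Icc (0 : ℝ) 1) :
    ghat (shift c a b) s = powSum (dcoef c) (a * s + b) / powSum (dcoef c) (a + b) := by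
  rw [ghat_eq, ← emom_eq, hc.emom_shift ha.le hb hab, hc.powSum_dcoef_shift ha.le hb hab hs,
    mul_div_mul_left _ _ ha.ne']

lemma tsum_shift_le_one (hc : IsSupercritical c) (ha : 0 ≤ a) (hb : 0 ≤ b) (hab : a + b ≤ 1) :
    ∑' i, shift c a b i ≤ 1 := by
  rw [← powSum_one, powSum_shift hc.nonneg hc.summable ha hb hab (by simp), mul_one]
  refine (powSum_mono hc.nonneg hc.summable (add_nonneg ha hb) hab le_rfl).trans ?_
  rw [powSum_one]
  exact hc.tsum_le_one

end IsSupercritical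

/-- Thinning factor of the solution of (S), as a function of the total affine image `x` of `1`. -/
noncomputable def thin (c : ℕ → ℝ) (x : ℝ) : ℝ := powSum (dcoef c) x / powSum (dcoef c) 1

/-- The curve of degree sequences on which the solution of (S) started at `c` lives. -/
noncomputable def curve (c : ℕ → ℝ) (x : ℝ) : ℕ → ℝ := shift c (thin c x) (x - thin c x)

/-- Largest fixed point along `curve`. -/
noncomputable def surv (c : ℕ → ℝ) (x : ℝ) : ℝ := sSup (fixSet (ghat (curve c x)))

/-- On `[x₁, 1]` the sequences `curve c x` are supercritical. -/
structure IsThreshold (c : ℕ → ℝ) (x₁ : ℝ) : Prop where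
  pos : 0 < x₁
  lt_one : x₁ < 1
  first_pos : ∀ x ∈ Icc x₁ 1, 0 < powSum (dcoef c) x
  lt_second : ∀ x ∈ Icc x₁ 1, powSum (dcoef c) 1 < powSum (dcoef (dcoef c)) x

lemma IsSupercritical.exists_threshold {c : ℕ → ℝ} (hc : IsSupercritical c) :
    ∃ x₁, IsThreshold c x₁ := by
  have h1 := powSum_continuousOn (dcoef_nonneg hc.nonneg) hc.summable_dcoef 1 (by simp)
  have h2 := powSum_continuousOn (dcoef_nonneg (dcoef_nonneg hc.nonneg)) hc.summable_dcoef_dcoef 1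
    (by simp)
  have hp := hc.emom_pos
  have hl := hc.emom_lt_qmom
  rw [emom_eq] at hp hl
  rw [qmom_eq] at hl
  have hev := (h1.eventually (lt_mem_nhds hp)).and (h2.eventually (lt_mem_nhds hl))
  rw [eventually_nhdsWithin_iff, Metric.eventually_nhds_iff] at hev
  obtain ⟨ε, hε, hev⟩ := hev
  have key : ∀ x ∈ Icc (1 - min (ε / 2) (1 / 2)) 1, 0 < powSum (dcoef c) x ∧
      powSum (dcoef c) 1 < powSum (dcoef (dcoef c)) x := by
    intro x hx
    have m1 := min_le_left (ε / 2) (1 / 2)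
    have m2 := min_le_right (ε / 2) (1 / 2)
    refine hev ?_ ⟨by linarith [hx.1], hx.2⟩
    rw [Real.dist_eq, abs_lt]
    constructor <;> linarith [hx.1, hx.2]
  have m0 : 0 < min (ε / 2) (1 / 2 : ℝ) := by positivity
  have m2 := min_le_right (ε / 2) (1 / 2)
  exact ⟨_, by linarith, by linarith, fun x hx => (key x hx).1, fun x hx => (key x hx).2⟩

namespace IsThreshold

variable {c : ℕ → ℝ} {x₁ x : ℝ}

lemma mem_unit (h : IsThreshold c x₁) (hx : x ∈ Icc x₁ 1) : x ∈ Icc (0 : ℝ) 1 :=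
  ⟨h.pos.le.trans hx.1, hx.2⟩

lemma one_mem (h : IsThreshold c x₁) : (1 : ℝ) ∈ Icc x₁ 1 := ⟨h.lt_one.le, le_rfl⟩

lemma thin_one (h : IsThreshold c x₁) : thin c 1 = 1 := div_self (h.first_pos 1 h.one_mem).ne'

lemma curve_one (h : IsThreshold c x₁) : curve c 1 = c := by
  funext i
  rw [curve, h.thin_one, sub_self, shift_one_zero]

lemma thin_pos (h : IsThreshold c x₁) (hx : x ∈ Icc x₁ 1) : 0 < thin c x :=
  div_pos (h.first_pos x hx) (h.first_pos 1 h.one_mem)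

lemma thin_hasDerivWithinAt (hc : IsSupercritical c) (hx : x ∈ Icc (0 : ℝ) 1) :
    HasDerivWithinAt (thin c) (powSum (dcoef (dcoef c)) x / powSum (dcoef c) 1) (Icc 0 1) x :=
  (powSum_hasDerivWithinAt_unit (dcoef_nonneg hc.nonneg) hc.summable_dcoef
    hc.summable_dcoef_dcoef hx).div_const _

lemma thin_le (h : IsThreshold c x₁) (hc : IsSupercritical c) (hx : x ∈ Icc x₁ 1) :
    thin c x ≤ x := by
  have hd : ∀ y ∈ Icc x₁ 1, HasDerivWithinAt (fun y => thin c y - y)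
      (powSum (dcoef (dcoef c)) y / powSum (dcoef c) 1 - 1) (Icc x₁ 1) y := fun y hy =>
    ((thin_hasDerivWithinAt hc (h.mem_unit hy)).mono (Icc_subset_Icc_left h.pos.le)).sub
      (hasDerivWithinAt_id y _)
  have hmono : MonotoneOn (fun y => thin c y - y) (Icc x₁ 1) := by
    refine monotoneOn_of_hasDerivWithinAt_nonneg (convex_Icc _ _)
      (fun y hy => (hd y hy).continuousWithinAt)
      (fun y hy => (hd y (interior_subset hy)).mono interior_subset) fun y hy => ?_
    rw [sub_nonneg, le_div_iff₀ (h.first_pos 1 h.one_mem), one_mul]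
    exact (h.lt_second y (interior_subset hy)).le
  have := hmono hx h.one_mem hx.2
  simp only [h.thin_one] at this
  linarith

lemma emom_curve (h : IsThreshold c x₁) (hc : IsSupercritical c) (hx : x ∈ Icc x₁ 1) :
    Emom (curve c x) = thin c x * powSum (dcoef c) x := by
  rw [curve, hc.emom_shift (h.thin_pos hx).le (sub_nonneg.2 (h.thin_le hc hx)) (by linarith [hx.2]),
    add_sub_cancel]

lemma qmom_curve (h : IsThreshold c x₁) (hc : IsSupercritical c) (hx : x ∈ Icc x₁ 1) :
    Qmom (curve c x) = thin c x ^ 2 * powSum (dcoef (dcoef c)) x := by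
  rw [curve, hc.qmom_shift (h.thin_pos hx).le (sub_nonneg.2 (h.thin_le hc hx)) (by linarith [hx.2]),
    add_sub_cancel]

lemma ghat_curve (h : IsThreshold c x₁) (hc : IsSupercritical c) (hx : x ∈ Icc x₁ 1) {s : ℝ}
    (hs : s ∈ Icc (0 : ℝ) 1) : ghat (curve c x) s
      = powSum (dcoef c) (thin c x * s + (x - thin c x)) / powSum (dcoef c) x := by
  rw [curve, hc.ghat_shift (h.thin_pos hx) (sub_nonneg.2 (h.thin_le hc hx)) (by linarith [hx.2]) hs,
    add_sub_cancel]

lemma isSupercritical_curve (h : IsThreshold c x₁) (hc : IsSupercritical c) (hx : x ∈ Icc x₁ 1) :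
    IsSupercritical (curve c x) := by
  have ha := h.thin_pos hx
  have hb := sub_nonneg.2 (h.thin_le hc hx)
  have hab : thin c x + (x - thin c x) ≤ 1 := by linarith [hx.2]
  have hf := h.first_pos x hx
  refine ⟨shift_nonneg hc.nonneg ha.le hb, summable_shift hc.nonneg hc.summable ha.le hb hab,
    hc.tsum_shift_le_one ha.le hb hab, hc.summable_dcoef_shift ha.le hb hab,
    hc.summable_dcoef_dcoef_shift ha.le hb hab, ?_, ?_⟩
  · rw [h.emom_curve hc hx]
    exact mul_pos ha hf
  · rw [h.emom_curve hc hx, h.qmom_curve hc hx, pow_two, mul_assoc]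
    refine mul_lt_mul_of_pos_left ?_ ha
    rw [thin, div_mul_eq_mul_div, lt_div_iff₀ (h.first_pos 1 h.one_mem)]
    exact mul_lt_mul_of_pos_left (h.lt_second x hx) hf

lemma surv_isGreatest (h : IsThreshold c x₁) (hc : IsSupercritical c) (hx : x ∈ Icc x₁ 1) :
    IsGreatest (fixSet (ghat (curve c x))) (surv c x) := by
  have hs := h.isSupercritical_curve hc hx
  obtain ⟨r, hr⟩ := (isGen_ghat hs.nonneg hs.summable_dcoef hs.emom_pos).exists_isGreatest
  rwa [surv, hr.csSup_eq]

lemma surv_pos (h : IsThreshold c x₁) (hc : IsSupercritical c) (hx : x ∈ Icc x₁ 1) :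
    0 < surv c x := by
  have hs := h.isSupercritical_curve hc hx
  obtain ⟨s, hs1, hs2⟩ := exists_ghat_lt hs.nonneg hs.summable_dcoef hs.summable_dcoef_dcoef
    hs.emom_pos hs.emom_lt_qmom
  have := (isGen_ghat hs.nonneg hs.summable_dcoef hs.emom_pos).lt_of_lt (h.surv_isGreatest hc hx)
    ⟨hs1.1.le, hs1.2.le⟩ hs2
  linarith [hs1.2]

lemma surv_continuousOn (h : IsThreshold c x₁) (hc : IsSupercritical c) :
    ContinuousOn (surv c) (Icc x₁ 1) := by
  intro x hx
  have hs := h.isSupercritical_curve hc hx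
  obtain ⟨s, hs1, hs2⟩ := exists_ghat_lt hs.nonneg hs.summable_dcoef hs.summable_dcoef_dcoef
    hs.emom_pos hs.emom_lt_qmom
  refine IsGen.continuousWithinAt (g := fun x => ghat (curve c x)) hx (fun y hy => ?_)
    (fun y hy => h.surv_isGreatest hc hy) ⟨s, ⟨hs1.1.le, hs1.2.le⟩, hs2⟩ fun s hs => ?_
  · have hs := h.isSupercritical_curve hc hy
    exact isGen_ghat hs.nonneg hs.summable_dcoef hs.emom_pos
  · have hf := powSum_continuousOn (dcoef_nonneg hc.nonneg) hc.summable_dcoef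
    have hsub : Icc x₁ 1 ⊆ Icc (0 : ℝ) 1 := Icc_subset_Icc_left h.pos.le
    have hthin : ContinuousOn (thin c) (Icc x₁ 1) := (hf.mono hsub).div_const _
    refine ContinuousWithinAt.congr (f := fun y =>
      powSum (dcoef c) (thin c y * s + (y - thin c y)) / powSum (dcoef c) y) ?_
      (fun y hy => h.ghat_curve hc hy hs) (h.ghat_curve hc hx hs)
    refine ContinuousOn.continuousWithinAt (ContinuousOn.div ?_ (hf.mono hsub)
      fun y hy => (h.first_pos y hy).ne') hx
    refine hf.comp (by fun_prop) fun y hy => ?_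
    have h1 := h.thin_le hc hy
    have h2 := mul_nonneg (h.thin_pos hy).le hs.1
    have h3 := mul_le_mul_of_nonneg_left hs.2 (h.thin_pos hy).le
    exact ⟨by linarith, by linarith [hy.2]⟩

lemma isSolS_curve (h : IsThreshold c x₁) (hc : IsSupercritical c) {X : ℝ → ℝ} {T : ℝ}
    (hX0 : X 0 = 1) (hX : ∀ t ∈ Icc 0 T, X t ∈ Icc x₁ 1 ∧
      HasDerivAt X (-1 / (surv c (X t) * powSum (dcoef c) (X t))) t) :
    IsSolS c T (fun i t => curve c (X t) i) (fun t => surv c (X t)) := by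
  refine ⟨fun i => by simp only [hX0, h.curve_one], fun t ht => ?_⟩
  obtain ⟨hx, hXd⟩ := hX t ⟨ht.1, ht.2.le⟩
  have hs := h.isSupercritical_curve hc hx
  refine ⟨hs.nonneg, hs.summable, hs.tsum_le_one, summable_dcoef_iff.1 hs.summable_dcoef,
    hs.emom_pos, summable_dcoef_dcoef_iff.1 hs.summable_dcoef_dcoef, h.surv_isGreatest hc hx,
    fun i => ?_⟩
  have hmaps : MapsTo X (Ico 0 T) (Icc 0 1) := fun u hu => h.mem_unit (hX u ⟨hu.1, hu.2.le⟩).1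
  have hxd := hXd.hasDerivWithinAt (s := Ico 0 T)
  have hthin := (thin_hasDerivWithinAt hc (h.mem_unit hx)).comp t hxd hmaps
  have hpos := h.thin_pos hx
  have hR := h.surv_pos hc hx
  have hf := h.first_pos _ hx
  have hf1 := h.first_pos 1 h.one_mem
  refine (shift_hasDerivWithinAt hc.nonneg hc.summable hthin (hxd.sub hthin) (fun u hu => ?_) ht ?_
    hpos.ne' i).congr_deriv ?_
  · exact sub_nonneg.2 (h.thin_le hc (hX u ⟨hu.1, hu.2.le⟩).1)
  · simp only [Function.comp_apply, Pi.sub_apply]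
    linarith [hx.2]
  · rw [fS, h.emom_curve hc hx, h.qmom_curve hc hx]
    simp only [Function.comp_apply, Pi.sub_apply, curve]
    set z₁ := shift c (thin c (X t)) (X t - thin c (X t)) i
    set z₂ := shift c (thin c (X t)) (X t - thin c (X t)) (i + 1)
    set R := surv c (X t)
    have e : thin c (X t) = powSum (dcoef c) (X t) / powSum (dcoef c) 1 := rfl
    rw [e]
    clear_value z₁ z₂ R
    field_simp
    ring

end IsThreshold

/-- Death rate in (S). -/
noncomputable def deathRate (z : ℕ → ℝ) (r : ℝ) : ℝ := 1 / (r * Emom z)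

/-- Thinning rate in (S). -/
noncomputable def thinRate (z : ℕ → ℝ) (r : ℝ) : ℝ := (Qmom z / Emom z - 1) * deathRate z r

lemma fS_eq_rates (z : ℕ → ℝ) (r : ℝ) (i : ℕ) :
    fS z r i = -(deathRate z r + thinRate z r) * (i * z i)
      + thinRate z r * (((i : ℝ) + 1) * z (i + 1)) := by
  rw [fS, thinRate, deathRate, one_div_mul_eq_div, ← one_div_mul_one_div]
  ring

lemma le_one_of_tsum_le_one {z : ℕ → ℝ} (h0 : ∀ i, 0 ≤ z i) (hs : Summable z) (h : ∑' i, z i ≤ 1)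
    (i : ℕ) : z i ≤ 1 :=
  (hs.le_tsum i fun j _ => h0 j).trans h

lemma exists_rate_bound {c : ℕ → ℝ} (hc : IsSupercritical c) {T : ℝ} (hT : 0 < T)
    {z : ℕ → ℝ → ℝ} {ρ : ℝ → ℝ} (h : IsSolS c T z ρ) :
    ∃ δ C : ℝ, 0 < δ ∧ δ < T ∧ ∀ t ∈ Icc 0 δ, 0 < ρ t ∧
      Emom (fun i => z i t) < Qmom (fun i => z i t) ∧ deathRate (fun i => z i t) (ρ t) ≤ C := by
  obtain ⟨s, hs, hgs⟩ := exists_ghat_lt hc.nonneg hc.summable_dcoef hc.summable_dcoef_dcoef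
    hc.emom_pos hc.emom_lt_qmom
  have hsI : s ∈ Icc (0 : ℝ) 1 := ⟨hs.1.le, hs.2.le⟩
  have hcz : (fun i => z i 0) = c := funext h.1
  have h0 : (0 : ℝ) ∈ Ico 0 T := ⟨le_rfl, hT⟩
  have hzc : ∀ i, ContinuousOn (z i) (Ico 0 T) := fun i t ht =>
    ((h.2 t ht).2.2.2.2.2.2.2 i).continuousWithinAt
  rw [ghat_eq, ← emom_eq, div_lt_iff₀ hc.emom_pos] at hgs
  obtain ⟨N, hN⟩ : ∃ N, powSum (dcoef c) s < s * ∑ k ∈ Finset.range N, dcoef c k := by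
    have := (hc.summable_dcoef.hasSum.tendsto_sum_nat).const_mul s
    rw [← powSum_one, ← emom_eq] at this
    exact (this.eventually (lt_mem_nhds hgs)).exists
  have hNpos : 0 < ∑ k ∈ Finset.range N, dcoef c k :=
    pos_of_mul_pos_right ((powSum_nonneg (dcoef_nonneg hc.nonneg) hs.1.le).trans_lt hN) hs.1.le
  set m := (∑ k ∈ Finset.range N, dcoef c k) / 2 with hm
  have hm0 : 0 < m := half_pos hNpos
  have hEc : ContinuousOn (fun t => ∑ k ∈ Finset.range N, dcoef (fun i => z i t) k) (Ico 0 T) :=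
    continuousOn_finsetSum _ fun k _ => (hzc (k + 1)).const_mul _
  have hFc : ContinuousOn (fun t => powSum (dcoef fun i => z i t) s) (Ico 0 T) := by
    have hsum : Summable fun k : ℕ => ((k : ℝ) + 1) * s ^ k := by
      have h1 : ‖s‖ < 1 := by rw [Real.norm_of_nonneg hs.1.le]; exact hs.2
      have := (summable_pow_mul_geometric_of_norm_lt_one 1 h1).add
        (summable_geometric_of_norm_lt_one h1)
      refine this.congr fun k => ?_
      ring
    refine continuousOn_tsum (fun k => ((hzc (k + 1)).const_mul _).mul_const _) hsum fun k t ht => ?_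
    obtain ⟨h1, h2, h3, -⟩ := h.2 t ht
    rw [Real.norm_of_nonneg (mul_nonneg (dcoef_nonneg h1 k) (pow_nonneg hs.1.le k))]
    refine mul_le_mul_of_nonneg_right ?_ (pow_nonneg hs.1.le k)
    exact mul_le_of_le_one_right (by positivity) (le_one_of_tsum_le_one h1 h2 h3 _)
  have hev1 := (hFc 0 h0).eventually_lt ((hEc 0 h0).const_mul s) (by simpa only [hcz] using hN)
  have hev2 := (hEc 0 h0).eventually (lt_mem_nhds (a := m) (by
    simp only [hcz]
    linarith))
  have hev := hev1.and hev2
  rw [eventually_nhdsWithin_iff, Metric.eventually_nhds_iff] at hev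
  obtain ⟨ε, hε, hev⟩ := hev
  refine ⟨min (ε / 2) (T / 2), 1 / ((1 - s) * m), by positivity,
    (min_le_right _ _).trans_lt (half_lt_self hT), fun t ht => ?_⟩
  have htT : t ∈ Ico 0 T := ⟨ht.1, (ht.2.trans (min_le_right _ _)).trans_lt (half_lt_self hT)⟩
  obtain ⟨h1, h2⟩ := hev (y := t) (by
    rw [Real.dist_eq, sub_zero, abs_of_nonneg ht.1]
    exact (ht.2.trans (min_le_left _ _)).trans_lt (half_lt_self hε)) htT
  obtain ⟨hz0, -, -, hzd, hE, hzdd, hr, -⟩ := h.2 t htT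
  have hd := summable_dcoef_iff.2 hzd
  have hle : ∑ k ∈ Finset.range N, dcoef (fun i => z i t) k ≤ Emom (fun i => z i t) := by
    rw [emom_eq, powSum_one]
    exact hd.sum_le_tsum _ fun k _ => dcoef_nonneg hz0 k
  have hlt : ghat (fun i => z i t) s < s := by
    rw [ghat_eq, ← emom_eq, div_lt_iff₀ hE]
    exact h1.trans_le (mul_le_mul_of_nonneg_left hle hs.1.le)
  have hρ := (isGen_ghat hz0 hd hE).lt_of_lt hr hsI hlt
  have hs1 : 0 < 1 - s := sub_pos.2 hs.2
  refine ⟨hs1.trans hρ, emom_lt_qmom_of_ghat_lt hz0 hd (summable_dcoef_dcoef_iff.2 hzdd) hE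
    ⟨hs.1.le, hs.2⟩ hlt, ?_⟩
  exact one_div_le_one_div_of_le (mul_pos hs1 hm0)
    (mul_le_mul hρ.le (h2.le.trans hle) hm0.le (hs1.trans hρ).le)

lemma sum_rates (z : ℕ → ℝ) (α β : ℝ) (n : ℕ) :
    ∑ i ∈ Finset.range (n + 1), (-(α + β) * (i * z i) + β * (((i : ℝ) + 1) * z (i + 1)))
      = -α * ∑ i ∈ Finset.range (n + 1), (i : ℝ) * z i + β * (((n : ℝ) + 1) * z (n + 1)) := by
  induction n with
  | zero => simp
  | succ n ih =>
    rw [Finset.sum_range_succ, ih, Finset.sum_range_succ _ (n + 1)]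
    push_cast
    ring

lemma intervalIntegrable_of_hasDerivWithinAt_of_le {V V' : ℝ → ℝ} {δ K : ℝ} (hδ : 0 ≤ δ)
    (hV : ∀ t ∈ Icc 0 δ, HasDerivWithinAt V (V' t) (Icc 0 δ) t) (hK : ∀ t ∈ Icc 0 δ, -K ≤ V' t) :
    IntervalIntegrable V' volume 0 δ := by
  have h1 : IntervalIntegrable (fun t => V' t + K) volume 0 δ := by
    refine intervalIntegral.intervalIntegrable_deriv_of_nonneg (g := fun t => V t + K * t) ?_ ?_ ?_
    · rw [uIcc_of_le hδ]
      exact ContinuousOn.add (fun t ht => (hV t ht).continuousWithinAt) (by fun_prop)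
    · rw [min_eq_left hδ, max_eq_right hδ]
      intro t ht
      have := (hV t (Ioo_subset_Icc_self ht)).hasDerivAt (Icc_mem_nhds ht.1 ht.2)
      exact this.add (by simpa using (hasDerivAt_id t).const_mul K)
    · rw [min_eq_left hδ, max_eq_right hδ]
      intro t ht
      linarith [hK t (Ioo_subset_Icc_self ht)]
  simpa using h1.sub (intervalIntegrable_const (c := K))

/-- Bounded death rates and nonnegative thinning rates of a linear flow are integrable near `0`,
without any a priori measurability. -/
lemma exists_intervalIntegrable_rates {z : ℕ → ℝ → ℝ} {A B : ℝ → ℝ} {δ C : ℝ} (hδ : 0 < δ)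
    (hz0 : ∀ t ∈ Icc (0 : ℝ) δ, ∀ i, 0 ≤ z i t) (hz1 : ∀ t ∈ Icc (0 : ℝ) δ, ∀ i, z i t ≤ 1)
    (hd : ∀ i : ℕ, ∀ t ∈ Icc (0 : ℝ) δ, HasDerivWithinAt (z i)
      (-(A t + B t) * (i * z i t) + B t * (((i : ℝ) + 1) * z (i + 1) t)) (Icc 0 δ) t)
    (hA : ∀ t ∈ Icc (0 : ℝ) δ, 0 ≤ A t) (hAC : ∀ t ∈ Icc (0 : ℝ) δ, A t ≤ C)
    (hB : ∀ t ∈ Icc (0 : ℝ) δ, 0 ≤ B t) (hne : ∃ i, i ≠ 0 ∧ 0 < z i 0) :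
    ∃ ε, 0 < ε ∧ ε ≤ δ ∧ IntervalIntegrable A volume 0 ε ∧ IntervalIntegrable B volume 0 ε := by
  classical
  have hm0 := Nat.find_spec hne
  have hmin := fun k => Nat.find_min hne (m := k)
  obtain ⟨n, hn⟩ := Nat.exists_eq_succ_of_ne_zero hm0.1
  rw [hn] at hm0 hmin
  have h0 : (0 : ℝ) ∈ Icc (0 : ℝ) δ := ⟨le_rfl, hδ.le⟩
  set M : ℕ → ℝ → ℝ := fun k t => ∑ i ∈ Finset.range (k + 1), (i : ℝ) * z i t with hM
  set q : ℕ → ℝ → ℝ := fun k t => ((k : ℝ) + 1) * z (k + 1) t with hq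
  have hzc : ∀ i, ContinuousOn (z i) (Icc 0 δ) := fun i t ht => (hd i t ht).continuousWithinAt
  have hMc : ∀ k, ContinuousOn (M k) (Icc 0 δ) := fun k =>
    continuousOn_finsetSum _ fun i _ => (hzc i).const_mul _
  have hqc : ∀ k, ContinuousOn (q k) (Icc 0 δ) := fun k => (hzc _).const_mul _
  have hMle : ∀ k, ∀ t ∈ Icc (0 : ℝ) δ, M k t ≤ ∑ i ∈ Finset.range (k + 1), (i : ℝ) :=
    fun k t ht => Finset.sum_le_sum fun i _ =>
      mul_le_of_le_one_right (Nat.cast_nonneg i) (hz1 t ht i)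
  have hVi : ∀ k, IntervalIntegrable (fun t => -A t * M k t + B t * q k t) volume 0 δ := by
    intro k
    refine intervalIntegrable_of_hasDerivWithinAt_of_le hδ.le
      (V := fun t => ∑ i ∈ Finset.range (k + 1), z i t)
      (K := C * ∑ i ∈ Finset.range (k + 1), (i : ℝ)) (fun t ht => ?_) fun t ht => ?_
    · exact (HasDerivWithinAt.fun_sum fun i _ => hd i t ht).congr_deriv
        (sum_rates (fun i => z i t) (A t) (B t) k)
    · have h1 := mul_le_mul (hAC t ht) (hMle k t ht) (Finset.sum_nonneg fun i _ =>
        mul_nonneg (Nat.cast_nonneg i) (hz0 t ht i)) ((hA t ht).trans (hAC t ht))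
      have h2 : 0 ≤ B t * q k t :=
        mul_nonneg (hB t ht) (mul_nonneg (by positivity) (hz0 t ht _))
      linarith
  set D : ℝ → ℝ := fun t => M (n + 1) t * q n t - M n t * q (n + 1) t with hD
  have hDc : ContinuousOn D (Icc 0 δ) :=
    ((hMc _).mul (hqc _)).sub ((hMc _).mul (hqc _))
  have hD0 : 0 < D 0 := by
    have hMn : M n 0 = 0 := by
      refine Finset.sum_eq_zero fun i hi => ?_
      have := hmin i (Finset.mem_range.1 hi)
      rcases eq_or_ne i 0 with rfl | hi0
      · simp
      · have h1 : z i 0 ≤ 0 := by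
          by_contra! hlt
          exact this ⟨hi0, hlt⟩
        rw [le_antisymm h1 (hz0 0 h0 i), mul_zero]
    have hqn : 0 < q n 0 := mul_pos (by positivity) hm0.2
    have hMs : M (n + 1) 0 = q n 0 := by
      simp only [hM] at hMn
      simp only [hM]
      rw [Finset.sum_range_succ, hMn, zero_add, hq]
      push_cast
      rfl
    simp only [hD, hMn, hMs, zero_mul, sub_zero]
    exact mul_pos hqn hqn
  have hev := (hDc 0 h0).eventually (lt_mem_nhds hD0)
  rw [eventually_nhdsWithin_iff, Metric.eventually_nhds_iff] at hev
  obtain ⟨ε, hε, hev⟩ := hev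
  have hsub : Icc 0 (min (ε / 2) δ) ⊆ Icc 0 δ := Icc_subset_Icc_right (min_le_right _ _)
  have hmin0 : 0 < min (ε / 2) δ := by positivity
  have hDpos : ∀ t ∈ Icc 0 (min (ε / 2) δ), 0 < D t := fun t ht => hev (by
    rw [Real.dist_eq, sub_zero, abs_of_nonneg ht.1]
    exact (ht.2.trans (min_le_left _ _)).trans_lt (half_lt_self hε)) (hsub ht)
  have hu : uIcc 0 (min (ε / 2) δ) = Icc 0 (min (ε / 2) δ) := uIcc_of_le hmin0.le
  have hdiv : ∀ g : ℝ → ℝ, ContinuousOn g (Icc 0 δ) →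
      ContinuousOn (fun t => g t / D t) (uIcc 0 (min (ε / 2) δ)) := fun g hg => by
    rw [hu]
    exact (hg.mono hsub).div (hDc.mono hsub) fun t ht => (hDpos t ht).ne'
  have hVi2 : ∀ k, IntervalIntegrable (fun t => -A t * M k t + B t * q k t) volume 0
      (min (ε / 2) δ) := fun k => (hVi k).mono_set (by
    rw [hu, uIcc_of_le hδ.le]
    exact hsub)
  refine ⟨min (ε / 2) δ, hmin0, min_le_right _ _, ?_, ?_⟩
  · refine (((hVi2 n).mul_continuousOn (hdiv _ (hqc (n + 1)))).sub
      ((hVi2 (n + 1)).mul_continuousOn (hdiv _ (hqc n)))).congr fun t ht => ?_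
    have := (hDpos t (hu ▸ uIoc_subset_uIcc ht)).ne'
    rw [mul_div_assoc', mul_div_assoc', ← sub_div, div_eq_iff this]
    ring
  · refine (((hVi2 n).mul_continuousOn (hdiv _ (hMc (n + 1)))).sub
      ((hVi2 (n + 1)).mul_continuousOn (hdiv _ (hMc n)))).congr fun t ht => ?_
    have := (hDpos t (hu ▸ uIoc_subset_uIcc ht)).ne'
    rw [mul_div_assoc', mul_div_assoc', ← sub_div, div_eq_iff this]
    ring

lemma eq_add_mul_of_hasDerivAt {f : ℝ → ℝ} {δ κ : ℝ} (hf : ContinuousOn f (Icc 0 δ))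
    (hd : ∀ t ∈ Ioo 0 δ, HasDerivAt f κ t) {t : ℝ} (ht : t ∈ Icc 0 δ) : f t = f 0 + κ * t := by
  rcases ht.1.eq_or_lt with rfl | h0
  · simp
  obtain ⟨y, -, hy⟩ := exists_hasDerivAt_eq_slope f (fun _ => κ) h0
    (hf.mono (Icc_subset_Icc_right ht.2)) fun y hy => hd y ⟨hy.1, hy.2.trans_le ht.2⟩
  rw [eq_div_iff (by linarith)] at hy
  linarith

lemma hasDerivAt_integral_of_continuousOn {f : ℝ → ℝ} {δ t : ℝ} (hf : ContinuousOn f (Icc 0 δ))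
    (ht : t ∈ Ioo 0 δ) : HasDerivAt (fun t => ∫ u in (0 : ℝ)..t, f u) (f t) t :=
  intervalIntegral.integral_hasDerivAt_right
    ((hf.mono (by
      rw [uIcc_of_le ht.1.le]
      exact Icc_subset_Icc_right ht.2.le)).intervalIntegrable)
    ((hf.mono Ioo_subset_Icc_self).stronglyMeasurableAtFilter isOpen_Ioo t ht)
    (hf.continuousAt (Icc_mem_nhds ht.1 ht.2))

/-- Near time `0`, a solution of (S) is a rescaled expansion of its initial value, and its affine
parameters are driven by the continuous rates of (S). -/
lemma exists_affine_parameters {c : ℕ → ℝ} (hc : IsSupercritical c) {T : ℝ} (hT : 0 < T)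
    {z : ℕ → ℝ → ℝ} {ρ : ℝ → ℝ} (h : IsSolS c T z ρ) :
    ∃ (δ : ℝ) (a b : ℝ → ℝ), 0 < δ ∧ δ < T ∧ a 0 = 1 ∧ b 0 = 0 ∧
      ContinuousOn a (Icc 0 δ) ∧ ContinuousOn b (Icc 0 δ) ∧
      (∀ t ∈ Icc 0 δ, 0 < a t ∧ 0 ≤ b t ∧ a t + b t ≤ 1 ∧ 0 < ρ t ∧
        (fun i => z i t) = shift c (a t) (b t)) ∧
      ∀ t ∈ Ioo 0 δ,
        HasDerivAt a (-(deathRate (shift c (a t) (b t)) (ρ t)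
          + thinRate (shift c (a t) (b t)) (ρ t)) * a t) t ∧
        HasDerivAt b (thinRate (shift c (a t) (b t)) (ρ t) * a t) t := by
  obtain ⟨δ₀, C, hδ₀, hδ₀T, hbd⟩ := exists_rate_bound hc hT h
  have hcz : (fun i => z i 0) = c := funext h.1
  have hsub : Icc 0 δ₀ ⊆ Ico 0 T := fun t ht => ⟨ht.1, ht.2.trans_lt hδ₀T⟩
  set A : ℝ → ℝ := fun t => deathRate (fun i => z i t) (ρ t) with hA
  set B : ℝ → ℝ := fun t => thinRate (fun i => z i t) (ρ t) with hB
  have hA0 : ∀ t ∈ Icc 0 δ₀, 0 ≤ A t := fun t ht =>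
    one_div_nonneg.2 (mul_nonneg (hbd t ht).1.le (h.2 t (hsub ht)).2.2.2.2.1.le)
  have hB0 : ∀ t ∈ Icc 0 δ₀, 0 ≤ B t := fun t ht => by
    refine mul_nonneg (sub_nonneg.2 ?_) (hA0 t ht)
    exact (one_le_div (h.2 t (hsub ht)).2.2.2.2.1).2 (hbd t ht).2.1.le
  have hz0 : ∀ t ∈ Icc (0 : ℝ) δ₀, ∀ i, 0 ≤ z i t := fun t ht => (h.2 t (hsub ht)).1
  have hz1 : ∀ t ∈ Icc (0 : ℝ) δ₀, ∀ i, z i t ≤ 1 := fun t ht =>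
    le_one_of_tsum_le_one (hz0 t ht) (h.2 t (hsub ht)).2.1 (h.2 t (hsub ht)).2.2.1
  have hd : ∀ i : ℕ, ∀ t ∈ Icc (0 : ℝ) δ₀, HasDerivWithinAt (z i)
      (-(A t + B t) * (i * z i t) + B t * (((i : ℝ) + 1) * z (i + 1) t)) (Icc 0 δ₀) t :=
    fun i t ht => (((h.2 t (hsub ht)).2.2.2.2.2.2.2 i).mono hsub).congr_deriv (fS_eq_rates _ _ i)
  have hne : ∃ i, i ≠ 0 ∧ 0 < z i 0 := by
    by_contra! hcon
    refine hc.emom_pos.ne' ?_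
    have : ∀ j : ℕ, (j : ℝ) * c j = 0 := fun j => by
      rcases eq_or_ne j 0 with rfl | hj
      · simp
      · rw [← h.1 j, le_antisymm (hcon j hj) (hz0 0 ⟨le_rfl, hδ₀.le⟩ j), mul_zero]
    simp [Emom, this]
  obtain ⟨δ, hδ, hδδ₀, hAi, hBi⟩ := exists_intervalIntegrable_rates hδ₀ hz0 hz1 hd hA0
    (fun t ht => (hbd t ht).2.2) hB0 hne
  have hsub' : Icc 0 δ ⊆ Icc 0 δ₀ := Icc_subset_Icc_right hδδ₀
  obtain ⟨a, b, ha0, hb0, hac, hbc, hab, hai, hbi⟩ := eq_shift_of_linear_flow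
    (fun t ht => hz0 t (hsub' ht)) (fun t ht => hz1 t (hsub' ht))
    (fun t ht => (h.2 t (hsub (hsub' ht))).2.1)
    (fun i t ht => (hd i t (hsub' ht)).mono hsub')
    (fun t ht => hA0 t (hsub' ht)) (fun t ht => hB0 t (hsub' ht)) hAi hBi
  have hshift : ∀ t ∈ Icc 0 δ, (fun i => z i t) = shift c (a t) (b t) := fun t ht => by
    rw [← hcz]
    exact funext (hab t ht).2.2.2
  have hmem : MapsTo (fun t => a t + b t) (Icc 0 δ) (Icc 0 1) := fun t ht =>
    ⟨add_nonneg (hab t ht).1.le (hab t ht).2.1, (hab t ht).2.2.1⟩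
  have hf := powSum_continuousOn (dcoef_nonneg hc.nonneg) hc.summable_dcoef
  have hf2 := powSum_continuousOn (dcoef_nonneg (dcoef_nonneg hc.nonneg)) hc.summable_dcoef_dcoef
  have hEeq : ∀ t ∈ Icc 0 δ, Emom (fun i => z i t) = a t * powSum (dcoef c) (a t + b t) :=
    fun t ht => by rw [hshift t ht, hc.emom_shift (hab t ht).1.le (hab t ht).2.1 (hab t ht).2.2.1]
  have hQeq : ∀ t ∈ Icc 0 δ, Qmom (fun i => z i t)
      = a t ^ 2 * powSum (dcoef (dcoef c)) (a t + b t) :=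
    fun t ht => by rw [hshift t ht, hc.qmom_shift (hab t ht).1.le (hab t ht).2.1 (hab t ht).2.2.1]
  have hEpos : ∀ t ∈ Icc 0 δ, 0 < Emom (fun i => z i t) := fun t ht =>
    (h.2 t (hsub (hsub' ht))).2.2.2.2.1
  have hEc : ContinuousOn (fun t => Emom fun i => z i t) (Icc 0 δ) :=
    (hac.mul (hf.comp (hac.add hbc) hmem)).congr hEeq
  have hQc : ContinuousOn (fun t => Qmom fun i => z i t) (Icc 0 δ) :=
    ((hac.pow 2).mul (hf2.comp (hac.add hbc) hmem)).congr hQeq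
  have hρc : ContinuousOn ρ (Icc 0 δ) := by
    intro t ht
    obtain ⟨hz, -, -, hzd, hE, hzdd, -⟩ := h.2 t (hsub (hsub' ht))
    obtain ⟨s, hs, hgs⟩ := exists_ghat_lt hz (summable_dcoef_iff.2 hzd)
      (summable_dcoef_dcoef_iff.2 hzdd) hE (hbd t (hsub' ht)).2.1
    refine IsGen.continuousWithinAt (g := fun t => ghat fun i => z i t) ht (fun u hu => ?_)
      (fun u hu => (h.2 u (hsub (hsub' hu))).2.2.2.2.2.2.1) ⟨s, ⟨hs.1.le, hs.2.le⟩, hgs⟩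
      fun s hs => ?_
    · obtain ⟨hz, -, -, hzd, hE, -⟩ := h.2 u (hsub (hsub' hu))
      exact isGen_ghat hz (summable_dcoef_iff.2 hzd) hE
    · have heq : ∀ u ∈ Icc 0 δ, ghat (fun i => z i u) s
          = powSum (dcoef c) (a u * s + b u) / powSum (dcoef c) (a u + b u) := fun u hu => by
        rw [hshift u hu, hc.ghat_shift (hab u hu).1 (hab u hu).2.1 (hab u hu).2.2.1 hs]
      refine ContinuousOn.congr (ContinuousOn.div ?_ (hf.comp (hac.add hbc) hmem) ?_) heq t ht
      · refine hf.comp (by fun_prop) fun u hu => ?_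
        obtain ⟨h1, h2, h3, -⟩ := hab u hu
        have h4 := mul_nonneg h1.le hs.1
        have h5 := mul_le_mul_of_nonneg_left hs.2 h1.le
        exact ⟨by linarith, by linarith⟩
      · intro u hu h0
        change powSum (dcoef c) (a u + b u) = 0 at h0
        have := hEpos u hu
        rw [hEeq u hu, h0, mul_zero] at this
        exact this.false
  have hAc : ContinuousOn A (Icc 0 δ) := continuousOn_const.div (hρc.mul hEc) fun t ht =>
    (mul_pos (hbd t (hsub' ht)).1 (hEpos t ht)).ne'
  have hBc : ContinuousOn B (Icc 0 δ) :=
    ((hQc.div hEc fun t ht => (hEpos t ht).ne').sub continuousOn_const).mul hAc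
  refine ⟨δ, a, b, hδ, hδδ₀.trans_lt hδ₀T, ha0, hb0, hac, hbc, fun t ht =>
    ⟨(hab t ht).1, (hab t ht).2.1, (hab t ht).2.2.1, (hbd t (hsub' ht)).1, hshift t ht⟩,
    fun t ht => ?_⟩
  rw [← hshift t (Ioo_subset_Icc_self ht)]
  constructor
  · have h1 := (hasDerivAt_integral_of_continuousOn (hAc.add hBc) ht).fun_neg.exp
    have h2 : a = fun t => Real.exp (-∫ u in (0 : ℝ)..t, (A + B) u) := funext hai
    rw [← h2] at h1
    refine h1.congr_deriv ?_
    rw [hai t]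
    simp only [Pi.add_apply]
    ring
  · rw [show b = fun t => ∫ u in (0 : ℝ)..t, B u * a u from funext hbi]
    exact hasDerivAt_integral_of_continuousOn (hBc.mul hac) ht

/-- Every solution of (S) started at `c` follows `curve c`, at the speed prescribed by the
clock. -/
lemma IsThreshold.eventually_eq_curve {c : ℕ → ℝ} {x₁ : ℝ} (hx₁ : IsThreshold c x₁)
    (hc : IsSupercritical c) {G X : ℝ → ℝ} (hG1 : G 1 = 0) (hXG : ∀ x, X (-G x) = x)
    (hG : ∀ x ∈ Icc x₁ 1, HasDerivAt G (surv c x * powSum (dcoef c) x) x)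
    {T : ℝ} (hT : 0 < T) {z : ℕ → ℝ → ℝ} {ρ : ℝ → ℝ} (h : IsSolS c T z ρ) :
    ∃ δ > 0, δ < T ∧ ∀ t ∈ Icc 0 δ, (fun i => z i t) = curve c (X t) := by
  obtain ⟨δ₀, a, b, hδ₀, hδ₀T, ha0, hb0, hac, hbc, hab, hder⟩ := exists_affine_parameters hc hT h
  set x : ℝ → ℝ := fun t => a t + b t with hx
  have hx0 : x 0 = 1 := by simp [hx, ha0, hb0]
  have hxc : ContinuousOn x (Icc 0 δ₀) := hac.add hbc
  obtain ⟨δ, hδ, hδδ₀, hxI⟩ : ∃ δ > 0, δ ≤ δ₀ ∧ ∀ t ∈ Icc 0 δ, x t ∈ Icc x₁ 1 := by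
    have hev := (hxc 0 ⟨le_rfl, hδ₀.le⟩).eventually (lt_mem_nhds (hx0 ▸ hx₁.lt_one))
    rw [eventually_nhdsWithin_iff, Metric.eventually_nhds_iff] at hev
    obtain ⟨ε, hε, hev⟩ := hev
    refine ⟨min (ε / 2) δ₀, by positivity, min_le_right _ _, fun t ht => ?_⟩
    have htm : t ∈ Icc 0 δ₀ := ⟨ht.1, ht.2.trans (min_le_right _ _)⟩
    refine ⟨(hev ?_ htm).le, (hab t htm).2.2.1⟩
    rw [Real.dist_eq, sub_zero, abs_of_nonneg ht.1]
    exact (ht.2.trans (min_le_left _ _)).trans_lt (half_lt_self hε)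
  have hsub : Icc 0 δ ⊆ Icc 0 δ₀ := Icc_subset_Icc_right hδδ₀
  have hpos := hx₁.first_pos
  have hp1 := hpos 1 hx₁.one_mem
  have hxd : ∀ t ∈ Ioo 0 δ, HasDerivAt x (-1 / (ρ t * powSum (dcoef c) (x t))) t := by
    intro t ht
    have htm := hsub (Ioo_subset_Icc_self ht)
    obtain ⟨h1, h2⟩ := hder t ⟨ht.1, ht.2.trans_le hδδ₀⟩
    obtain ⟨hat, hbt, habt, hρ, -⟩ := hab t htm
    refine (h1.add h2).congr_deriv ?_
    have hp := hpos _ (hxI t (Ioo_subset_Icc_self ht))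
    rw [deathRate, hc.emom_shift hat.le hbt habt]
    change 0 < powSum (dcoef c) (a t + b t) at hp
    change _ = -1 / (ρ t * powSum (dcoef c) (a t + b t))
    field_simp
    ring
  have hthin : ∀ t ∈ Icc 0 δ, a t = thin c (x t) := by
    intro t ht
    have hqc : ContinuousOn (fun t => a t / thin c (x t)) (Icc 0 δ) := by
      refine (hac.mono hsub).div ?_ fun t ht => (hx₁.thin_pos (hxI t ht)).ne'
      exact ((powSum_continuousOn (dcoef_nonneg hc.nonneg) hc.summable_dcoef).comp
        (hxc.mono hsub) fun t ht => hx₁.mem_unit (hxI t ht)).div_const _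
    have hq := eq_add_mul_of_hasDerivAt (κ := 0) hqc (fun t ht => ?_) ht
    · rw [hx0, hx₁.thin_one, ha0, div_one, zero_mul, add_zero,
        div_eq_one_iff_eq (hx₁.thin_pos (hxI t ht)).ne'] at hq
      exact hq
    · have htm := Ioo_subset_Icc_self ht
      obtain ⟨h1, -⟩ := hder t ⟨ht.1, ht.2.trans_le hδδ₀⟩
      obtain ⟨hat, hbt, habt, hρ, -⟩ := hab t (hsub htm)
      have h3 := ((thin_hasDerivWithinAt hc (hx₁.mem_unit (hxI t htm))).comp t
        (hxd t ht).hasDerivWithinAt (s := Icc 0 δ) fun u hu => hx₁.mem_unit (hxI u hu)).hasDerivAt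
        (Icc_mem_nhds ht.1 ht.2)
      have htp := hx₁.thin_pos (hxI t htm)
      refine (h1.div h3 htp.ne').congr_deriv ?_
      have hp := hpos _ (hxI t htm)
      rw [thinRate, deathRate, hc.emom_shift hat.le hbt habt, hc.qmom_shift hat.le hbt habt]
      change 0 < powSum (dcoef c) (a t + b t) at hp
      simp only [Function.comp_apply, thin, hx]
      field_simp
      ring
  have hcurve : ∀ t ∈ Icc 0 δ, (fun i => z i t) = curve c (x t) := fun t ht => by
    rw [(hab t (hsub ht)).2.2.2.2, curve, ← hthin t ht]
    simp only [hx, add_sub_cancel_left]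
  have hGx : ∀ t ∈ Icc 0 δ, G (x t) = -t := by
    intro t ht
    have hGc : ContinuousOn (fun t => G (x t)) (Icc 0 δ) :=
      ContinuousOn.comp (t := Icc x₁ 1) (fun y hy => (hG y hy).continuousAt.continuousWithinAt)
        (hxc.mono hsub) hxI
    have := eq_add_mul_of_hasDerivAt (κ := -1) hGc (fun u hu => ?_) ht
    · rw [this, hx0, hG1]
      ring
    · have hum := Ioo_subset_Icc_self hu
      have hρ : ρ u = surv c (x u) := by
        rw [surv, ← hcurve u hum]
        exact (h.2 u ⟨hu.1.le, (hu.2.trans_le hδδ₀).trans hδ₀T⟩).2.2.2.2.2.2.1.csSup_eq.symm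
      refine ((hG _ (hxI u hum)).comp u (hxd u hu)).congr_deriv ?_
      rw [hρ]
      have := hpos _ (hxI u hum)
      have := hx₁.surv_pos hc (hxI u hum)
      field_simp
  refine ⟨δ, hδ, hδδ₀.trans_lt hδ₀T, fun t ht => ?_⟩
  rw [hcurve t ht]
  have := hXG (x t)
  rw [hGx t ht, neg_neg] at this
  rw [this]

lemma IsThreshold.exists_clock {c : ℕ → ℝ} {x₁ : ℝ} (h : IsThreshold c x₁)
    (hc : IsSupercritical c) :
    ∃ (G X : ℝ → ℝ) (T : ℝ), 0 < T ∧ G 1 = 0 ∧ (∀ x, X (-G x) = x) ∧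
      (∀ x ∈ Icc x₁ 1, HasDerivAt G (surv c x * powSum (dcoef c) x) x) ∧
      ∀ t ∈ Icc 0 T, X t ∈ Icc x₁ 1 ∧
        HasDerivAt X (-1 / (surv c (X t) * powSum (dcoef c) (X t))) t :=
  DegreeFlow.exists_clock h.lt_one
    ((h.surv_continuousOn hc).mul ((powSum_continuousOn (dcoef_nonneg hc.nonneg)
      hc.summable_dcoef).mono (Icc_subset_Icc_left h.pos.le)))
    fun x hx => mul_pos (h.surv_pos hc hx) (h.first_pos x hx)

/-- Two solutions of (S) with the same supercritical initial value agree for small times. -/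
lemma IsSupercritical.eventually_eq {c : ℕ → ℝ} (hc : IsSupercritical c) {T : ℝ} (hT : 0 < T)
    {z₁ z₂ : ℕ → ℝ → ℝ} {ρ₁ ρ₂ : ℝ → ℝ} (h₁ : IsSolS c T z₁ ρ₁) (h₂ : IsSolS c T z₂ ρ₂) :
    ∃ δ > 0, ∀ t ∈ Icc 0 δ, ∀ i, z₁ i t = z₂ i t := by
  obtain ⟨x₁, hx₁⟩ := hc.exists_threshold
  obtain ⟨G, X, -, -, hG1, hXG, hG, -⟩ := hx₁.exists_clock hc
  obtain ⟨δ₁, hδ₁, -, he₁⟩ := hx₁.eventually_eq_curve hc hG1 hXG hG hT h₁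
  obtain ⟨δ₂, hδ₂, -, he₂⟩ := hx₁.eventually_eq_curve hc hG1 hXG hG hT h₂
  refine ⟨min δ₁ δ₂, lt_min hδ₁ hδ₂, fun t ht i => ?_⟩
  have h1 := congrFun (he₁ t ⟨ht.1, ht.2.trans (min_le_left _ _)⟩) i
  have h2 := congrFun (he₂ t ⟨ht.1, ht.2.trans (min_le_right _ _)⟩) i
  exact h1.trans h2.symm

lemma isSolS_time_shift {c : ℕ → ℝ} {T t₀ : ℝ} {z : ℕ → ℝ → ℝ} {ρ : ℝ → ℝ}
    (h : IsSolS c T z ρ) (ht₀ : 0 ≤ t₀) :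
    IsSolS (fun i => z i t₀) (T - t₀) (fun i t => z i (t₀ + t)) fun t => ρ (t₀ + t) := by
  refine ⟨fun i => by simp, fun t ht => ?_⟩
  have hmaps : MapsTo (fun u => t₀ + u) (Ico 0 (T - t₀)) (Ico 0 T) := fun u hu =>
    ⟨add_nonneg ht₀ hu.1, by linarith [hu.2]⟩
  obtain ⟨h1, h2, h3, h4, h5, h6, h7, h8⟩ := h.2 _ (hmaps ht)
  refine ⟨h1, h2, h3, h4, h5, h6, h7, fun i => ?_⟩
  exact ((h8 i).comp t ((hasDerivAt_id t).const_add t₀).hasDerivWithinAt hmaps).congr_deriv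
    (mul_one _)

/-- A solution of (S) along which the sequence stays supercritical is the only one. -/
lemma eq_of_supercritical_solution {c : ℕ → ℝ} {T : ℝ} {z y : ℕ → ℝ → ℝ} {ρ σ : ℝ → ℝ}
    (hz : IsSolS c T z ρ) (hy : IsSolS c T y σ)
    (hsup : ∀ t ∈ Ico 0 T, IsSupercritical fun i => z i t) {t : ℝ} (ht : t ∈ Ico 0 T) (i : ℕ) :
    y i t = z i t := by
  have hsub : Icc 0 t ⊆ Ico 0 T := fun u hu => ⟨hu.1, hu.2.trans_lt ht.2⟩
  have hcont : ∀ {w : ℕ → ℝ → ℝ} {τ : ℝ → ℝ}, IsSolS c T w τ → ∀ i, ContinuousOn (w i) (Icc 0 t) :=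
    fun hw i u hu => ((hw.2 u (hsub hu)).2.2.2.2.2.2.2 i).continuousWithinAt.mono hsub
  have hclosed : IsClosed ({u | ∀ i, y i u = z i u} ∩ Icc 0 t) := by
    have : {u | ∀ i, y i u = z i u} ∩ Icc 0 t
        = ⋂ i, Icc 0 t ∩ (fun u => y i u - z i u) ⁻¹' {0} := by
      ext u
      simp only [mem_inter_iff, mem_ofPred_eq, mem_iInter, mem_preimage, mem_singleton_iff,
        sub_eq_zero]
      exact ⟨fun hu i => ⟨hu.2, hu.1 i⟩, fun hu => ⟨fun i => (hu i).2, (hu 0).1⟩⟩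
    rw [this]
    exact isClosed_iInter fun i => ((hcont hy i).sub (hcont hz i)).preimage_isClosed_of_isClosed
      isClosed_Icc isClosed_singleton
  refine hclosed.Icc_subset_of_forall_exists_gt (fun i => (hy.1 i).trans (hz.1 i).symm) ?_
    ⟨ht.1, le_rfl⟩ i
  intro t₀ ⟨heq, ht₀⟩ s hs
  have ht₀T : t₀ ∈ Ico 0 T := hsub ⟨ht₀.1, ht₀.2.le⟩
  have hy' := isSolS_time_shift hy ht₀.1
  rw [funext heq] at hy'
  obtain ⟨δ, hδ, hagree⟩ := (hsup t₀ ht₀T).eventually_eq (sub_pos.2 ht₀T.2) hy'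
    (isSolS_time_shift hz ht₀.1)
  have hs : 0 < s - t₀ := sub_pos.2 hs
  refine ⟨t₀ + min δ (s - t₀), fun i => hagree _ ⟨by positivity, min_le_left _ _⟩ i, ?_, ?_⟩
  · have : 0 < min δ (s - t₀) := by positivity
    linarith
  · linarith [min_le_right δ (s - t₀)]

lemma IsSupercritical.of_moments {c : ℕ → ℝ} (h0 : ∀ i, 0 ≤ c i) (h1 : ∑' i, c i = 1)
    (hmom : Summable fun k : ℕ => (k : ℝ) ^ 2 * c k) (hsup : Emom c < Qmom c) :
    IsSupercritical c := by
  have hE : Summable fun k : ℕ => (k : ℝ) * c k :=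
    hmom.of_nonneg_of_le (fun k => mul_nonneg (Nat.cast_nonneg k) (h0 k)) fun k =>
      mul_le_mul_of_nonneg_right (by exact_mod_cast Nat.le_self_pow two_ne_zero k) (h0 k)
  have hQ : Summable fun k : ℕ => (k : ℝ) * ((k : ℝ) - 1) * c k :=
    (hmom.sub hE).congr fun k => by ring
  have hnn : ∀ k : ℕ, 0 ≤ (k : ℝ) * c k := fun k => mul_nonneg (Nat.cast_nonneg k) (h0 k)
  refine ⟨h0, ?_, h1.le, summable_dcoef_iff.2 hE, summable_dcoef_dcoef_iff.2 hQ,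
    (tsum_nonneg hnn).lt_of_ne' fun hzero => ?_, hsup⟩
  · by_contra hns
    rw [tsum_eq_zero_of_not_summable hns] at h1
    exact zero_ne_one h1
  · have hk : ∀ k : ℕ, (k : ℝ) * c k = 0 :=
      congrFun ((hasSum_zero_iff_of_nonneg hnn).1 (hzero ▸ hE.hasSum))
    have hq : Qmom c = 0 := by
      have : ∀ k : ℕ, (k : ℝ) * ((k : ℝ) - 1) * c k = 0 := fun k => by
        rw [mul_right_comm, hk, zero_mul]
      simp [Qmom, this]
    exact absurd hsup (by rw [hq, Emom, hzero]; exact lt_irrefl 0)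

/-- Local existence and uniqueness for (S) from a supercritical initial distribution. -/
theorem exists_unique_isSolS {c : ℕ → ℝ} (hc : IsSupercritical c) :
    ∃ tmax > (0 : ℝ), (∃ z ρ, IsSolS c tmax z ρ) ∧
      ∀ z₁ ρ₁ z₂ ρ₂, IsSolS c tmax z₁ ρ₁ → IsSolS c tmax z₂ ρ₂ →
        ∀ i : ℕ, ∀ t ∈ Ico (0 : ℝ) tmax, z₁ i t = z₂ i t := by
  obtain ⟨x₁, hx₁⟩ := hc.exists_threshold
  obtain ⟨G, X, T, hT, hG1, hXG, hG, hX⟩ := hx₁.exists_clock hc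
  have hX0 : X 0 = 1 := by simpa [hG1] using hXG 1
  have hsol := hx₁.isSolS_curve hc hX0 hX
  have hcrit : ∀ t ∈ Ico 0 T, IsSupercritical fun i => curve c (X t) i := fun t ht =>
    hx₁.isSupercritical_curve hc (hX t ⟨ht.1, ht.2.le⟩).1
  refine ⟨T, hT, ⟨_, _, hsol⟩, fun z₁ ρ₁ z₂ ρ₂ h₁ h₂ i t ht => ?_⟩
  rw [eq_of_supercritical_solution hsol h₁ hcrit ht i,
    eq_of_supercritical_solution hsol h₂ hcrit ht i]

end DegreeFlow

/-- Lemma 4 of the paper: if the system (S′) has a unique solution on some interval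
`[0, t'max)`, then the system (S) has a unique solution on some interval `[0, tmax)`. -/
theorem S'_unique_implies_S_unique
    (π : ℕ → ℝ) (hπ0 : ∀ i, 0 ≤ π i) (hπ1 : ∑' i : ℕ, π i = 1)
    (hmom : Summable fun k : ℕ => (k : ℝ) ^ 2 * π k)
    (hsup : (∑' k : ℕ, (k : ℝ) * ((k : ℝ) - 1) * π k) > ∑' k : ℕ, (k : ℝ) * π k)
    (hS' : ∃ tmax' > (0 : ℝ),
      (∃ ζ, IsSolS' π tmax' ζ) ∧
      ∀ ζ₁ ζ₂, IsSolS' π tmax' ζ₁ → IsSolS' π tmax' ζ₂ →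
        ∀ i : ℕ, ∀ t ∈ Ico (0 : ℝ) tmax', ζ₁ i t = ζ₂ i t) :
    ∃ tmax > (0 : ℝ),
      (∃ z ρ, IsSolS π tmax z ρ) ∧
      ∀ z₁ ρ₁ z₂ ρ₂, IsSolS π tmax z₁ ρ₁ → IsSolS π tmax z₂ ρ₂ →
        ∀ i : ℕ, ∀ t ∈ Ico (0 : ℝ) tmax, z₁ i t = z₂ i t :=
  DegreeFlow.exists_unique_isSolS (.of_moments hπ0 hπ1 hmom hsup)
end

section
/- Let π = (π_i)_{i≥0} be a probability distribution on the nonnegative integers and let (ζ_i)_{i≥0} be a solution of the system (S′) on an interval [0,T] on which E(t) = Σ_j j ζ_j(t) > 0 and all the series involved converge and may be differentiated term by term. Then d/dt (Σ_{i≥0} ζ_i(t)) = −1 for all t ∈ [0,T]; in particular Σ_{i≥0} ζ_i(t) = 1 − t. -/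
theorem Summable.hasSum_sub_succ {G : Type*} [AddCommGroup G] [TopologicalSpace G]
    [IsTopologicalAddGroup G] [T2Space G] {f : ℕ → G} (hf : Summable f) :
    HasSum (fun i => f i - f (i + 1)) (f 0) := by
  have h := hf.hasSum.sub ((summable_nat_add_iff 1).2 hf).hasSum
  rwa [hf.tsum_eq_zero_add, add_sub_cancel_right] at h


open Set

/-- Lemma 6, item 1, of the paper: for a solution `ζ` of the system (S′) whose series can
be differentiated term by term, the total mass `∑ᵢ ζᵢ(t)` has derivative `-1`; in
particular `∑ᵢ ζᵢ(t) = 1 - t`. -/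
theorem sum_zeta_has_derivative_neg_one
    (π : ℕ → ℝ) (hπ0 : ∀ i, 0 ≤ π i) (hπ1 : ∑' i : ℕ, π i = 1)
    (T : ℝ) (hT : 0 < T)
    (ζ : ℕ → ℝ → ℝ) (E Q : ℝ → ℝ)
    (hE : ∀ t, E t = ∑' j : ℕ, (j : ℝ) * ζ j t)
    (hQ : ∀ t, Q t = ∑' j : ℕ, (j : ℝ) * ((j : ℝ) - 1) * ζ j t)
    (hinit : ∀ i, ζ i 0 = π i)
    (hpos : ∀ t ∈ Icc (0 : ℝ) T, ∀ i, 0 ≤ ζ i t)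
    (hs0 : ∀ t ∈ Icc (0 : ℝ) T, Summable (fun i => ζ i t))
    (hs1 : ∀ t ∈ Icc (0 : ℝ) T, Summable (fun i : ℕ => (i : ℝ) * ζ i t))
    (hs2 : ∀ t ∈ Icc (0 : ℝ) T, Summable (fun i : ℕ => (i : ℝ) * ((i : ℝ) - 1) * ζ i t))
    (hEpos : ∀ t ∈ Icc (0 : ℝ) T, 0 < E t)
    (hode : ∀ t ∈ Icc (0 : ℝ) T, ∀ i : ℕ, HasDerivWithinAt (fun u => ζ i u)
      (-(i : ℝ) * ζ i t / E t
        + (1 / E t) * (1 - Q t / E t) * ((i : ℝ) * ζ i t - ((i : ℝ) + 1) * ζ (i + 1) t))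
      (Icc (0 : ℝ) T) t)
    (hterm : ∀ t ∈ Icc (0 : ℝ) T,
      Summable (fun i : ℕ => -(i : ℝ) * ζ i t / E t
        + (1 / E t) * (1 - Q t / E t) * ((i : ℝ) * ζ i t - ((i : ℝ) + 1) * ζ (i + 1) t)) ∧
      HasDerivWithinAt (fun u => ∑' i : ℕ, ζ i u)
        (∑' i : ℕ, (-(i : ℝ) * ζ i t / E t
          + (1 / E t) * (1 - Q t / E t) * ((i : ℝ) * ζ i t - ((i : ℝ) + 1) * ζ (i + 1) t)))
        (Icc (0 : ℝ) T) t) :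
    ∀ t ∈ Icc (0 : ℝ) T,
      HasDerivWithinAt (fun u => ∑' i : ℕ, ζ i u) (-1) (Icc (0 : ℝ) T) t ∧
      (∑' i : ℕ, ζ i t) = 1 - t := by
  have hder : ∀ t ∈ Icc (0 : ℝ) T,
      HasDerivWithinAt (fun u => ∑' i : ℕ, ζ i u) (-1) (Icc (0 : ℝ) T) t := by
    intro t ht
    have hEne : E t ≠ 0 := (hEpos t ht).ne'
    have hsumE : HasSum (fun i : ℕ => (i : ℝ) * ζ i t) (E t) := by
      rw [hE t]
      exact (hs1 t ht).hasSum
    have htel := (hs1 t ht).hasSum_sub_succ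
    have hsum := (hsumE.mul_left (-1 / E t)).add
      (htel.mul_left ((1 / E t) * (1 - Q t / E t)))
    have hval : ∑' i : ℕ, (-(i : ℝ) * ζ i t / E t
        + (1 / E t) * (1 - Q t / E t) * ((i : ℝ) * ζ i t - ((i : ℝ) + 1) * ζ (i + 1) t))
        = -1 := by
      convert hsum.tsum_eq using 1
      · refine tsum_congr fun i => ?_
        push_cast
        ring
      · simp [div_mul_cancel₀ _ hEne]
    exact hval ▸ (hterm t ht).2
  have hder0 : ∀ t ∈ Icc (0 : ℝ) T,
      HasDerivWithinAt (fun u => (∑' i : ℕ, ζ i u) + u) 0 (Icc (0 : ℝ) T) t := by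
    intro t ht
    simpa using (hder t ht).fun_add (hasDerivWithinAt_id t _)
  have hconst := constant_of_derivWithin_zero
    (fun t ht => (hder0 t ht).differentiableWithinAt)
    (fun t ht => (hder0 t (Ico_subset_Icc_self ht)).derivWithin
      (uniqueDiffOn_Icc hT t (Ico_subset_Icc_self ht)))
  refine fun t ht => ⟨hder t ht, ?_⟩
  have h := hconst t ht
  simp only [hinit, hπ1, add_zero] at h
  exact eq_sub_of_add_eq h
end

section
/- Let π = (π_i)_{i≥0} be a probability distribution on the nonnegative integers and let (ζ_i)_{i≥0} be a solution of the system (S′) on an interval [0,T] on which E(t) = Σ_j j ζ_j(t) > 0 and all the series involved converge and may be differentiated term by term. Then E′(t) = −2·(Σ_{i≥1} i(i−1) ζ_i(t)) / E(t) for all t ∈ [0,T]. -/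
open Set

/-- Lemma 6, item 2, of the paper: for a solution `ζ` of the system (S′) whose series can
be differentiated term by term, the first moment `E(t) = ∑ᵢ i ζᵢ(t)` satisfies
`E'(t) = -2 (∑ᵢ i(i-1) ζᵢ(t)) / E(t)`. -/
theorem first_moment_derivative
    (π : ℕ → ℝ) (hπ0 : ∀ i, 0 ≤ π i) (hπ1 : ∑' i : ℕ, π i = 1)
    (T : ℝ) (hT : 0 < T)
    (ζ : ℕ → ℝ → ℝ) (E Q : ℝ → ℝ)
    (hE : ∀ t, E t = ∑' j : ℕ, (j : ℝ) * ζ j t)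
    (hQ : ∀ t, Q t = ∑' j : ℕ, (j : ℝ) * ((j : ℝ) - 1) * ζ j t)
    (hinit : ∀ i, ζ i 0 = π i)
    (hpos : ∀ t ∈ Icc (0 : ℝ) T, ∀ i, 0 ≤ ζ i t)
    (hs0 : ∀ t ∈ Icc (0 : ℝ) T, Summable (fun i => ζ i t))
    (hs1 : ∀ t ∈ Icc (0 : ℝ) T, Summable (fun i : ℕ => (i : ℝ) * ζ i t))
    (hs2 : ∀ t ∈ Icc (0 : ℝ) T, Summable (fun i : ℕ => (i : ℝ) * ((i : ℝ) - 1) * ζ i t))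
    (hEpos : ∀ t ∈ Icc (0 : ℝ) T, 0 < E t)
    (hode : ∀ t ∈ Icc (0 : ℝ) T, ∀ i : ℕ, HasDerivWithinAt (fun u => ζ i u)
      (-(i : ℝ) * ζ i t / E t
        + (1 / E t) * (1 - Q t / E t) * ((i : ℝ) * ζ i t - ((i : ℝ) + 1) * ζ (i + 1) t))
      (Icc (0 : ℝ) T) t)
    (hterm : ∀ t ∈ Icc (0 : ℝ) T,
      Summable (fun i : ℕ => (i : ℝ) * (-(i : ℝ) * ζ i t / E t
        + (1 / E t) * (1 - Q t / E t) * ((i : ℝ) * ζ i t - ((i : ℝ) + 1) * ζ (i + 1) t))) ∧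
      HasDerivWithinAt (fun u => ∑' i : ℕ, (i : ℝ) * ζ i u)
        (∑' i : ℕ, (i : ℝ) * (-(i : ℝ) * ζ i t / E t
          + (1 / E t) * (1 - Q t / E t) * ((i : ℝ) * ζ i t - ((i : ℝ) + 1) * ζ (i + 1) t)))
        (Icc (0 : ℝ) T) t) :
    ∀ t ∈ Icc (0 : ℝ) T,
      HasDerivWithinAt E (-2 * Q t / E t) (Icc (0 : ℝ) T) t := by
  intro t ht
  have h1 : HasSum (fun j : ℕ => (j : ℝ) * ζ j t) (E t) := by
    rw [hE t]; exact (hs1 t ht).hasSum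
  have h2 : HasSum (fun j : ℕ => (j : ℝ) * ((j : ℝ) - 1) * ζ j t) (Q t) := by
    rw [hQ t]; exact (hs2 t ht).hasSum
  have h3 : HasSum (fun j : ℕ => ((j : ℝ) + 1) * (j : ℝ) * ζ (j + 1) t) (Q t) := by
    simpa using (hasSum_nat_add_iff' 1).mpr h2
  have hE0 : E t ≠ 0 := (hEpos t ht).ne'
  have hsq := h2.add h1
  have hsum : HasSum (fun i : ℕ => (i : ℝ) * (-(i : ℝ) * ζ i t / E t
      + (1 / E t) * (1 - Q t / E t) * ((i : ℝ) * ζ i t - ((i : ℝ) + 1) * ζ (i + 1) t)))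
      (-2 * Q t / E t) := by
    have hlim : -1 / E t * (Q t + E t) + (1 / E t) * (1 - Q t / E t) * (Q t + E t - Q t)
        = -2 * Q t / E t := by
      field_simp
      ring
    rw [← hlim]
    have hcomb := ((hsq.mul_left (-1 / E t)).add
      ((hsq.sub h3).mul_left ((1 / E t) * (1 - Q t / E t))))
    refine (congrArg (HasSum · _) (funext fun i => ?_)).mp hcomb
    ring
  have hEf : E = fun u => ∑' i : ℕ, (i : ℝ) * ζ i u := funext hE
  have hderiv := (hterm t ht).2
  rwa [hsum.tsum_eq, ← hEf] at hderiv
end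

section
/- Let π = (π_i)_{i≥0} be a probability distribution on the nonnegative integers, let E : [0,T] → (0,∞) be a continuously differentiable function with E(0) = Σ_j j π_j > 0, set Z(t) = ∫₀ᵗ ( E′(u)/(2√E(u)) + 1/√E(u) ) du, fix an integer Δ ≥ 1, and let (ζ_i^{(Δ)})_{0≤i≤Δ} be the solution of the truncated linear system driven by E. Then for all t ∈ [0,T] and s ∈ [0,1], Σ_{0≤i≤Δ} ζ_i^{(Δ)}(t) s^i = f_Δ( ( s·√E(t) − Z(t) ) / √E(0) ), where f_Δ(x) = Σ_{0≤i≤Δ} π_i x^i. -/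
open Set

/-- The telescoping identity behind the constancy of the truncated generating polynomial along
characteristics. -/
theorem sum_range_characteristic_telescope (z : ℕ → ℝ) (a q x : ℝ) (n : ℕ) :
    ∑ i ∈ Finset.range n,
        (((i : ℝ) / 2 * q * z i - ((i : ℝ) + 1) * z (i + 1) * a) * x ^ i
          + z i * ((i : ℝ) * x ^ (i - 1) * (a - x * q / 2)))
      = -(a * n * z n * x ^ (n - 1)) := by
  induction n with
  | zero => simp
  | succ n ih =>
    rw [Finset.sum_range_succ, ih]
    cases n with
    | zero => simp; ring
    | succ m =>
      simp only [Nat.add_sub_cancel]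
      push_cast
      ring

/-- The fundamental theorem of calculus on a compact interval, endpoints included. -/
theorem hasDerivWithinAt_integral_Icc {g : ℝ → ℝ} {a b t : ℝ}
    (hg : ContinuousOn g (Icc a b)) (ht : t ∈ Icc a b) :
    HasDerivWithinAt (fun u => ∫ v in a..u, g v) (g t) (Icc a b) t := by
  have : Fact (t ∈ Icc a b) := ⟨ht⟩
  have hsub : uIcc a t ⊆ Icc a b := by
    rw [uIcc_of_le ht.1]
    exact Icc_subset_Icc_right ht.2
  exact intervalIntegral.integral_hasDerivWithinAt_right
    (hg.mono hsub).intervalIntegrable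
    (hg.stronglyMeasurableAtFilter_nhdsWithin measurableSet_Icc t) (hg t ht)

/-- Lemma 7 of the paper: the generating polynomial of the solution of the truncated
linear system driven by `E` is `f_Δ((s √E(t) - Z(t)) / √E(0))`. -/
theorem truncated_system_generating_series
    (π : ℕ → ℝ) (hπ0 : ∀ i, 0 ≤ π i) (hπ1 : ∑' i : ℕ, π i = 1)
    (T : ℝ) (hT : 0 < T) (Δ : ℕ) (hΔ : 1 ≤ Δ)
    (E E' Z : ℝ → ℝ)
    (hE0 : E 0 = ∑' j : ℕ, (j : ℝ) * π j) (hE0pos : 0 < E 0)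
    (hEpos : ∀ t ∈ Icc (0 : ℝ) T, 0 < E t)
    (hE' : ∀ t ∈ Icc (0 : ℝ) T, HasDerivWithinAt E (E' t) (Icc (0 : ℝ) T) t)
    (hE'cont : ContinuousOn E' (Icc (0 : ℝ) T))
    (hZ : ∀ t, Z t = ∫ u in (0 : ℝ)..t,
      (E' u / (2 * Real.sqrt (E u)) + 1 / Real.sqrt (E u)))
    (ζ : ℕ → ℝ → ℝ)
    (hinit : ∀ i ≤ Δ, ζ i 0 = π i)
    (htop : ∀ t ∈ Icc (0 : ℝ) T, HasDerivWithinAt (fun u => ζ Δ u)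
      (((Δ : ℝ) / 2) * (E' t / E t) * ζ Δ t) (Icc (0 : ℝ) T) t)
    (hmid : ∀ i < Δ, ∀ t ∈ Icc (0 : ℝ) T, HasDerivWithinAt (fun u => ζ i u)
      (((i : ℝ) / 2) * (E' t / E t) * ζ i t
        - ((i : ℝ) + 1) * ζ (i + 1) t * (E' t / (2 * E t) + 1 / E t))
      (Icc (0 : ℝ) T) t) :
    ∀ t ∈ Icc (0 : ℝ) T, ∀ s ∈ Icc (0 : ℝ) 1,
      ∑ i ∈ Finset.range (Δ + 1), ζ i t * s ^ i
        = ∑ k ∈ Finset.range (Δ + 1),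
            π k * ((s * Real.sqrt (E t) - Z t) / Real.sqrt (E 0)) ^ k := by
  intro t ht s _
  have hEcont : ContinuousOn E (Icc 0 T) := fun u hu => (hE' u hu).continuousWithinAt
  have hsqrt : ContinuousOn (fun u => Real.sqrt (E u)) (Icc 0 T) := hEcont.sqrt
  have hsqrt_ne : ∀ u ∈ Icc (0 : ℝ) T, Real.sqrt (E u) ≠ 0 := fun u hu =>
    (Real.sqrt_pos.2 (hEpos u hu)).ne'
  have hZ' : ∀ u ∈ Icc (0 : ℝ) T, HasDerivWithinAt Z
      (E' u / (2 * Real.sqrt (E u)) + 1 / Real.sqrt (E u)) (Icc 0 T) u := by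
    intro u hu
    rw [funext hZ]
    refine hasDerivWithinAt_integral_Icc
      (g := fun u => E' u / (2 * Real.sqrt (E u)) + 1 / Real.sqrt (E u)) ?_ hu
    exact (hE'cont.div (continuousOn_const.mul hsqrt)
      fun u hu => mul_ne_zero two_ne_zero (hsqrt_ne u hu)).add
      (continuousOn_const.div hsqrt hsqrt_ne)
  set c := s * Real.sqrt (E t) - Z t with hc
  -- the characteristic through `(t, s)`
  let x : ℝ → ℝ := fun u => (c + Z u) / Real.sqrt (E u)
  have hx : ∀ u ∈ Icc (0 : ℝ) T, HasDerivWithinAt x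
      ((E' u / (2 * E u) + 1 / E u) - x u * (E' u / E u) / 2) (Icc 0 T) u := by
    intro u hu
    have hne := hsqrt_ne u hu
    have hEu := (hEpos u hu).ne'
    have hsq : Real.sqrt (E u) ^ 2 = E u := Real.sq_sqrt (hEpos u hu).le
    refine (((hZ' u hu).const_add c).div ((hE' u hu).sqrt hEu) hne).congr_deriv ?_
    simp only [x]
    generalize Real.sqrt (E u) = r at hne hsq ⊢
    rw [← hsq]
    field_simp
  let P : ℝ → ℝ := fun u => ∑ i ∈ Finset.range (Δ + 1), ζ i u * x u ^ i
  have hP : ∀ u ∈ Icc (0 : ℝ) T, HasDerivWithinAt P 0 (Icc 0 T) u := by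
    intro u hu
    have hmid' := HasDerivWithinAt.fun_sum (u := Finset.range Δ) fun i hi =>
      (hmid i (Finset.mem_range.1 hi) u hu).mul ((hx u hu).pow i)
    have htop' := (htop u hu).mul ((hx u hu).pow Δ)
    have hPsum : P = fun v => ∑ i ∈ Finset.range Δ, ζ i v * x v ^ i + ζ Δ v * x v ^ Δ :=
      funext fun v => Finset.sum_range_succ _ _
    rw [hPsum]
    refine (hmid'.add htop').congr_deriv ?_
    have htel := sum_range_characteristic_telescope (fun i => ζ i u)
      (E' u / (2 * E u) + 1 / E u) (E' u / E u) (x u) Δ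
    simp only [Pi.pow_apply] at htel ⊢
    rw [htel]
    obtain ⟨m, rfl⟩ := Nat.exists_eq_add_of_le' hΔ
    simp only [Nat.add_sub_cancel]
    ring
  have hconst : P t = P 0 := constant_of_derivWithin_zero
    (fun u hu => (hP u hu).differentiableWithinAt)
    (fun u hu => (hP u (Ico_subset_Icc_self hu)).derivWithin
      (uniqueDiffOn_Icc hT u (Ico_subset_Icc_self hu))) t ht
  have hxt : x t = s := by
    simp only [x, hc, sub_add_cancel]
    exact mul_div_cancel_right₀ s (hsqrt_ne t ht)
  have hx0 : x 0 = c / Real.sqrt (E 0) := by simp [x, hZ 0]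
  simp only [P, hxt, hx0] at hconst
  rw [hconst]
  refine Finset.sum_congr rfl fun i hi => ?_
  rw [hinit i (Nat.lt_succ_iff.1 (Finset.mem_range.1 hi))]
end

section
/- Let π = (π_i)_{i≥0} be a probability distribution on the nonnegative integers, let E : [0,T] → (0,∞) be a continuously differentiable function with E(0) = Σ_j j π_j > 0, set Z(t) = ∫₀ᵗ ( E′(u)/(2√E(u)) + 1/√E(u) ) du, fix an integer Δ ≥ 1, and let (ζ_i^{(Δ)})_{0≤i≤Δ} be the solution of the truncated linear system driven by E. Then for every 0 ≤ i ≤ Δ and t ∈ [0,T], ζ_i^{(Δ)}(t) = Σ_{k=i}^{Δ} π_k · E(0)^{−k/2} · binom(k, k−i) · (−Z(t))^{k−i} · E(t)^{i/2}. -/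
open Set

theorem hasDerivWithinAt_integral_of_continuousOn_Icc {f : ℝ → ℝ} {a b t : ℝ}
    (hf : ContinuousOn f (Icc a b)) (ht : t ∈ Icc a b) :
    HasDerivWithinAt (fun x => ∫ u in a..x, f u) (f t) (Icc a b) t := by
  have : Fact (t ∈ Icc a b) := ⟨ht⟩
  refine intervalIntegral.integral_hasDerivWithinAt_right ?_
    (hf.stronglyMeasurableAtFilter_nhdsWithin measurableSet_Icc t) (hf t ht)
  refine (hf.mono ?_).intervalIntegrable
  rw [uIcc_of_le ht.1]
  exact Icc_subset_Icc_right ht.2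

theorem choose_sub_mul_sub_eq {i k : ℕ} (h : i + 1 ≤ k) :
    (Nat.choose k (k - i) : ℝ) * ((k - i : ℕ) : ℝ)
      = ((i : ℝ) + 1) * Nat.choose k (k - (i + 1)) := by
  rw [Nat.choose_symm (by lia : i ≤ k), Nat.choose_symm h]
  have := Nat.choose_succ_right_eq k i
  rw [mul_comm ((i : ℝ) + 1)]
  exact_mod_cast this.symm

/-- The binomial sums `y i = ∑_{k=i}^Δ c k C(k, k-i) (-Z)^(k-i)` satisfy
`(y i)' = -(i+1) y (i+1) Z'`. -/
theorem hasDerivWithinAt_sum_choose_mul_neg_pow (c : ℕ → ℝ) (Δ : ℕ) {Z : ℝ → ℝ} {Z' t : ℝ}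
    {s : Set ℝ} (hZ : HasDerivWithinAt Z Z' s t) {i : ℕ} (hi : i ≤ Δ) :
    HasDerivWithinAt
      (fun u => ∑ k ∈ Finset.Icc i Δ, c k * (Nat.choose k (k - i) : ℝ) * (-Z u) ^ (k - i))
      (-((i : ℝ) + 1) * Z' * ∑ k ∈ Finset.Icc (i + 1) Δ,
        c k * (Nat.choose k (k - (i + 1)) : ℝ) * (-Z t) ^ (k - (i + 1))) s t := by
  have h := HasDerivWithinAt.fun_sum (u := Finset.Icc i Δ) fun k _ =>
    ((hZ.fun_neg.fun_pow (k - i)).const_mul (c k * (Nat.choose k (k - i) : ℝ)))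
  refine h.congr_deriv ?_
  rw [← Finset.insert_Icc_add_one_left_eq_Icc hi, Finset.sum_insert (by simp), Finset.mul_sum]
  simp only [Nat.sub_self, Nat.cast_zero, zero_mul, mul_zero, zero_add]
  refine Finset.sum_congr rfl fun k hk => ?_
  rw [Nat.sub_sub]
  linear_combination (-c k * (-Z t) ^ (k - (i + 1)) * Z') *
    choose_sub_mul_sub_eq (Finset.mem_Icc.1 hk).1

/-- The explicit formula for the solution of the truncated linear system driven by `E`:
`ζᵢ^(Δ)(t) = ∑_{k=i}^Δ π_k E(0)^(-k/2) C(k, k-i) (-Z(t))^(k-i) E(t)^(i/2)`. -/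
theorem truncated_system_explicit_solution
    (π : ℕ → ℝ) (hπ0 : ∀ i, 0 ≤ π i) (hπ1 : ∑' i : ℕ, π i = 1)
    (T : ℝ) (hT : 0 < T) (Δ : ℕ) (hΔ : 1 ≤ Δ)
    (E E' Z : ℝ → ℝ)
    (hE0 : E 0 = ∑' j : ℕ, (j : ℝ) * π j) (hE0pos : 0 < E 0)
    (hEpos : ∀ t ∈ Icc (0 : ℝ) T, 0 < E t)
    (hE' : ∀ t ∈ Icc (0 : ℝ) T, HasDerivWithinAt E (E' t) (Icc (0 : ℝ) T) t)
    (hE'cont : ContinuousOn E' (Icc (0 : ℝ) T))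
    (hZ : ∀ t, Z t = ∫ u in (0 : ℝ)..t,
      (E' u / (2 * Real.sqrt (E u)) + 1 / Real.sqrt (E u)))
    (ζ : ℕ → ℝ → ℝ)
    (hinit : ∀ i ≤ Δ, ζ i 0 = π i)
    (htop : ∀ t ∈ Icc (0 : ℝ) T, HasDerivWithinAt (fun u => ζ Δ u)
      (((Δ : ℝ) / 2) * (E' t / E t) * ζ Δ t) (Icc (0 : ℝ) T) t)
    (hmid : ∀ i < Δ, ∀ t ∈ Icc (0 : ℝ) T, HasDerivWithinAt (fun u => ζ i u)
      (((i : ℝ) / 2) * (E' t / E t) * ζ i t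
        - ((i : ℝ) + 1) * ζ (i + 1) t * (E' t / (2 * E t) + 1 / E t))
      (Icc (0 : ℝ) T) t) :
    ∀ i ≤ Δ, ∀ t ∈ Icc (0 : ℝ) T,
      ζ i t = ∑ k ∈ Finset.Icc i Δ,
        π k * E 0 ^ (-(k : ℝ) / 2) * (Nat.choose k (k - i) : ℝ)
          * (-Z t) ^ (k - i) * E t ^ ((i : ℝ) / 2) := by
  have hsub : ∀ t ∈ Icc (0 : ℝ) T, HasDerivWithinAt Z
      (E' t / (2 * Real.sqrt (E t)) + 1 / Real.sqrt (E t)) (Icc (0 : ℝ) T) t := by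
    intro t ht
    have hEc : ContinuousOn E (Icc (0 : ℝ) T) := fun u hu => (hE' u hu).continuousWithinAt
    have hs : ContinuousOn (fun u => Real.sqrt (E u)) (Icc (0 : ℝ) T) := hEc.sqrt
    have hne : ∀ u ∈ Icc (0 : ℝ) T, Real.sqrt (E u) ≠ 0 := fun u hu =>
      (Real.sqrt_pos.2 (hEpos u hu)).ne'
    rw [show Z = _ from funext hZ]
    refine hasDerivWithinAt_integral_of_continuousOn_Icc
      (f := fun u => E' u / (2 * Real.sqrt (E u)) + 1 / Real.sqrt (E u)) ?_ ht
    exact (hE'cont.div (continuousOn_const.mul hs) fun u hu =>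
        mul_ne_zero two_ne_zero (hne u hu)).add
      (continuousOn_const.div hs hne)
  set y : ℕ → ℝ → ℝ := fun i t => ∑ k ∈ Finset.Icc i Δ,
    π k * E 0 ^ (-(k : ℝ) / 2) * (Nat.choose k (k - i) : ℝ) * (-Z t) ^ (k - i) with hy
  suffices H : ∀ i ≤ Δ, ∀ t ∈ Icc (0 : ℝ) T, ζ i t = y i t * E t ^ ((i : ℝ) / 2) by
    intro i hi t ht
    rw [H i hi t ht, hy, Finset.sum_mul]
  have hZ0 : Z 0 = 0 := by simp [hZ]
  have hy0 : ∀ i ≤ Δ, y i 0 = π i * E 0 ^ (-(i : ℝ) / 2) := by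
    intro i hi
    simp only [hy, hZ0]
    rw [Finset.sum_eq_single_of_mem i (Finset.mem_Icc.2 ⟨le_rfl, hi⟩)]
    · simp
    · intro k hk hki
      have : k - i ≠ 0 := by have := (Finset.mem_Icc.1 hk).1; lia
      simp [this]
  have step : ∀ i ≤ Δ, (∀ t ∈ Icc (0 : ℝ) T, HasDerivWithinAt (ζ i)
      (((i : ℝ) / 2) * (E' t / E t) * ζ i t
        - ((i : ℝ) + 1) * (y (i + 1) t * E t ^ (((i + 1 : ℕ) : ℝ) / 2))
          * (E' t / (2 * E t) + 1 / E t)) (Icc (0 : ℝ) T) t) →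
      ∀ t ∈ Icc (0 : ℝ) T, ζ i t = y i t * E t ^ ((i : ℝ) / 2) := by
    intro i hi hd t ht
    have hderiv : ∀ t ∈ Icc (0 : ℝ) T, HasDerivWithinAt
        (fun u => ζ i u * E u ^ (-(i : ℝ) / 2) - y i u) 0 (Icc (0 : ℝ) T) t := by
      intro t ht
      have hEt := hEpos t ht
      have h := ((hd t ht).fun_mul
        ((hE' t ht).rpow_const (p := -(i : ℝ) / 2) (Or.inl hEt.ne'))).fun_sub
        (hasDerivWithinAt_sum_choose_mul_neg_pow
          (fun k => π k * E 0 ^ (-(k : ℝ) / 2)) Δ (hsub t ht) hi)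
      refine h.congr_deriv ?_
      change _ - -((i : ℝ) + 1) * _ * y (i + 1) t = 0
      have h1 : E t ^ (-(i : ℝ) / 2 - 1) = E t ^ (-(i : ℝ) / 2) / E t := Real.rpow_sub_one hEt.ne' _
      have h2 : E t ^ (((i + 1 : ℕ) : ℝ) / 2) * E t ^ (-(i : ℝ) / 2) = Real.sqrt (E t) := by
        rw [← Real.rpow_add hEt, Real.sqrt_eq_rpow]
        congr 1
        push_cast
        ring
      have h3 : E' t / (2 * Real.sqrt (E t)) + 1 / Real.sqrt (E t)
          = Real.sqrt (E t) * (E' t / (2 * E t) + 1 / E t) := by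
        have hs := (Real.sqrt_pos.2 hEt).ne'
        have hsq := Real.sq_sqrt hEt.le
        generalize Real.sqrt (E t) = r at hs hsq
        rw [← hsq]
        field_simp
      rw [h1, h3, ← h2]
      ring
    have hconst := constant_of_derivWithin_zero
      (fun u hu => (hderiv u hu).differentiableWithinAt)
      (fun u hu => (hderiv u (Ico_subset_Icc_self hu)).derivWithin
        (uniqueDiffOn_Icc hT u (Ico_subset_Icc_self hu))) t ht
    simp only [hinit i hi, hy0 i hi, sub_self] at hconst
    rw [← sub_eq_zero.1 hconst, mul_assoc, ← Real.rpow_add (hEpos t ht)]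
    rw [neg_div, neg_add_cancel, Real.rpow_zero, mul_one]
  intro i hi
  induction hi using Nat.decreasingInduction with
  | self =>
    refine step Δ le_rfl fun t ht => (htop t ht).congr_deriv ?_
    simp [hy]
  | of_succ i hi ih =>
    refine step i hi.le fun t ht => (hmid i hi t ht).congr_deriv ?_
    rw [ih t ht]
end

section
/- Let π = (π_i)_{i≥0} be a probability distribution on the nonnegative integers and let (ζ_i)_{i≥0} be a solution of the system (S′) on an interval [0,T] with E(t) = Σ_j j ζ_j(t) > 0 and E′(t)/(2E(t)) + 1/E(t) ≤ 0 for all t ∈ [0,T], and such that Σ_{i≥0} ζ_i(t) = 1 − t. Fix ε > 0 and an integer Δ ≥ 1 with Σ_{0≤i≤Δ} π_i ≥ 1 − ε, and let (ζ_i^{(Δ)})_{0≤i≤Δ} be the solution of the truncated linear system driven by E. Then for all t ∈ [0,T] and all 0 ≤ i ≤ Δ, ζ_i^{(Δ)}(t) ≤ ζ_i(t) ≤ ζ_i^{(Δ)}(t) + 2ε. -/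
open Set

/-- A function on `[0, T]` with nonnegative derivative is at least its initial value. -/
theorem le_of_hasDerivWithinAt_nonneg_Icc {T : ℝ} {f f' : ℝ → ℝ}
    (hf : ∀ t ∈ Icc (0 : ℝ) T, HasDerivWithinAt f (f' t) (Icc (0 : ℝ) T) t)
    (hf' : ∀ t ∈ Icc (0 : ℝ) T, 0 ≤ f' t) {t : ℝ} (ht : t ∈ Icc (0 : ℝ) T) :
    f 0 ≤ f t := by
  have hmono : MonotoneOn f (Icc (0 : ℝ) T) :=
    monotoneOn_of_hasDerivWithinAt_nonneg (convex_Icc 0 T)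
      (fun x hx => (hf x hx).continuousWithinAt)
      (fun x hx => (hf x (interior_subset hx)).mono interior_subset)
      (fun x hx => hf' x (interior_subset hx))
  exact hmono ⟨le_rfl, ht.1.trans ht.2⟩ ht ht.1

/-- A solution of `f' = p (E' / E) f + s` with `s ≥ 0` and `f 0 ≥ 0` stays nonnegative;
the integrating factor is `E ^ (-p)`. -/
theorem nonneg_of_hasDerivWithinAt_logDeriv_mul_add {T p : ℝ} {f s E E' : ℝ → ℝ}
    (hEpos : ∀ t ∈ Icc (0 : ℝ) T, 0 < E t)
    (hE' : ∀ t ∈ Icc (0 : ℝ) T, HasDerivWithinAt E (E' t) (Icc (0 : ℝ) T) t)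
    (hf : ∀ t ∈ Icc (0 : ℝ) T,
      HasDerivWithinAt f (p * (E' t / E t) * f t + s t) (Icc (0 : ℝ) T) t)
    (hs : ∀ t ∈ Icc (0 : ℝ) T, 0 ≤ s t) (hf0 : 0 ≤ f 0) :
    ∀ t ∈ Icc (0 : ℝ) T, 0 ≤ f t := by
  intro t ht
  have hderiv : ∀ u ∈ Icc (0 : ℝ) T, HasDerivWithinAt (fun u => f u * E u ^ (-p))
      (s u * E u ^ (-p)) (Icc (0 : ℝ) T) u := by
    intro u hu
    have hEu := hEpos u hu
    refine ((hf u hu).mul ((hE' u hu).rpow_const (p := -p) (Or.inl hEu.ne'))).congr_deriv ?_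
    rw [Real.rpow_sub_one hEu.ne']
    field_simp
    ring
  have hle := le_of_hasDerivWithinAt_nonneg_Icc hderiv
    (fun u hu => mul_nonneg (hs u hu) (Real.rpow_nonneg (hEpos u hu).le _)) ht
  have h0 : 0 ≤ f 0 * E 0 ^ (-p) :=
    mul_nonneg hf0 (Real.rpow_nonneg (hEpos 0 ⟨le_rfl, ht.1.trans ht.2⟩).le _)
  exact nonneg_of_mul_nonneg_left (h0.trans hle) (Real.rpow_pos_of_pos (hEpos t ht) _)

/-- The sum of the right-hand sides of (S′), weighted by the index. -/
theorem hasSum_index_mul_rhs {z : ℕ → ℝ} {e q : ℝ} (c : ℝ)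
    (h1 : HasSum (fun i : ℕ => (i : ℝ) * z i) e)
    (h2 : HasSum (fun i : ℕ => (i : ℝ) * ((i : ℝ) - 1) * z i) q) :
    HasSum (fun i : ℕ => (i : ℝ) * (-(i : ℝ) * z i / e
      + c * ((i : ℝ) * z i - ((i : ℝ) + 1) * z (i + 1)))) (-(q + e) / e + c * e) := by
  have hsq : HasSum (fun i : ℕ => (i : ℝ) ^ 2 * z i) (q + e) := by
    refine (h2.add h1).congr_fun fun i => ?_
    ring
  have hshift : HasSum (fun i : ℕ => (i : ℝ) * ((i : ℝ) + 1) * z (i + 1)) q := by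
    have h := (hasSum_nat_add_iff' 1).mpr h2
    simp only [Finset.range_one, Finset.sum_singleton, Nat.cast_zero, zero_mul, sub_zero] at h
    refine h.congr_fun fun i => ?_
    push_cast
    ring
  rw [show -(q + e) / e + c * e = -1 / e * (q + e) + c * (q + e - q) by ring]
  refine ((hsq.mul_left (-1 / e)).add ((hsq.sub hshift).mul_left c)).congr_fun fun i => ?_
  ring

/-- Telescoping of the truncated system. -/
theorem sum_truncated_rhs (k g : ℝ) (z : ℕ → ℝ) (n : ℕ) :
    ∑ i ∈ Finset.range n, (k * ((i : ℝ) * z i) - ((i : ℝ) + 1) * z (i + 1) * g)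
      + k * ((n : ℝ) * z n) = (k - g) * ∑ i ∈ Finset.range (n + 1), (i : ℝ) * z i := by
  induction n with
  | zero => simp
  | succ n ih =>
    rw [Finset.sum_range_succ, Finset.sum_range_succ _ (n + 1), mul_add, ← ih]
    push_cast
    ring

/-- Lemma 8 of the paper: a solution `ζ` of the system (S′) (with term-by-term
differentiable series, positive first moment `E`, `E'/(2E) + 1/E ≤ 0` and total mass
`1 - t`) is squeezed between the solution `ζ^(Δ)` of the truncated linear system driven
by `E` and `ζ^(Δ) + 2ε`, provided `∑_{i ≤ Δ} πᵢ ≥ 1 - ε`. -/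
theorem truncation_bounds
    (π : ℕ → ℝ) (hπ0 : ∀ i, 0 ≤ π i) (hπ1 : ∑' i : ℕ, π i = 1)
    (T ε : ℝ) (hT : 0 < T) (hε : 0 < ε)
    (Δ : ℕ) (hΔ : 1 ≤ Δ) (hΔε : 1 - ε ≤ ∑ i ∈ Finset.range (Δ + 1), π i)
    (ζ : ℕ → ℝ → ℝ) (E E' Q : ℝ → ℝ)
    (hE : ∀ t, E t = ∑' j : ℕ, (j : ℝ) * ζ j t)
    (hQ : ∀ t, Q t = ∑' j : ℕ, (j : ℝ) * ((j : ℝ) - 1) * ζ j t)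
    (hinit : ∀ i, ζ i 0 = π i)
    (hpos : ∀ t ∈ Icc (0 : ℝ) T, ∀ i, 0 ≤ ζ i t)
    (hs1 : ∀ t ∈ Icc (0 : ℝ) T, Summable (fun i : ℕ => (i : ℝ) * ζ i t))
    (hs2 : ∀ t ∈ Icc (0 : ℝ) T, Summable (fun i : ℕ => (i : ℝ) * ((i : ℝ) - 1) * ζ i t))
    (hEpos : ∀ t ∈ Icc (0 : ℝ) T, 0 < E t)
    (hode : ∀ t ∈ Icc (0 : ℝ) T, ∀ i : ℕ, HasDerivWithinAt (fun u => ζ i u)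
      (-(i : ℝ) * ζ i t / E t
        + (1 / E t) * (1 - Q t / E t) * ((i : ℝ) * ζ i t - ((i : ℝ) + 1) * ζ (i + 1) t))
      (Icc (0 : ℝ) T) t)
    (hE' : ∀ t ∈ Icc (0 : ℝ) T, HasDerivWithinAt E (E' t) (Icc (0 : ℝ) T) t)
    (hterm : ∀ t ∈ Icc (0 : ℝ) T,
      Summable (fun i : ℕ => (i : ℝ) * (-(i : ℝ) * ζ i t / E t
        + (1 / E t) * (1 - Q t / E t) * ((i : ℝ) * ζ i t - ((i : ℝ) + 1) * ζ (i + 1) t))) ∧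
      E' t = ∑' i : ℕ, (i : ℝ) * (-(i : ℝ) * ζ i t / E t
        + (1 / E t) * (1 - Q t / E t) * ((i : ℝ) * ζ i t - ((i : ℝ) + 1) * ζ (i + 1) t)))
    (hneg : ∀ t ∈ Icc (0 : ℝ) T, E' t / (2 * E t) + 1 / E t ≤ 0)
    (hmass : ∀ t ∈ Icc (0 : ℝ) T, ∑' i : ℕ, ζ i t = 1 - t)
    (ζΔ : ℕ → ℝ → ℝ)
    (hΔinit : ∀ i ≤ Δ, ζΔ i 0 = π i)
    (hΔtop : ∀ t ∈ Icc (0 : ℝ) T, HasDerivWithinAt (fun u => ζΔ Δ u)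
      (((Δ : ℝ) / 2) * (E' t / E t) * ζΔ Δ t) (Icc (0 : ℝ) T) t)
    (hΔmid : ∀ i < Δ, ∀ t ∈ Icc (0 : ℝ) T, HasDerivWithinAt (fun u => ζΔ i u)
      (((i : ℝ) / 2) * (E' t / E t) * ζΔ i t
        - ((i : ℝ) + 1) * ζΔ (i + 1) t * (E' t / (2 * E t) + 1 / E t))
      (Icc (0 : ℝ) T) t) :
    ∀ t ∈ Icc (0 : ℝ) T, ∀ i ≤ Δ,
      ζΔ i t ≤ ζ i t ∧ ζ i t ≤ ζΔ i t + 2 * ε := by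
  have hsum1 : ∀ t ∈ Icc (0 : ℝ) T, HasSum (fun i : ℕ => (i : ℝ) * ζ i t) (E t) := by
    intro t ht
    rw [hE t]
    exact (hs1 t ht).hasSum
  have hEQ : ∀ t ∈ Icc (0 : ℝ) T, E' t / (2 * E t) = -Q t / E t ^ 2 := by
    intro t ht
    have hEt := (hEpos t ht).ne'
    have h2 : HasSum (fun i : ℕ => (i : ℝ) * ((i : ℝ) - 1) * ζ i t) (Q t) := by
      rw [hQ t]
      exact (hs2 t ht).hasSum
    rw [(hterm t ht).2,
      (hasSum_index_mul_rhs ((1 / E t) * (1 - Q t / E t)) (hsum1 t ht) h2).tsum_eq]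
    field_simp
    ring
  have hζ : ∀ t ∈ Icc (0 : ℝ) T, ∀ i : ℕ, HasDerivWithinAt (fun u => ζ i u)
      (((i : ℝ) / 2) * (E' t / E t) * ζ i t
        - ((i : ℝ) + 1) * ζ (i + 1) t * (E' t / (2 * E t) + 1 / E t)) (Icc (0 : ℝ) T) t := by
    intro t ht i
    have hEt := (hEpos t ht).ne'
    refine (hode t ht i).congr_deriv ?_
    rw [show (i : ℝ) / 2 * (E' t / E t) = i * (E' t / (2 * E t)) by field_simp, hEQ t ht]
    field_simp
    ring
  have hlow : ∀ i ≤ Δ, ∀ t ∈ Icc (0 : ℝ) T, 0 ≤ ζ i t - ζΔ i t := by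
    intro i hi
    induction hi using Nat.decreasingInduction with
    | self =>
      refine nonneg_of_hasDerivWithinAt_logDeriv_mul_add (p := (Δ : ℝ) / 2)
        (s := fun t => ((Δ : ℝ) + 1) * ζ (Δ + 1) t * -(E' t / (2 * E t) + 1 / E t))
        hEpos hE' (fun t ht => ?_) (fun t ht => ?_) ?_
      · exact ((hζ t ht Δ).sub (hΔtop t ht)).congr_deriv (by ring)
      · exact mul_nonneg (mul_nonneg (by positivity) (hpos t ht _)) (neg_nonneg.mpr (hneg t ht))
      · simp [hinit, hΔinit Δ le_rfl]
    | @of_succ i hi ih =>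
      refine nonneg_of_hasDerivWithinAt_logDeriv_mul_add (p := (i : ℝ) / 2)
        (s := fun t => ((i : ℝ) + 1) * (ζ (i + 1) t - ζΔ (i + 1) t)
          * -(E' t / (2 * E t) + 1 / E t))
        hEpos hE' (fun t ht => ?_) (fun t ht => ?_) ?_
      · exact ((hζ t ht i).sub (hΔmid i hi t ht)).congr_deriv (by ring)
      · exact mul_nonneg (mul_nonneg (by positivity) (ih t ht)) (neg_nonneg.mpr (hneg t ht))
      · simp [hinit, hΔinit i hi.le]
  have hsumΔ : ∀ t ∈ Icc (0 : ℝ) T, 1 - ε - t ≤ ∑ i ∈ Finset.range (Δ + 1), ζΔ i t := by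
    have hderiv : ∀ t ∈ Icc (0 : ℝ) T,
        HasDerivWithinAt (fun u => ∑ i ∈ Finset.range (Δ + 1), ζΔ i u + u)
          (-(1 / E t) * ∑ i ∈ Finset.range (Δ + 1), (i : ℝ) * ζΔ i t + 1)
          (Icc (0 : ℝ) T) t := by
      intro t ht
      simp only [Finset.sum_range_succ _ Δ]
      refine (((HasDerivWithinAt.fun_sum fun i hi =>
        hΔmid i (Finset.mem_range.mp hi) t ht).add (hΔtop t ht)).add
          (hasDerivWithinAt_id t _)).congr_deriv ?_
      have h := sum_truncated_rhs (E' t / (2 * E t)) (E' t / (2 * E t) + 1 / E t)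
        (fun i => ζΔ i t) Δ
      rw [sub_add_cancel_left, Finset.sum_range_succ _ Δ] at h
      rw [← h]
      congr 2
      · exact Finset.sum_congr rfl fun i _ => by ring
      · ring
    intro t ht
    have h := le_of_hasDerivWithinAt_nonneg_Icc hderiv (fun u hu => ?_) ht
    · have h0 : ∑ i ∈ Finset.range (Δ + 1), ζΔ i 0 = ∑ i ∈ Finset.range (Δ + 1), π i :=
        Finset.sum_congr rfl fun i hi => hΔinit i (Nat.lt_succ_iff.mp (Finset.mem_range.mp hi))
      simp only [h0] at h
      linarith
    · have hle : ∑ i ∈ Finset.range (Δ + 1), (i : ℝ) * ζΔ i u ≤ E u :=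
        calc ∑ i ∈ Finset.range (Δ + 1), (i : ℝ) * ζΔ i u
            ≤ ∑ i ∈ Finset.range (Δ + 1), (i : ℝ) * ζ i u := by
              refine Finset.sum_le_sum fun i hi => mul_le_mul_of_nonneg_left ?_ i.cast_nonneg
              exact sub_nonneg.mp (hlow i (Nat.lt_succ_iff.mp (Finset.mem_range.mp hi)) u hu)
          _ ≤ E u := sum_le_hasSum _
              (fun i _ => mul_nonneg i.cast_nonneg (hpos u hu i)) (hsum1 u hu)
      have hdiv := (div_le_one (hEpos u hu)).mpr hle
      rw [div_eq_inv_mul] at hdiv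
      rw [one_div]
      linarith
  intro t ht i hi
  refine ⟨sub_nonneg.mp (hlow i hi t ht), ?_⟩
  have hsumm : Summable (fun i : ℕ => ζ i t) := by
    refine (summable_nat_add_iff 1).mp (((summable_nat_add_iff 1).mpr (hs1 t ht)).of_nonneg_of_le
      (fun j => hpos t ht _) fun j => le_mul_of_one_le_left (hpos t ht _) ?_)
    exact_mod_cast Nat.le_add_left 1 j
  have hmassΔ : ∑ j ∈ Finset.range (Δ + 1), ζ j t ≤ 1 - t :=
    hmass t ht ▸ hsumm.sum_le_tsum _ fun j _ => hpos t ht j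
  have hsingle : ζ i t - ζΔ i t ≤ ∑ j ∈ Finset.range (Δ + 1), (ζ j t - ζΔ j t) :=
    Finset.single_le_sum (f := fun j => ζ j t - ζΔ j t)
      (fun j hj => hlow j (Nat.lt_succ_iff.mp (Finset.mem_range.mp hj)) t ht)
      (Finset.mem_range.mpr (Nat.lt_succ_iff.mpr hi))
  rw [Finset.sum_sub_distrib] at hsingle
  linarith [hsumΔ t ht]
end

section
/- Let T > 0, 0 < β < 1/2, λ > 0, C > 0, z₀ ∈ ℝ, and let f : [0,T] × ℝ → ℝ be Lipschitz. For each N ≥ 1 let (Ω_N, 𝓕^N, P_N) be a probability space with a filtration (𝓕_i^N)_{i≥0} and an adapted real-valued process (Y^N(i))_{i≥0} such that: (i) Y^N(0)/N converges in probability to z₀ as N → ∞; (ii) almost surely |Y^N(i+1) − Y^N(i)| ≤ N^β for all 0 ≤ i ≤ TN; (iii) almost surely | E[ Y^N(i+1) − Y^N(i) | 𝓕_i^N ] − f( i/N , Y^N(i)/N ) | ≤ C·N^{−λ} for all 0 ≤ i ≤ TN. Then the initial value problem z′(t) = f(t, z(t)), z(0) = z₀ has a unique solution z on [0,T], and for every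 ε > 0, P_N( sup_{t∈[0,T]} | Y^N(⌊tN⌋)/N − z(t) | > ε ) → 0 as N → ∞. -/
open MeasureTheory Filter Set

/-- Picard–Lindelöf for a globally Lipschitz scalar field: solutions exist on all of `[0, T]`. -/
theorem exists_solution_of_lipschitzWith {f : ℝ → ℝ → ℝ} {K : NNReal}
    (hf : LipschitzWith K (Function.uncurry f)) {T : ℝ} (hT : 0 ≤ T) (z₀ : ℝ) :
    ∃ z : ℝ → ℝ, z 0 = z₀ ∧
      ∀ t ∈ Icc (0 : ℝ) T, HasDerivWithinAt z (f t (z t)) (Icc (0 : ℝ) T) t := by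
  have hcont : Continuous (Function.uncurry f) := hf.continuous
  have hsnd : ∀ t, LipschitzWith K (f t) := fun t =>
    (hf.comp (LipschitzWith.prodMk_left t)).weaken (mul_one K).le
  have hcont0 : Continuous fun t => f t 0 := hcont.comp (continuous_id.prodMk continuous_const)
  obtain ⟨M, hM⟩ := isCompact_Icc.exists_bound_of_continuousOn (s := Icc (0 : ℝ) T)
    hcont0.continuousOn
  have hM0 : 0 ≤ M := (norm_nonneg _).trans (hM 0 ⟨le_rfl, hT⟩)
  have hgrowth : ∀ t ∈ Icc (0 : ℝ) T, ∀ x, ‖f t x‖ ≤ K * ‖x‖ + M := fun t ht x => by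
    have h1 := (hsnd t).dist_le_mul x 0
    rw [dist_eq_norm, dist_zero_right] at h1
    have h2 := norm_sub_norm_le (f t x) (f t 0)
    linarith [hM t ht]
  set R := gronwallBound ‖z₀‖ K M T
  have hR0 : 0 ≤ R := (norm_nonneg z₀).trans <| by
    simpa only [gronwallBound_x0] using gronwallBound_mono (norm_nonneg z₀) hM0 K.coe_nonneg hT
  have hRR : -R ≤ R := by linarith
  let clamp : ℝ → ℝ := fun x => projIcc (-R) R hRR x
  have hclampR : ∀ x, ‖clamp x‖ ≤ R := fun x => abs_le.2 (projIcc (-R) R hRR x).2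
  have hclamp : LipschitzWith 1 clamp :=
    ((LipschitzWith.subtype_val _).comp (LipschitzWith.projIcc hRR)).weaken (mul_one 1).le
  have hclamp_le : ∀ x, ‖clamp x‖ ≤ ‖x‖ := fun x => by
    have h0 : clamp 0 = 0 := by
      simp [clamp, projIcc_of_mem hRR (show (0 : ℝ) ∈ Icc (-R) R from ⟨by linarith, hR0⟩)]
    simpa [h0] using hclamp.norm_sub_le x 0
  have hB0 : 0 ≤ K * R + M := by positivity
  have hpl : IsPicardLindelof (fun t x => f t (clamp x)) (tmin := 0) (tmax := T)
      ⟨0, le_rfl, hT⟩ z₀ ⟨(K * R + M) * T, by positivity⟩ 0 ⟨K * R + M, hB0⟩ K :=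
    { lipschitzOnWith := fun t _ =>
        (((hsnd t).comp hclamp).weaken (mul_one K).le).lipschitzOnWith
      continuousOn := fun x _ =>
        (hcont.comp (continuous_id.prodMk continuous_const)).continuousOn
      norm_le := fun t ht x _ => by
        refine (hgrowth t ht _).trans ?_
        change K * ‖clamp x‖ + M ≤ K * R + M
        gcongr
        exact hclampR x
      mul_max_le := by
        change (K * R + M) * max (T - 0) (0 - 0) ≤ (K * R + M) * T - 0
        simp [hT] }
  obtain ⟨z, hz0, hz⟩ := hpl.exists_eq_forall_mem_Icc_hasDerivWithinAt₀
  refine ⟨z, hz0, fun t ht => ?_⟩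
  have hzR : ‖z t‖ ≤ R := by
    refine (norm_le_gronwallBound_of_norm_deriv_right_le (δ := ‖z₀‖) (K := K) (ε := M)
      (fun s hs => (hz s hs).continuousWithinAt)
      (fun s hs => (hz s (Ico_subset_Icc_self hs)).mono_of_mem_nhdsWithin
        (Icc_mem_nhdsGE_of_mem hs)) (by simp at hz0; rw [hz0])
      (fun s hs => (hgrowth s (Ico_subset_Icc_self hs) _).trans ?_) t ht).trans ?_
    · gcongr
      exact hclamp_le _
    · exact gronwallBound_mono (norm_nonneg z₀) hM0 K.coe_nonneg (by simpa using ht.2)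
  have hfix : clamp (z t) = z t := by
    simp [clamp, projIcc_of_mem hRR (abs_le.1 hzR)]
  simpa [hfix] using hz t ht

/-- Solutions of a globally Lipschitz initial value problem are unique on `[0, T]`. -/
theorem eqOn_solution_of_lipschitzWith {f : ℝ → ℝ → ℝ} {K : NNReal}
    (hf : LipschitzWith K (Function.uncurry f)) {T : ℝ} {z w : ℝ → ℝ} (h0 : z 0 = w 0)
    (hz : ∀ t ∈ Icc (0 : ℝ) T, HasDerivWithinAt z (f t (z t)) (Icc (0 : ℝ) T) t)
    (hw : ∀ t ∈ Icc (0 : ℝ) T, HasDerivWithinAt w (f t (w t)) (Icc (0 : ℝ) T) t) :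
    EqOn z w (Icc (0 : ℝ) T) :=
  ODE_solution_unique_of_mem_Icc_right (v := f) (s := fun _ => univ)
    (fun t _ => ((hf.comp (LipschitzWith.prodMk_left t)).weaken (mul_one K).le).lipschitzOnWith)
    (fun s hs => (hz s hs).continuousWithinAt)
    (fun s hs => (hz s (Ico_subset_Icc_self hs)).mono_of_mem_nhdsWithin
        (Icc_mem_nhdsGE_of_mem hs)) (fun _ _ => mem_univ _)
    (fun s hs => (hw s hs).continuousWithinAt)
    (fun s hs => (hw s (Ico_subset_Icc_self hs)).mono_of_mem_nhdsWithin
        (Icc_mem_nhdsGE_of_mem hs)) (fun _ _ => mem_univ _) h0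

/-- A discrete Grönwall inequality in summed form. -/
theorem le_mul_exp_of_le_add_sum {e : ℕ → ℝ} {A b : ℝ} {n : ℕ} (hA : 0 ≤ A) (hb : 0 ≤ b)
    (h : ∀ k ≤ n, e k ≤ A + b * ∑ i ∈ Finset.range k, e i) :
    ∀ k ≤ n, e k ≤ A * Real.exp (b * k) := by
  have key : ∀ k ≤ n, A + b * ∑ i ∈ Finset.range k, e i ≤ A * Real.exp (b * k) := by
    intro k
    induction k with
    | zero => simp
    | succ k ih =>
      intro hk
      have ih := ih (by omega)
      have hstep := h k (by omega)
      have hexp := Real.add_one_le_exp b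
      calc A + b * ∑ i ∈ Finset.range (k + 1), e i
          = (A + b * ∑ i ∈ Finset.range k, e i) + b * e k := by
            rw [Finset.sum_range_succ]; ring
        _ ≤ A * Real.exp (b * k) + b * (A * Real.exp (b * k)) := by
            gcongr
            exact hstep.trans ih
        _ = A * Real.exp (b * k) * (b + 1) := by ring
        _ ≤ A * Real.exp (b * k) * Real.exp b := by gcongr
        _ = A * Real.exp (b * ↑(k + 1)) := by
            rw [mul_assoc, ← Real.exp_add]; push_cast; ring_nf
  exact fun k hk => (h k hk).trans (key k hk)

/-- Stability of the explicit Euler scheme with step `h` for a Lipschitz field: `m` is an additive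
noise, `c` an approximation of the drift, and `κ` the consistency error of `z`. -/
theorem abs_sub_le_of_approx_euler {f : ℝ → ℝ → ℝ} {K : NNReal}
    (hf : LipschitzWith K (Function.uncurry f)) {T h δ η κ : ℝ} {n : ℕ}
    (hh : 0 ≤ h) (hδ : 0 ≤ δ) (hη : 0 ≤ η) (hκ : 0 ≤ κ) (hn : n * h ≤ T)
    {z : ℝ → ℝ} {y c : ℕ → ℝ} (h0 : |y 0 - z 0| ≤ δ)
    (hnoise : ∀ k ≤ n, |y k - y 0 - h * ∑ i ∈ Finset.range k, c i| ≤ δ)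
    (hdrift : ∀ i < n, |c i - f (i * h) (y i)| ≤ η)
    (hz : ∀ i < n, |z ((i + 1 : ℕ) * h) - z (i * h) - h * f (i * h) (z (i * h))| ≤ h * κ) :
    ∀ k ≤ n, |y k - z (k * h)| ≤ (2 * δ + T * (η + κ)) * Real.exp (K * T) := by
  have hT : 0 ≤ T := le_trans (by positivity) hn
  have hA : 0 ≤ 2 * δ + T * (η + κ) := by positivity
  have hstep : ∀ k ≤ n, |y k - z (k * h)| ≤
      (2 * δ + T * (η + κ)) + K * h * ∑ i ∈ Finset.range k, |y i - z (i * h)| := by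
    intro k hk
    have htel : z (k * h) - z 0 =
        ∑ i ∈ Finset.range k, (z ((i + 1 : ℕ) * h) - z (i * h)) := by
      rw [Finset.sum_range_sub (fun i : ℕ => z (i * h))]; simp
    have hdecomp : y k - z (k * h) = (y k - y 0 - h * ∑ i ∈ Finset.range k, c i) + (y 0 - z 0) +
        ∑ i ∈ Finset.range k, (h * c i - (z ((i + 1 : ℕ) * h) - z (i * h))) := by
      rw [Finset.sum_sub_distrib, ← htel, Finset.mul_sum]; ring
    have hterm : ∀ i ∈ Finset.range k, |h * c i - (z ((i + 1 : ℕ) * h) - z (i * h))| ≤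
        h * (η + κ) + K * h * |y i - z (i * h)| := by
      intro i hi
      have hin : i < n := (Finset.mem_range.1 hi).trans_le hk
      have hlip : |f (i * h) (y i) - f (i * h) (z (i * h))| ≤ K * |y i - z (i * h)| := by
        simpa [Prod.dist_eq, Real.dist_eq] using
          hf.dist_le_mul ((i : ℝ) * h, y i) ((i : ℝ) * h, z (i * h))
      have e1 := abs_le.1 (hdrift i hin)
      have e2 := abs_le.1 (hz i hin)
      have e3 := abs_le.1 hlip
      rw [abs_le]
      constructor <;> nlinarith
    calc |y k - z (k * h)|
        ≤ |y k - y 0 - h * ∑ i ∈ Finset.range k, c i| + |y 0 - z 0| +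
          |∑ i ∈ Finset.range k, (h * c i - (z ((i + 1 : ℕ) * h) - z (i * h)))| := by
          rw [hdecomp]; exact abs_add_three _ _ _
      _ ≤ δ + δ + ∑ i ∈ Finset.range k, (h * (η + κ) + K * h * |y i - z (i * h)|) := by
          gcongr
          · exact hnoise k hk
          · exact (Finset.abs_sum_le_sum_abs _ _).trans (Finset.sum_le_sum hterm)
      _ = 2 * δ + (k * h) * (η + κ) + K * h * ∑ i ∈ Finset.range k, |y i - z (i * h)| := by
          rw [Finset.sum_add_distrib, ← Finset.mul_sum (a := (K : ℝ) * h),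
            Finset.sum_const, Finset.card_range, nsmul_eq_mul]
          ring
      _ ≤ _ := by
          gcongr
          exact le_trans (by gcongr) hn
  intro k hk
  refine (le_mul_exp_of_le_add_sum hA (by positivity) hstep k hk).trans ?_
  have : (K : ℝ) * h * k ≤ K * T := by
    rw [mul_assoc, mul_comm h]
    gcongr
    exact le_trans (by gcongr) hn
  gcongr

/-- Increments of a martingale are orthogonal, so its second moment grows at most linearly. -/
theorem MeasureTheory.Martingale.integral_sq_le_of_bdd_difference {Ω : Type*}
    {m0 : MeasurableSpace Ω} {μ : Measure Ω} [IsProbabilityMeasure μ] {ℱ : Filtration ℕ m0}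
    {M : ℕ → Ω → ℝ} (hM : Martingale M ℱ μ) (hM0 : M 0 = 0) {R : ℝ}
    (hR : ∀ᵐ ω ∂μ, ∀ i, |M (i + 1) ω - M i ω| ≤ R) (n : ℕ) :
    Integrable (fun ω => M n ω ^ 2) μ ∧ ∫ ω, M n ω ^ 2 ∂μ ≤ n * R ^ 2 := by
  have hbound : ∀ n : ℕ, ∀ᵐ ω ∂μ, |M n ω| ≤ n * R := by
    intro n
    filter_upwards [hR] with ω hω
    induction n with
    | zero => simp [hM0]
    | succ n ih =>
      calc |M (n + 1) ω| = |(M (n + 1) ω - M n ω) + M n ω| := by ring_nf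
        _ ≤ R + n * R := (abs_add_le _ _).trans (add_le_add (hω n) ih)
        _ = _ := by push_cast; ring
  have hmeas : ∀ n, AEStronglyMeasurable (M n) μ := fun n => (hM.integrable n).1
  induction n with
  | zero => simp [hM0]
  | succ n ih =>
    set D : Ω → ℝ := M (n + 1) - M n with hD
    have hDint : Integrable D μ := (hM.integrable _).sub (hM.integrable _)
    have hDR : ∀ᵐ ω ∂μ, |D ω| ≤ R := hR.mono fun ω hω => hω n
    have hD2 : Integrable (fun ω => D ω ^ 2) μ := by
      refine Integrable.of_bound (hDint.1.pow 2) (R ^ 2) ?_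
      filter_upwards [hDR] with ω hω
      simpa using pow_le_pow_left₀ (abs_nonneg _) hω 2
    have hMD : Integrable (M n * D) μ :=
      hDint.bdd_mul (hmeas n) (c := n * R) (by simpa using hbound n)
    have hDcond : μ[D | ℱ n] =ᵐ[μ] 0 := by
      filter_upwards [condExp_sub (hM.integrable (n + 1)) (hM.integrable n) (ℱ n),
        hM.condExp_ae_eq n.le_succ, hM.condExp_ae_eq (le_refl n)] with ω h1 h2 h3
      simp [hD, h1, h2, h3]
    have horth : ∫ ω, (M n * D) ω ∂μ = 0 := by
      rw [← integral_condExp (ℱ.le n), integral_eq_zero_of_ae]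
      filter_upwards [condExp_mul_of_stronglyMeasurable_left (hM.stronglyMeasurable n) hMD hDint,
        hDcond] with ω h1 h2
      simp [h1, h2]
    have hexp : (fun ω => M (n + 1) ω ^ 2) =
        fun ω => (M n ω ^ 2 + 2 * (M n * D) ω) + D ω ^ 2 := by
      funext ω
      simp only [hD, Pi.mul_apply, Pi.sub_apply]
      ring
    have h12 : Integrable (fun ω => M n ω ^ 2 + 2 * (M n * D) ω) μ := ih.1.add (hMD.const_mul 2)
    refine ⟨hexp ▸ h12.add hD2, ?_⟩
    have hDle : ∫ ω, D ω ^ 2 ∂μ ≤ R ^ 2 := by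
      calc ∫ ω, D ω ^ 2 ∂μ ≤ ∫ _, R ^ 2 ∂μ := by
            refine integral_mono_ae hD2 (integrable_const _) ?_
            filter_upwards [hDR] with ω hω
            simpa using pow_le_pow_left₀ (abs_nonneg _) hω 2
        _ = R ^ 2 := by simp
    rw [hexp, integral_add h12 hD2, integral_add ih.1 (hMD.const_mul 2), integral_const_mul, horth]
    push_cast
    linarith [ih.2]

/-- A maximal inequality for martingales with bounded increments. -/
theorem MeasureTheory.Martingale.measure_exists_le_abs_le {Ω : Type*}
    {m0 : MeasurableSpace Ω} {μ : Measure Ω} [IsProbabilityMeasure μ] {ℱ : Filtration ℕ m0}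
    {M : ℕ → Ω → ℝ} (hM : Martingale M ℱ μ) (hM0 : M 0 = 0) {R : ℝ} (hR0 : 0 ≤ R)
    (hR : ∀ᵐ ω ∂μ, ∀ i, |M (i + 1) ω - M i ω| ≤ R) (n : ℕ) {a : ℝ} (ha : 0 < a) :
    μ {ω | ∃ k ≤ n, a ≤ |M k ω|} ≤ ENNReal.ofReal (√n * R / a) := by
  obtain ⟨hsq, hsqle⟩ := hM.integral_sq_le_of_bdd_difference hM0 hR n
  have hsub : Submartingale (fun k ω => |M k ω|) ℱ μ :=
    hM.submartingale.sup hM.neg.submartingale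
  have hL1 : ∫ ω, |M n ω| ∂μ ≤ √n * R := by
    have hvar := ProbabilityTheory.variance_nonneg (fun ω => |M n ω|) μ
    have hmem : MemLp (fun ω => |M n ω|) 2 μ := by
      rw [memLp_two_iff_integrable_sq (hsub.integrable n).1]
      simpa using hsq
    rw [ProbabilityTheory.variance_eq_sub hmem] at hvar
    simp only [Pi.pow_apply, sq_abs] at hvar
    have h1 : (∫ ω, |M n ω| ∂μ) ^ 2 ≤ (√n * R) ^ 2 := by
      rw [mul_pow, Real.sq_sqrt n.cast_nonneg]
      linarith
    exact le_of_sq_le_sq h1 (by positivity)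
  lift a to NNReal using ha.le
  have ha' : (a : ENNReal) ≠ 0 := by exact_mod_cast ha.ne'
  have hset : {ω | ∃ k ≤ n, (a : ℝ) ≤ |M k ω|} = {ω | (a : ℝ) ≤
      (Finset.range (n + 1)).sup' Finset.nonempty_range_add_one fun k => |M k ω|} := by
    ext ω
    simp [Finset.le_sup'_iff]
  have hmax := maximal_ineq hsub (fun _ _ => abs_nonneg _) (ε := a) n
  rw [ENNReal.ofReal_div_of_pos ha, ENNReal.le_div_iff_mul_le (by simp [ha']) (by simp),
    mul_comm, ENNReal.ofReal_coe_nnreal, hset]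
  refine hmax.trans (ENNReal.ofReal_le_ofReal (le_trans ?_ hL1))
  exact setIntegral_le_integral (hsub.integrable n) (Eventually.of_forall fun _ => abs_nonneg _)

/-- With high probability, an adapted process with bounded increments stays close to the sum of its
conditional drifts up to time `n`. -/
theorem measure_exists_le_abs_sub_sum_condExp_le {Ω : Type*}
    {m0 : MeasurableSpace Ω} {μ : Measure Ω} [IsProbabilityMeasure μ] {ℱ : Filtration ℕ m0}
    {Y : ℕ → Ω → ℝ} (hY : Adapted ℱ Y) {R : ℝ} (hR0 : 0 ≤ R) {n : ℕ}
    (hR : ∀ᵐ ω ∂μ, ∀ i < n, |Y (i + 1) ω - Y i ω| ≤ R) {a : ℝ} (ha : 0 < a) :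
    μ {ω | ∃ k ≤ n, a ≤ |Y k ω - Y 0 ω -
        ∑ i ∈ Finset.range k, (μ[fun ω' => Y (i + 1) ω' - Y i ω' | ℱ i]) ω|} ≤
      ENNReal.ofReal (√n * (2 * R) / a) := by
  let X : ℕ → Ω → ℝ := fun k ω => Y (min k n) ω - Y 0 ω
  have hX : StronglyAdapted ℱ X := fun k =>
    (((hY (min k n)).mono (ℱ.mono (min_le_left _ _)) le_rfl).sub
      ((hY 0).mono (ℱ.mono (Nat.zero_le k)) le_rfl)).stronglyMeasurable
  have hXdiff : ∀ᵐ ω ∂μ, ∀ i, ‖X (i + 1) ω - X i ω‖ ≤ R := by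
    filter_upwards [hR] with ω hω i
    rcases lt_or_ge i n with hi | hi
    · have h1 : min (i + 1) n = i + 1 := by omega
      have h2 : min i n = i := by omega
      simpa [X, h1, h2] using hω i hi
    · have h1 : min (i + 1) n = n := by omega
      have h2 : min i n = n := by omega
      simpa [X, h1, h2] using hR0
  have hXint : ∀ k, Integrable (X k) μ := fun k => by
    refine Integrable.of_bound ((hX k).mono (ℱ.le k)).aestronglyMeasurable (k * R) ?_
    filter_upwards [hXdiff] with ω hω
    induction k with
    | zero => simp [X]
    | succ k ih =>
      calc ‖X (k + 1) ω‖ = ‖(X (k + 1) ω - X k ω) + X k ω‖ := by ring_nf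
        _ ≤ R + k * R := (norm_add_le _ _).trans (add_le_add (hω k) ih)
        _ = _ := by push_cast; ring
  refine le_trans (measure_mono ?_) ((martingale_martingalePart hX hXint).measure_exists_le_abs_le
    (by ext ω; simp [X]) (by positivity) (martingalePart_bdd_difference ℱ hXdiff) n ha)
  rintro ω ⟨k, hk, hak⟩
  refine ⟨k, hk, hak.trans_eq ?_⟩
  have hsum : predictablePart X ℱ μ k =
      ∑ i ∈ Finset.range k, μ[fun ω' => Y (i + 1) ω' - Y i ω' | ℱ i] := by
    refine Finset.sum_congr rfl fun i hi => ?_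
    have hik := Finset.mem_range.1 hi
    have h1 : min (i + 1) n = i + 1 := by omega
    have h2 : min i n = i := by omega
    congr 1
    ext ω'
    simp [X, h1, h2]
  have hk' : min k n = k := by omega
  simp [martingalePart, hsum, X, hk']

/-- A solution is Lipschitz, and satisfies the explicit Euler scheme up to a second order error. -/
theorem exists_lipschitz_and_euler_consistency {f : ℝ → ℝ → ℝ} {K : NNReal}
    (hf : LipschitzWith K (Function.uncurry f)) {T : ℝ} {z : ℝ → ℝ}
    (hz : ∀ t ∈ Icc (0 : ℝ) T, HasDerivWithinAt z (f t (z t)) (Icc (0 : ℝ) T) t) :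
    ∃ L : ℝ, 0 ≤ L ∧
      (∀ s ∈ Icc (0 : ℝ) T, ∀ t ∈ Icc (0 : ℝ) T, |z t - z s| ≤ L * |t - s|) ∧
      ∀ s t, 0 ≤ s → s ≤ t → t ≤ T →
        |z t - z s - (t - s) * f s (z s)| ≤ (t - s) * (K * (1 + L) * (t - s)) := by
  have hzc : ContinuousOn z (Icc 0 T) := fun t ht => (hz t ht).continuousWithinAt
  obtain ⟨L, hL⟩ := isCompact_Icc.exists_bound_of_continuousOn
    (hf.continuous.comp_continuousOn (continuousOn_id.prodMk hzc))
  have hlip : ∀ s ∈ Icc (0 : ℝ) T, ∀ t ∈ Icc (0 : ℝ) T, |z t - z s| ≤ max L 0 * |t - s| :=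
    fun s hs t ht => (convex_Icc 0 T).norm_image_sub_le_of_norm_hasDerivWithin_le hz
      (fun x hx => (hL x hx).trans (le_max_left _ _)) hs ht
  refine ⟨max L 0, le_max_right _ _, hlip, fun s t hs hst htT => ?_⟩
  have hsub : Icc s t ⊆ Icc 0 T := Icc_subset_Icc hs htT
  have hsmem : s ∈ Icc s t := left_mem_Icc.2 hst
  have hbound : ∀ u ∈ Icc s t, ‖f u (z u) - f s (z s)‖ ≤ K * (1 + max L 0) * (t - s) := by
    intro u hu
    have h1 : ‖f u (z u) - f s (z s)‖ ≤ K * max |u - s| |z u - z s| := by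
      simpa [Prod.dist_eq, Real.dist_eq] using hf.dist_le_mul (u, z u) (s, z s)
    have h2 := hlip s (hsub hsmem) u (hsub hu)
    have h3 : |u - s| ≤ t - s := by
      rw [abs_of_nonneg (sub_nonneg.2 hu.1)]
      linarith [hu.2]
    refine h1.trans ?_
    rw [mul_assoc]
    gcongr
    have hL0 : 0 ≤ max L 0 := le_max_right _ _
    have h4 : max L 0 * |u - s| ≤ max L 0 * (t - s) := by gcongr
    have h5 : 0 ≤ max L 0 * (t - s) := mul_nonneg hL0 (sub_nonneg.2 hst)
    exact max_le (by linarith) (by linarith)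
  have hder : ∀ u ∈ Icc s t, HasDerivWithinAt (fun u => z u - u * f s (z s))
      (f u (z u) - f s (z s)) (Icc s t) u := fun u hu => by
    have h := ((hasDerivWithinAt_id u (Icc s t)).mul_const (f s (z s)))
    rw [one_mul] at h
    exact ((hz u (hsub hu)).mono hsub).sub h
  have h := (convex_Icc s t).norm_image_sub_le_of_norm_hasDerivWithin_le hder hbound hsmem
    (right_mem_Icc.2 hst)
  rw [Real.norm_eq_abs, Real.norm_of_nonneg (sub_nonneg.2 hst)] at h
  calc |z t - z s - (t - s) * f s (z s)|
      = |z t - t * f s (z s) - (z s - s * f s (z s))| := by ring_nf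
    _ ≤ _ := by linarith

/-- The martingale fluctuation bound, at scale `N` over a horizon proportional to `N`,
vanishes when the increments are `O(N ^ β)` with `β < 1 / 2`. -/
theorem tendsto_sqrt_mul_rpow_div_zero {T β δ : ℝ} (hT : 0 ≤ T) (hβ : β < 1 / 2) (hδ : 0 < δ) :
    Tendsto (fun N : ℕ => √(⌊T * N⌋₊ : ℝ) * (2 * (N : ℝ) ^ β) / (δ * N)) atTop (nhds 0) := by
  have hlim : Tendsto (fun N : ℕ => 2 * √T / δ * (N : ℝ) ^ (-(1 / 2 - β))) atTop (nhds 0) := by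
    simpa using ((tendsto_rpow_neg_atTop (by linarith : 0 < 1 / 2 - β)).comp
      tendsto_natCast_atTop_atTop).const_mul (2 * √T / δ)
  refine squeeze_zero' (Eventually.of_forall fun N => by positivity) ?_ hlim
  filter_upwards [eventually_gt_atTop 0] with N hN
  have hN' : (0 : ℝ) < N := by exact_mod_cast hN
  have hs : √(⌊T * N⌋₊ : ℝ) ≤ √T * (N : ℝ) ^ (1 / 2 : ℝ) := by
    rw [← Real.sqrt_eq_rpow, ← Real.sqrt_mul hT]
    exact Real.sqrt_le_sqrt (Nat.floor_le (by positivity))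
  have hp : (N : ℝ) ^ (1 / 2 : ℝ) * (N : ℝ) ^ β = (N : ℝ) ^ (-(1 / 2 - β)) * N := by
    nth_rewrite 4 [← Real.rpow_one (N : ℝ)]
    rw [← Real.rpow_add hN', ← Real.rpow_add hN']
    ring_nf
  calc √(⌊T * N⌋₊ : ℝ) * (2 * (N : ℝ) ^ β) / (δ * N)
      ≤ √T * (N : ℝ) ^ (1 / 2 : ℝ) * (2 * (N : ℝ) ^ β) / (δ * N) := by gcongr
    _ = 2 * √T * ((N : ℝ) ^ (1 / 2 : ℝ) * (N : ℝ) ^ β) / (δ * N) := by ring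
    _ = 2 * √T / δ * (N : ℝ) ^ (-(1 / 2 - β)) := by
      rw [hp]
      field_simp

/-- Wormald's differential equation method (Theorem 9 of the paper): if a family of
adapted processes `Y^N` has small increments and conditional drift close to
`f(i/N, Y^N(i)/N)` for a Lipschitz function `f`, then the initial value problem
`z' = f(t, z)`, `z(0) = z₀` has a unique solution on `[0,T]` and `Y^N(⌊tN⌋)/N` converges
to it uniformly in probability. -/
theorem wormald_differential_equation_method
    (T : ℝ) (hT : 0 < T)
    (β lam C z₀ : ℝ) (hβ0 : 0 < β) (hβ : β < 1 / 2) (hlam : 0 < lam) (hC : 0 < C)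
    (f : ℝ → ℝ → ℝ) (K : NNReal) (hf : LipschitzWith K (Function.uncurry f))
    (Ω : ℕ → Type) (mΩ : ∀ N, MeasurableSpace (Ω N))
    (P : ∀ N, Measure (Ω N)) (hP : ∀ N, IsProbabilityMeasure (P N))
    (ℱ : ∀ N, Filtration ℕ (mΩ N))
    (Y : ∀ N, ℕ → Ω N → ℝ)
    (hadapted : ∀ N, Adapted (ℱ N) (Y N))
    (hinit : ∀ ε > (0 : ℝ),
      Tendsto (fun N : ℕ => P N {ω | ε < |Y N 0 ω / N - z₀|}) atTop (nhds 0))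
    (hincrement : ∀ N : ℕ, 1 ≤ N → ∀ᵐ ω ∂(P N), ∀ i : ℕ, (i : ℝ) ≤ T * N →
      |Y N (i + 1) ω - Y N i ω| ≤ (N : ℝ) ^ β)
    (hdrift : ∀ N : ℕ, 1 ≤ N → ∀ i : ℕ, (i : ℝ) ≤ T * N →
      ∀ᵐ ω ∂(P N),
        |((P N)[fun ω' => Y N (i + 1) ω' - Y N i ω' | (ℱ N) i]) ω
            - f ((i : ℝ) / N) (Y N i ω / N)|
          ≤ C * (N : ℝ) ^ (-lam)) :
    ∃ z : ℝ → ℝ, z 0 = z₀ ∧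
      (∀ t ∈ Icc (0 : ℝ) T, HasDerivWithinAt z (f t (z t)) (Icc (0 : ℝ) T) t) ∧
      (∀ z' : ℝ → ℝ, z' 0 = z₀ →
        (∀ t ∈ Icc (0 : ℝ) T, HasDerivWithinAt z' (f t (z' t)) (Icc (0 : ℝ) T) t) →
        EqOn z z' (Icc (0 : ℝ) T)) ∧
      (∀ ε > (0 : ℝ),
        Tendsto (fun N : ℕ =>
            P N {ω | ε < ⨆ t : Icc (0 : ℝ) T, |Y N ⌊(t : ℝ) * N⌋₊ ω / N - z t|})
          atTop (nhds 0)) := by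
  obtain ⟨z, hz0, hz⟩ := exists_solution_of_lipschitzWith hf hT.le z₀
  refine ⟨z, hz0, hz, fun z' hz'0 hz' =>
    eqOn_solution_of_lipschitzWith hf (hz0.trans hz'0.symm) hz hz', fun ε hε => ?_⟩
  obtain ⟨L, hL0, hzlip, hzeuler⟩ := exists_lipschitz_and_euler_consistency hf hz
  set δ : ℝ := ε / (4 * Real.exp (K * T)) with hδdef
  have hδ : 0 < δ := by positivity
  have herr : ∀ᶠ N : ℕ in atTop, (2 * δ + T * (C * (N : ℝ) ^ (-lam) + K * (1 + L) * (N : ℝ)⁻¹)) *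
      Real.exp (K * T) + L * (N : ℝ)⁻¹ < ε := by
    have h1 : Tendsto (fun N : ℕ => (N : ℝ)⁻¹) atTop (nhds 0) := tendsto_inv_atTop_nhds_zero_nat
    have h2 : Tendsto (fun N : ℕ => (N : ℝ) ^ (-lam)) atTop (nhds 0) :=
      (tendsto_rpow_neg_atTop hlam).comp tendsto_natCast_atTop_atTop
    refine (((((h2.const_mul C).add (h1.const_mul (K * (1 + L)))).const_mul T).const_add
      (2 * δ)).mul_const (Real.exp (K * T)) |>.add (h1.const_mul L)).eventually_lt_const ?_
    have : 2 * δ * Real.exp (K * T) = ε / 2 := by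
      rw [hδdef]
      field_simp
      norm_num
    simp only [mul_zero, add_zero, this]
    linarith
  have hlim : Tendsto (fun N : ℕ => P N {ω | δ < |Y N 0 ω / N - z₀|} +
      ENNReal.ofReal (√(⌊T * N⌋₊ : ℝ) * (2 * (N : ℝ) ^ β) / (δ * N))) atTop (nhds 0) := by
    simpa using (hinit δ hδ).add (ENNReal.tendsto_ofReal
      (tendsto_sqrt_mul_rpow_div_zero hT.le hβ hδ))
  refine tendsto_of_tendsto_of_tendsto_of_le_of_le' tendsto_const_nhds hlim
    (Eventually.of_forall fun _ => zero_le) ?_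
  filter_upwards [herr, eventually_ge_atTop 1] with N hNerr hN
  have hN0 : (0 : ℝ) < N := by exact_mod_cast hN
  set n := ⌊T * N⌋₊
  have hle : ∀ i : ℕ, i ≤ n → (i : ℝ) ≤ T * N := fun i hi =>
    (Nat.le_floor_iff (by positivity)).1 hi
  have hfluct := measure_exists_le_abs_sub_sum_condExp_le (μ := P N) (hadapted N)
    (R := (N : ℝ) ^ β) (by positivity) (n := n)
    (by filter_upwards [hincrement N hN] with ω hω i hi using hω i (hle i hi.le))
    (mul_pos hδ hN0)
  have hdrift' : ∀ᵐ ω ∂(P N), ∀ i < n,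
      |((P N)[fun ω' => Y N (i + 1) ω' - Y N i ω' | (ℱ N) i]) ω
        - f ((i : ℝ) / N) (Y N i ω / N)| ≤ C * (N : ℝ) ^ (-lam) :=
    ae_all_iff.2 fun i => by
      by_cases hi : i < n
      · filter_upwards [hdrift N hN i (hle i hi.le)] with ω hω _ using hω
      · exact Eventually.of_forall fun _ h => absurd h hi
  refine le_trans (le_trans (measure_mono_ae ?_) (measure_union_le _ _))
    (add_le_add_right hfluct _)
  filter_upwards [hdrift'] with ω hω hωε
  by_contra hgood
  change ¬(_ ∨ _) at hgood
  simp only [not_or, mem_ofPred_eq, not_lt, not_exists, not_and, not_le] at hgood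
  obtain ⟨hgood0, hgoodM⟩ := hgood
  refine absurd hωε (not_lt.2 ?_)
  have hmesh : ∀ i ≤ n, (i : ℝ) * (N : ℝ)⁻¹ ≤ T := fun i hi => by
    rw [← div_eq_mul_inv, div_le_iff₀ hN0]
    exact hle i hi
  have hgrid := abs_sub_le_of_approx_euler hf (T := T) (h := (N : ℝ)⁻¹) (δ := δ)
    (η := C * (N : ℝ) ^ (-lam)) (κ := K * (1 + L) * (N : ℝ)⁻¹) (n := n) (by positivity) hδ.le
    (by positivity) (by positivity) (hmesh n le_rfl) (z := z) (y := fun i => Y N i ω / N)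
    (c := fun i => ((P N)[fun ω' => Y N (i + 1) ω' - Y N i ω' | (ℱ N) i]) ω)
    (by simpa only [hz0] using hgood0)
    (fun k hk => by
      have h := (hgoodM k hk).le
      rw [← div_le_iff₀ hN0, ← abs_of_pos hN0, ← abs_div] at h
      simpa only [sub_div, div_eq_inv_mul, mul_sub] using h)
    (fun i hi => by simpa only [← div_eq_mul_inv] using hω i hi)
    (fun i hi => by
      have hstep : ((i + 1 : ℕ) : ℝ) * (N : ℝ)⁻¹ - i * (N : ℝ)⁻¹ = (N : ℝ)⁻¹ := by
        push_cast
        ring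
      have h := hzeuler (i * (N : ℝ)⁻¹) ((i + 1 : ℕ) * (N : ℝ)⁻¹) (by positivity)
        (by gcongr; omega) (hmesh _ hi)
      rwa [hstep] at h)
  have : Nonempty (Icc (0 : ℝ) T) := ⟨⟨0, le_rfl, hT.le⟩⟩
  refine ciSup_le fun ⟨t, ht0, htT⟩ => ?_
  have htN : 0 ≤ t * N := by positivity
  set k := ⌊t * N⌋₊
  have hkn : k ≤ n := Nat.floor_le_floor (by gcongr)
  have hkt : (k : ℝ) * (N : ℝ)⁻¹ ≤ t := by
    rw [← div_eq_mul_inv, div_le_iff₀ hN0]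
    exact Nat.floor_le htN
  have htk : t - k * (N : ℝ)⁻¹ ≤ (N : ℝ)⁻¹ := by
    have h1 : t * N < k + 1 := Nat.lt_floor_add_one _
    have h2 : t < (k + 1) / N := (lt_div_iff₀ hN0).2 h1
    rw [div_eq_mul_inv] at h2
    linarith
  have h1 := hgrid k hkn
  have h2 := hzlip t ⟨ht0, htT⟩ (k * (N : ℝ)⁻¹) ⟨by positivity, hmesh k hkn⟩
  rw [abs_sub_comm _ t, abs_of_nonneg (sub_nonneg.2 hkt)] at h2
  have h3 : L * (t - k * (N : ℝ)⁻¹) ≤ L * (N : ℝ)⁻¹ := by gcongr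
  calc |Y N k ω / N - z t| ≤ |Y N k ω / N - z (k * (N : ℝ)⁻¹)| + |z (k * (N : ℝ)⁻¹) - z t| :=
        abs_sub_le _ _ _
    _ ≤ ε := by linarith
end

section
/- Let 0 < p < 1 and let f(s) = p/(1−(1−p)s) be the generating function of the geometric distribution started at 0 with parameter p, with inverse f⁻¹(y) = (1 − p/y)/(1−p) for y > 0. Then for every α ∈ [0,1) and every s ∈ [0,1], g(α,s) := (1/(1−α))·f( f⁻¹(1−α) − (1−s)·f′(f⁻¹(1−α))/f′(1) ) = p(α)/( 1 − (1−p(α))·s ), where p(α) = p/( p + (1−p)(1−α)³ ). In other words, g(α,·) is the generating function of the geometric distribution started at 0 with parameter p(α). -/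
open Set

/-- The derivative of the generating function of the geometric distribution started at `0`. -/
theorem hasDerivAt_geometric_generatingFunction {p x : ℝ} (hx : 1 - (1 - p) * x ≠ 0) :
    HasDerivAt (fun s : ℝ => p / (1 - (1 - p) * s)) (p * (1 - p) / (1 - (1 - p) * x) ^ 2) x := by
  have hden : HasDerivAt (fun s : ℝ => 1 - (1 - p) * s) (-(1 - p)) x := by
    simpa using ((hasDerivAt_id x).const_mul (1 - p)).const_sub 1
  exact ((hasDerivAt_const x p).fun_div hden hx).congr_deriv (by ring)

/-- Geometric case (Section 3.3 of the paper): for `f` the generating function of the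
geometric distribution started at `0` with parameter `p`, the distribution with
generating function `g(α,s) = (1/(1-α)) f(f⁻¹(1-α) - (1-s) f'(f⁻¹(1-α)) / f'(1))` is the
geometric distribution started at `0` with parameter `p(α) = p / (p + (1-p)(1-α)³)`. -/
theorem geometric_remaining_degree_distribution
    (p : ℝ) (hp0 : 0 < p) (hp1 : p < 1)
    (f finv : ℝ → ℝ)
    (hf : f = fun s => p / (1 - (1 - p) * s))
    (hfinv : finv = fun y => (1 - p / y) / (1 - p))
    (pα : ℝ → ℝ)
    (hpα : ∀ α, pα α = p / (p + (1 - p) * (1 - α) ^ 3)) :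
    ∀ α ∈ Ico (0 : ℝ) 1, ∀ s ∈ Icc (0 : ℝ) 1,
      (1 / (1 - α)) * f (finv (1 - α) - (1 - s) * deriv f (finv (1 - α)) / deriv f 1)
        = pα α / (1 - (1 - pα α) * s) := by
  rintro α ⟨-, hα⟩ s ⟨-, hs⟩
  have hy : 0 < 1 - α := by linarith
  generalize hyα : 1 - α = y at hy
  have hq : 0 < 1 - p := by linarith
  have hinv : 1 - (1 - p) * ((1 - p / y) / (1 - p)) = p / y := by
    field_simp
    ring
  have hone : 1 - (1 - p) * 1 = p := by ring
  have hderiv_inv : deriv f (finv y) = p * (1 - p) / (p / y) ^ 2 := by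
    have h := hasDerivAt_geometric_generatingFunction (p := p) (x := (1 - p / y) / (1 - p))
      (by rw [hinv]; positivity)
    rw [hinv] at h
    rw [hf, hfinv]
    exact h.deriv
  have hderiv_one : deriv f 1 = p * (1 - p) / p ^ 2 := by
    have h := hasDerivAt_geometric_generatingFunction (p := p) (x := 1) (by rw [hone]; positivity)
    rw [hone] at h
    rw [hf]
    exact h.deriv
  have hratio : (1 - s) * deriv f (finv y) / deriv f 1 = (1 - s) * y ^ 2 := by
    rw [hderiv_inv, hderiv_one]
    field_simp
  have hs' : 0 ≤ 1 - s := by linarith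
  have hden : 0 < p + (1 - p) * y ^ 3 * (1 - s) := by positivity
  have hD : 0 < p + (1 - p) * y ^ 3 := by positivity
  have harg : 1 - (1 - p) * (finv y - (1 - s) * y ^ 2)
      = (p + (1 - p) * y ^ 3 * (1 - s)) / y := by
    rw [mul_sub, ← sub_add, hfinv, hinv]
    field_simp
  have hparam : 1 - (1 - p / (p + (1 - p) * y ^ 3)) * s
      = (p + (1 - p) * y ^ 3 * (1 - s)) / (p + (1 - p) * y ^ 3) := by
    field_simp
    ring
  have hval : f (finv y - (1 - s) * y ^ 2) = p / ((p + (1 - p) * y ^ 3 * (1 - s)) / y) := by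
    rw [← harg, hf]
  rw [hratio, hval, hpα, hyα, hparam]
  field_simp
end

section
/- Let 0 < p < 2/3 and, for α ∈ [0,1) and s ∈ [0,1], set ĝ(α,s) = ( p(α)/( 1 − (1−p(α))·s ) )² where p(α) = p/( p + (1−p)(1−α)³ ). Then for every ρ ∈ (0,1), the number α(ρ) = 1 − ( p/(1−p) )^{1/3} · ( 1/( 1−ρ + √(1−ρ) ) )^{1/3} satisfies the equation 1 − ρ = ĝ( α(ρ), 1 − ρ ). -/
open Set

/-- Geometric case (Section 3.3 of the paper): the function
`α(ρ) = 1 - (p/(1-p))^(1/3) (1/(1-ρ+√(1-ρ)))^(1/3)` solves the equation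
`1 - ρ = ĝ(α(ρ), 1-ρ)` where `ĝ(α,s) = (p(α)/(1-(1-p(α))s))²` and
`p(α) = p/(p + (1-p)(1-α)³)`. -/
theorem geometric_alpha_solves_fixed_point
    (p : ℝ) (hp0 : 0 < p) (hp1 : p < 2 / 3)
    (ρ : ℝ) (hρ : ρ ∈ Ioo (0 : ℝ) 1)
    (α : ℝ)
    (hα : α = 1 - (p / (1 - p)) ^ ((1 : ℝ) / 3)
      * (1 / (1 - ρ + Real.sqrt (1 - ρ))) ^ ((1 : ℝ) / 3))
    (pα : ℝ)
    (hpα : pα = p / (p + (1 - p) * (1 - α) ^ 3)) :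
    1 - ρ = (pα / (1 - (1 - pα) * (1 - ρ))) ^ 2 := by
  obtain ⟨-, hρ1⟩ := hρ
  obtain ⟨t, ht, htρ⟩ : ∃ t : ℝ, 0 < t ∧ 1 - ρ = t ^ 2 :=
    ⟨√(1 - ρ), Real.sqrt_pos.2 (by linarith), (Real.sq_sqrt (by linarith)).symm⟩
  have h1p : 0 < 1 - p := by linarith
  have rpow_third_pow : ∀ x : ℝ, 0 < x → (x ^ ((1 : ℝ) / 3)) ^ 3 = x := fun x hx => by
    rw [← Real.rpow_natCast, ← Real.rpow_mul hx.le]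
    norm_num
  rw [htρ, Real.sqrt_sq ht.le] at hα
  have hcube : (1 - α) ^ 3 = p / (1 - p) * (1 / (t ^ 2 + t)) := by
    rw [hα, sub_sub_cancel, mul_pow, rpow_third_pow _ (by positivity),
      rpow_third_pow _ (by positivity)]
  have hpα' : pα = (t ^ 2 + t) / (t ^ 2 + t + 1) := by
    rw [hpα, hcube]
    field_simp
  have hden : 1 - (1 - pα) * t ^ 2 = (t + 1) / (t ^ 2 + t + 1) := by
    rw [hpα']
    field_simp
    ring
  have hratio : pα / (1 - (1 - pα) * t ^ 2) = t := by
    rw [hden, hpα']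
    field_simp
  rw [htρ, hratio]
end
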